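/- For every integer n ≥ 11, the rainbow number of the matching 5K₂ with respect to the class of plane triangulations on n vertices equals 2n + 1; that is, rb(𝒯ₙ, 5K₂) = 2n + 1. -/

import Mathlib

/-- A topological planar embedding of a simple graph `G`: an injective placement `f` of the
vertices in the plane together with, for each edge, an arc `γ e : ℝ → ℝ × ℝ` that is
continuous and injective on `[0,1]`, joins the images of the two endpoints of the edge,
whose interior avoids all vertex images, and such that interiors of distinct arcs are
pairwise disjoint. -/
def SimpleGraph.IsPlanarEmbedding {V : Type*} (G : SimpleGraph V) (f : V → ℝ × ℝ)
    (γ : G.edgeSet → ℝ → ℝ × ℝ) : Prop :=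
  Function.Injective f ∧
  (∀ e : G.edgeSet, ContinuousOn (γ e) (Set.Icc 0 1)) ∧
  (∀ e : G.edgeSet, Set.InjOn (γ e) (Set.Icc 0 1)) ∧
  (∀ e : G.edgeSet, ∃ u v : V, (e : Sym2 V) = s(u, v) ∧ γ e 0 = f u ∧ γ e 1 = f v) ∧
  (∀ e : G.edgeSet, ∀ t ∈ Set.Ioo (0 : ℝ) 1, ∀ v : V, γ e t ≠ f v) ∧
  (∀ e₁ e₂ : G.edgeSet, e₁ ≠ e₂ → ∀ t₁ ∈ Set.Ioo (0 : ℝ) 1, ∀ t₂ ∈ Set.Ioo (0 : ℝ) 1,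
      γ e₁ t₁ ≠ γ e₂ t₂)

/-- A simple graph is planar if it admits a topological planar embedding. -/
def SimpleGraph.IsPlanar {V : Type*} (G : SimpleGraph V) : Prop :=
  ∃ f γ, G.IsPlanarEmbedding f γ

/-- A plane triangulation on `n` vertices: a maximal planar simple graph on `n ≥ 3`
vertices, i.e. a planar graph with exactly `3n - 6` edges. -/
def IsPlaneTriangulation {n : ℕ} (G : SimpleGraph (Fin n)) : Prop :=
  3 ≤ n ∧ G.IsPlanar ∧ G.edgeSet.ncard = 3 * n - 6

/-- `M` is a matching of size `k` in `G` (a copy of `kK₂`): a set of `k` pairwise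
vertex-disjoint edges of `G`. -/
def IsMatchingOfSize {V : Type*} (G : SimpleGraph V) (M : Finset (Sym2 V)) (k : ℕ) : Prop :=
  M.card = k ∧ (↑M : Set (Sym2 V)) ⊆ G.edgeSet ∧
    ∀ e ∈ M, ∀ e' ∈ M, e ≠ e' → ∀ v : V, v ∈ e → v ∉ e'

/-- Under the edge-coloring `c`, the graph `G` contains a rainbow matching of size `k`. -/
def HasRainbowMatching {V α : Type*} (G : SimpleGraph V) (c : Sym2 V → α) (k : ℕ) : Prop :=
  ∃ M : Finset (Sym2 V), IsMatchingOfSize G M k ∧ Set.InjOn c (↑M : Set (Sym2 V))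

/-- `r` colors suffice for rainbow `kK₂` in every plane triangulation on `n` vertices:
every edge-coloring of such a triangulation using at least `r` distinct colors contains
a rainbow matching of size `k`. -/
def RainbowThreshold (n k r : ℕ) : Prop :=
  ∀ G : SimpleGraph (Fin n), IsPlaneTriangulation G →
    ∀ c : Sym2 (Fin n) → ℕ, r ≤ (c '' G.edgeSet).ncard → HasRainbowMatching G c k

section
open Set

/-! ### Logarithmic change along a curve -/

noncomputable def logChange (g : ℝ → ℂ) : ℂ :=
  open Classical in
  if h : ∃ F : ℝ → ℂ, Continuous F ∧ ∀ t, Complex.exp (F t) = g t then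
    h.choose 1 - h.choose 0 else 0

lemma logs_diff_const {F F' : ℝ → ℂ} (hF : Continuous F) (hF' : Continuous F')
    (h : ∀ t, Complex.exp (F t) = Complex.exp (F' t)) : F 1 - F 0 = F' 1 - F' 0 := by
  have hk : ∀ t, ∃ n : ℤ, F t - F' t = n * (2 * Real.pi * Complex.I) := by
    intro t
    obtain ⟨n, hn⟩ := Complex.exp_eq_exp_iff_exists_int.1 (h t)
    exact ⟨n, by rw [hn]; ring⟩
  choose k hk using hk
  have hpi : (2 * Real.pi * Complex.I : ℂ) ≠ 0 := Complex.two_pi_I_ne_zero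
  have hc : Continuous (fun t => ((k t : ℤ) : ℂ)) := by
    have : (fun t => ((k t : ℤ) : ℂ)) = fun t => (F t - F' t) / (2 * Real.pi * Complex.I) := by
      funext t; rw [hk t]; field_simp
    rw [this]; fun_prop
  have hc2 : Continuous k := by
    have hcr : Continuous (fun t => ((k t : ℤ) : ℝ)) := by
      have := Complex.continuous_re.comp hc
      simpa [Function.comp_def] using this
    exact (Int.isClosedEmbedding_coe_real.isEmbedding.continuous_iff).2 hcr
  have : k 1 = k 0 := PreconnectedSpace.constant inferInstance hc2
  have h1 := hk 1
  have h0 := hk 0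
  rw [this] at h1
  linear_combination h1 - h0

lemma logChange_eq {g F : ℝ → ℂ} (hF : Continuous F) (h : ∀ t, Complex.exp (F t) = g t) :
    logChange g = F 1 - F 0 := by
  have hex : ∃ F : ℝ → ℂ, Continuous F ∧ ∀ t, Complex.exp (F t) = g t := ⟨F, hF, h⟩
  unfold logChange
  rw [dif_pos hex]
  exact logs_diff_const hex.choose_spec.1 hF (fun t => by rw [hex.choose_spec.2, h])

lemma exists_log {X : Type*} [TopologicalSpace X] [LocallyPathConnectedSpace X]
    [SimplyConnectedSpace X]
    {g : X → ℂ} (hg : Continuous g) (h0 : ∀ x, g x ≠ 0) :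
    ∃ F : X → ℂ, Continuous F ∧ ∀ x, Complex.exp (F x) = g x := by
  have x₀ : X := Classical.arbitrary X
  obtain ⟨F, ⟨-, hF⟩, -⟩ := Complex.isCoveringMapOn_exp.existsUnique_continuousMap_lifts
    ⟨g, hg⟩ (Complex.exp_log (h0 x₀)) (fun x => h0 x)
  exact ⟨F, F.continuous, fun x => congrFun hF x⟩

lemma exp_logChange {g : ℝ → ℂ} (hg : Continuous g) (h0 : ∀ t, g t ≠ 0) :
    Complex.exp (logChange g) = g 1 / g 0 := by
  obtain ⟨F, hF, h⟩ := exists_log hg h0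
  rw [logChange_eq hF h, Complex.exp_sub, h, h]

lemma logChange_neg {g : ℝ → ℂ} (hg : Continuous g) (h0 : ∀ t, g t ≠ 0) :
    logChange (fun t => - g t) = logChange g := by
  obtain ⟨F, hF, h⟩ := exists_log hg h0
  rw [logChange_eq hF h, logChange_eq (F := fun t => F t + Real.pi * Complex.I) (by fun_prop)]
  · ring
  · intro t
    rw [Complex.exp_add, h, Complex.exp_pi_mul_I]; ring

lemma logChange_square {γ δ : ℝ → ℂ} (hγ : Continuous γ) (hδ : Continuous δ)
    (h : ∀ s t, γ s ≠ δ t) :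
    logChange (fun s => γ s - δ 0) + logChange (fun t => δ t - γ 1) =
      logChange (fun s => γ s - δ 1) + logChange (fun t => δ t - γ 0) := by
  obtain ⟨L, hL, hLe⟩ := exists_log (X := ℝ × ℝ) (g := fun x => γ x.1 - δ x.2)
    (by fun_prop) (fun x => sub_ne_zero.2 (h _ _))
  have e1 : ∀ t, logChange (fun s => γ s - δ t) = L (1, t) - L (0, t) := fun t =>
    logChange_eq (F := fun s => L (s, t)) (by fun_prop) (fun s => hLe (s, t))
  have e2 : ∀ s, logChange (fun t => δ t - γ s) = L (s, 1) - L (s, 0) := by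
    intro s
    have := logChange_neg (g := fun t => γ s - δ t) (by fun_prop) (fun t => sub_ne_zero.2 (h _ _))
    simp only [neg_sub] at this
    rw [this]
    exact logChange_eq (F := fun t => L (s, t)) (by fun_prop) (fun t => hLe (s, t))
  rw [e1, e1, e2, e2]; ring

/-- sign -/
def eps {N : ℕ} (a b : Fin N) : ℤ := if a < b then 1 else -1

theorem cross_eq {N : ℕ} (p : Fin N → ℂ) (hp : Function.Injective p)
    (E : Fin N → Fin N → Prop) (γ : Fin N → Fin N → ℝ → ℂ)
    (hc : ∀ a b, E a b → Continuous (γ a b)) (h0 : ∀ a b, E a b → γ a b 0 = p a)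
    (h1 : ∀ a b, E a b → γ a b 1 = p b)
    (hd : ∀ a b c d, E a b → E c d → a ≠ c → a ≠ d → b ≠ c → b ≠ d →
      ∀ s t, γ a b s ≠ γ c d t) :
    ∃ n : Fin N → Fin N → Fin N → ℤ, ∀ a b c d, E a b → E c d → a ≠ c → a ≠ d → b ≠ c → b ≠ d →
      2 * (n a b c - n a b d + n c d b - n c d a) = eps b c - eps a c - eps b d + eps a d := by
  classical
  let α : Fin N → Fin N → ℂ := fun x y =>
    if x < y then Complex.log (p x - p y) else Complex.log (p y - p x) + Real.pi * Complex.I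
  have hα : ∀ x y, x ≠ y → Complex.exp (α x y) = p x - p y := by
    intro x y hxy
    simp only [α]
    split_ifs with h
    · rw [Complex.exp_log]; exact sub_ne_zero.2 (fun h => hxy (hp h))
    · rw [Complex.exp_add, Complex.exp_log, Complex.exp_pi_mul_I]
      · ring
      · exact sub_ne_zero.2 (fun h => hxy (hp h.symm))
  have hα2 : ∀ x y, x ≠ y → α y x - α x y = Real.pi * Complex.I * (eps x y : ℤ) := by
    intro x y hxy
    simp only [α, eps]
    rcases lt_or_gt_of_ne hxy with h | h
    · simp [h, not_lt.2 h.le]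
    · simp [h, not_lt.2 h.le]
  have hn : ∀ a b c, ∃ n : ℤ, E a b → a ≠ c → b ≠ c → (∀ s, γ a b s ≠ p c) →
      logChange (fun s => γ a b s - p c) = α b c - α a c + n * (2 * Real.pi * Complex.I) := by
    intro a b c
    by_cases hh : E a b ∧ a ≠ c ∧ b ≠ c ∧ (∀ s, γ a b s ≠ p c)
    · obtain ⟨h1', h2, h3, h4⟩ := hh
      have hcc := hc a b h1'
      have := exp_logChange (g := fun s => γ a b s - p c) (by fun_prop)
        (fun t => sub_ne_zero.2 (h4 t))
      rw [h0 _ _ h1', h1 _ _ h1', ← hα b c h3, ← hα a c h2, ← Complex.exp_sub] at this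
      obtain ⟨n, hn⟩ := Complex.exp_eq_exp_iff_exists_int.1 this
      exact ⟨n, fun _ _ _ _ => hn⟩
    · exact ⟨0, fun a1 a2 a3 a4 => absurd ⟨a1, a2, a3, a4⟩ hh⟩
  choose n hn using hn
  refine ⟨n, fun a b c d hab hcd hac had hbc hbd => ?_⟩
  have hdis := hd a b c d hab hcd hac had hbc hbd
  have hsq := logChange_square (hc a b hab) (hc c d hcd) hdis
  rw [h0 _ _ hab, h1 _ _ hab, h0 _ _ hcd, h1 _ _ hcd] at hsq
  rw [hn a b c hab hac hbc (fun s => by rw [← h0 c d hcd]; exact hdis s 0),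
    hn a b d hab had hbd (fun s => by rw [← h1 c d hcd]; exact hdis s 1),
    hn c d b hcd hbc.symm hbd.symm (fun s => by rw [← h1 a b hab]; exact (hdis 1 s).symm),
    hn c d a hcd hac.symm had.symm (fun s => by rw [← h0 a b hab]; exact (hdis 0 s).symm)] at hsq
  have e1 := hα2 b c hbc
  have e2 := hα2 a c hac
  have e3 := hα2 b d hbd
  have e4 := hα2 a d had
  have hpi : (Real.pi * Complex.I : ℂ) ≠ 0 := by simp [Real.pi_ne_zero]
  have : (Real.pi * Complex.I : ℂ) * ((2 * (n a b c - n a b d + n c d b - n c d a) : ℤ) : ℂ) =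
      (Real.pi * Complex.I : ℂ) * ((eps b c - eps a c - eps b d + eps a d : ℤ) : ℂ) := by
    push_cast
    linear_combination hsq + e1 - e2 - e3 + e4
  exact_mod_cast mul_left_cancel₀ hpi this

theorem no_K5_curves (p : Fin 5 → ℂ) (hp : Function.Injective p)
    (γ : Fin 5 → Fin 5 → ℝ → ℂ)
    (hc : ∀ a b, a < b → Continuous (γ a b)) (h0 : ∀ a b, a < b → γ a b 0 = p a)
    (h1 : ∀ a b, a < b → γ a b 1 = p b)
    (hd : ∀ a b c d, a < b → c < d → a ≠ c → a ≠ d → b ≠ c → b ≠ d →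
      ∀ s t, γ a b s ≠ γ c d t) : False := by
  obtain ⟨n, hn⟩ := cross_eq p hp (fun a b => a < b) γ hc h0 h1 hd
  have k := fun a b c d (h : a < b ∧ c < d ∧ a ≠ c ∧ a ≠ d ∧ b ≠ c ∧ b ≠ d) =>
    hn a b c d h.1 h.2.1 h.2.2.1 h.2.2.2.1 h.2.2.2.2.1 h.2.2.2.2.2
  have a1 := k 0 1 2 3 (by decide)
  have a2 := k 0 2 1 3 (by decide)
  have a3 := k 0 3 1 2 (by decide)
  have a4 := k 0 1 2 4 (by decide)
  have a5 := k 0 2 1 4 (by decide)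
  have a6 := k 0 4 1 2 (by decide)
  have a7 := k 0 1 3 4 (by decide)
  have a8 := k 0 3 1 4 (by decide)
  have a9 := k 0 4 1 3 (by decide)
  have b1 := k 0 2 3 4 (by decide)
  have b2 := k 0 3 2 4 (by decide)
  have b3 := k 0 4 2 3 (by decide)
  have b4 := k 1 2 3 4 (by decide)
  have b5 := k 1 3 2 4 (by decide)
  have b6 := k 1 4 2 3 (by decide)
  have e : ∀ a b : Fin 5, eps a b = if a < b then 1 else -1 := fun a b => rfl
  simp only [e, Fin.reduceLT, if_true, if_false] at *
  omega

theorem no_K33_curves (p : Fin 6 → ℂ) (hp : Function.Injective p)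
    (γ : Fin 6 → Fin 6 → ℝ → ℂ)
    (hc : ∀ a b, a < 3 ∧ 3 ≤ b → Continuous (γ a b)) (h0 : ∀ a b, a < 3 ∧ 3 ≤ b → γ a b 0 = p a)
    (h1 : ∀ a b, a < 3 ∧ 3 ≤ b → γ a b 1 = p b)
    (hd : ∀ a b c d, a < 3 ∧ 3 ≤ b → c < 3 ∧ 3 ≤ d → a ≠ c → a ≠ d → b ≠ c → b ≠ d →
      ∀ s t, γ a b s ≠ γ c d t) : False := by
  obtain ⟨n, hn⟩ := cross_eq p hp (fun a b => a < 3 ∧ 3 ≤ b) γ hc h0 h1 hd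
  have k := fun a b c d (h : (a < 3 ∧ 3 ≤ b) ∧ (c < 3 ∧ 3 ≤ d) ∧ a ≠ c ∧ a ≠ d ∧ b ≠ c ∧ b ≠ d) =>
    hn a b c d h.1 h.2.1 h.2.2.1 h.2.2.2.1 h.2.2.2.2.1 h.2.2.2.2.2
  have a1 := k 0 3 1 4 (by decide)
  have a2 := k 0 4 1 3 (by decide)
  have a3 := k 0 3 1 5 (by decide)
  have a4 := k 0 5 1 3 (by decide)
  have a5 := k 0 4 1 5 (by decide)
  have a6 := k 0 5 1 4 (by decide)
  have b1 := k 0 3 2 4 (by decide)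
  have b2 := k 0 4 2 3 (by decide)
  have b3 := k 0 3 2 5 (by decide)
  have b4 := k 0 5 2 3 (by decide)
  have b5 := k 0 4 2 5 (by decide)
  have b6 := k 0 5 2 4 (by decide)
  have c1 := k 1 3 2 4 (by decide)
  have c2 := k 1 4 2 3 (by decide)
  have c3 := k 1 3 2 5 (by decide)
  have c4 := k 1 5 2 3 (by decide)
  have c5 := k 1 4 2 5 (by decide)
  have c6 := k 1 5 2 4 (by decide)
  have e : ∀ a b : Fin 6, eps a b = if a < b then 1 else -1 := fun a b => rfl
  simp only [e, Fin.reduceLT, if_true, if_false] at *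
  omega
end

section
open Set

/-! ### Branch sets and models -/

def ConnSet {V : Type*} (G : SimpleGraph V) (B : Set V) : Prop :=
  B.Nonempty ∧ ∀ A : Set V, A ⊆ B → A.Nonempty → A ≠ B → ∃ u ∈ A, ∃ v ∈ B \ A, G.Adj u v

def AdjSet {V : Type*} (G : SimpleGraph V) (A B : Set V) : Prop :=
  ∃ u ∈ A, ∃ v ∈ B, G.Adj u v

def K5Free {V : Type*} (G : SimpleGraph V) : Prop :=
  ∀ B : Fin 5 → Set V, (∀ i, ConnSet G (B i)) → (∀ i j, i < j → Disjoint (B i) (B j)) →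
    (∀ i j, i < j → AdjSet G (B i) (B j)) → False

def K33Free {V : Type*} (G : SimpleGraph V) : Prop :=
  ∀ B : Fin 6 → Set V, (∀ i, ConnSet G (B i)) → (∀ i j, i < j → Disjoint (B i) (B j)) →
    (∀ i j, i < 3 ∧ 3 ≤ j → AdjSet G (B i) (B j)) → False

section
variable {V : Type*} {G : SimpleGraph V} {f : V → ℝ × ℝ} {γ : G.edgeSet → ℝ → ℝ × ℝ}

/-- the drawing of the subgraph induced on `X` -/
def drawn (f : V → ℝ × ℝ) (γ : G.edgeSet → ℝ → ℝ × ℝ) (X : Set V) : Set (ℝ × ℝ) :=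
  f '' X ∪ {z | ∃ e : G.edgeSet, (∀ v ∈ (e : Sym2 V), v ∈ X) ∧ ∃ t ∈ Icc (0:ℝ) 1, γ e t = z}

lemma drawn_mono {X Y : Set V} (h : X ⊆ Y) : drawn f γ X ⊆ drawn f γ Y := by
  rintro z (hz | ⟨e, he, t, ht, rfl⟩)
  · exact Or.inl (image_mono h hz)
  · exact Or.inr ⟨e, fun v hv => h (he v hv), t, ht, rfl⟩

lemma drawn_cases (hE : G.IsPlanarEmbedding f γ) {X : Set V} {z : ℝ × ℝ}
    (hz : z ∈ drawn f γ X) : (∃ v ∈ X, f v = z) ∨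
      ∃ e : G.edgeSet, (∀ v ∈ (e : Sym2 V), v ∈ X) ∧ ∃ t ∈ Ioo (0:ℝ) 1, γ e t = z := by
  rcases hz with ⟨v, hv, rfl⟩ | ⟨e, he, t, ht, rfl⟩
  · exact Or.inl ⟨v, hv, rfl⟩
  · obtain ⟨u, v, huv, h0, h1⟩ := hE.2.2.2.1 e
    rcases eq_or_lt_of_le ht.1 with h | h
    · left; exact ⟨u, he u (by rw [huv]; simp), by rw [← h, h0]⟩
    rcases eq_or_lt_of_le ht.2 with h' | h'
    · left; exact ⟨v, he v (by rw [huv]; simp), by rw [h', h1]⟩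
    exact Or.inr ⟨e, he, t, ⟨h, h'⟩, rfl⟩

lemma drawn_disjoint (hE : G.IsPlanarEmbedding f γ) {X Y : Set V} (h : Disjoint X Y)
    {z w : ℝ × ℝ} (hz : z ∈ drawn f γ X) (hw : w ∈ drawn f γ Y) : z ≠ w := by
  have hd := Set.disjoint_left.1 h
  rcases drawn_cases hE hz with ⟨v, hv, rfl⟩ | ⟨e, he, t, ht, rfl⟩ <;>
  rcases drawn_cases hE hw with ⟨v', hv', rfl⟩ | ⟨e', he', t', ht', rfl⟩
  · intro hh
    have := hE.1 hh
    subst this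
    exact hd hv hv'
  · exact (hE.2.2.2.2.1 e' t' ht' v).symm
  · exact hE.2.2.2.2.1 e t ht v'
  · refine hE.2.2.2.2.2 e e' ?_ t ht t' ht'
    rintro rfl
    obtain ⟨u, v, huv, -, -⟩ := hE.2.2.2.1 e
    have hu : u ∈ (e : Sym2 V) := by rw [huv]; simp
    exact hd (he u hu) (he' u hu)

lemma joined_adj (hE : G.IsPlanarEmbedding f γ) {X : Set V} {u v : V} (hu : u ∈ X) (hv : v ∈ X)
    (h : G.Adj u v) : JoinedIn (drawn f γ X) (f u) (f v) := by
  set e : G.edgeSet := ⟨s(u, v), h⟩ with he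
  have hX : ∀ w ∈ (e : Sym2 V), w ∈ X := by
    intro w hw
    rcases Sym2.mem_iff.1 hw with rfl | rfl <;> assumption
  obtain ⟨u', v', huv, h0, h1⟩ := hE.2.2.2.1 e
  have key : JoinedIn (drawn f γ X) (f u') (f v') := by
    rw [← h0, ← h1]
    have hc := hE.2.1 e
    refine JoinedIn.ofLine (f := γ e) hc rfl rfl ?_
    rintro z ⟨t, ht, rfl⟩
    exact Or.inr ⟨e, hX, t, ht, rfl⟩
  have huv' : s(u, v) = s(u', v') := huv
  rcases Sym2.eq_iff.1 huv' with ⟨rfl, rfl⟩ | ⟨rfl, rfl⟩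
  · exact key
  · exact key.symm

lemma joined_conn (hE : G.IsPlanarEmbedding f γ) {X B : Set V} (hB : ConnSet G B) (hX : B ⊆ X)
    {u v : V} (hu : u ∈ B) (hv : v ∈ B) : JoinedIn (drawn f γ X) (f u) (f v) := by
  by_contra hcon
  have hself : JoinedIn (drawn f γ X) (f u) (f u) :=
    JoinedIn.refl (Or.inl ⟨u, hX hu, rfl⟩)
  obtain ⟨x, hx, y, hy, hxy⟩ := hB.2 {w | w ∈ B ∧ JoinedIn (drawn f γ X) (f u) (f w)}
    (fun w hw => hw.1) ⟨u, hu, hself⟩ (fun h => by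
      have : v ∈ {w | w ∈ B ∧ JoinedIn (drawn f γ X) (f u) (f w)} := by rw [h]; exact hv
      exact hcon this.2)
  exact hy.2 ⟨hy.1, hx.2.trans (joined_adj hE (hX hx.1) (hX hy.1) hxy)⟩

lemma exists_curve {N : ℕ} (hE : G.IsPlanarEmbedding f γ) (B : Fin N → Set V)
    (hB : ∀ i, ConnSet G (B i)) (r : Fin N → V) (hr : ∀ i, r i ∈ B i) (i j : Fin N)
    (hij : AdjSet G (B i) (B j)) :
    ∃ g : ℝ → ℝ × ℝ, Continuous g ∧ g 0 = f (r i) ∧ g 1 = f (r j) ∧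
      ∀ t, g t ∈ drawn f γ (B i ∪ B j) := by
  obtain ⟨u, hu, v, hv, huv⟩ := hij
  have h1 := joined_conn hE (hB i) (X := B i ∪ B j) subset_union_left (hr i) hu
  have h2 := joined_adj hE (X := B i ∪ B j) (Or.inl hu) (Or.inr hv) huv
  have h3 := joined_conn hE (hB j) (X := B i ∪ B j) subset_union_right hv (hr j)
  obtain ⟨P, hP⟩ := (h1.trans h2).trans h3
  refine ⟨P.extend, P.continuous_extend, by simp, by simp, fun t => ?_⟩
  rw [Path.extend]
  exact hP _

end

def toC (z : ℝ × ℝ) : ℂ := ⟨z.1, z.2⟩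

lemma toC_inj : Function.Injective toC := by
  intro a b h
  have := Complex.ext_iff.1 h
  exact Prod.ext this.1 this.2

lemma toC_cont : Continuous toC := by
  have : toC = fun z => Complex.equivRealProdCLM.symm z := by
    funext z; apply Complex.ext <;> simp [toC]
  rw [this]; exact Complex.equivRealProdCLM.symm.continuous

lemma curves_of_model {V : Type*} {G : SimpleGraph V} (hG : G.IsPlanar) {N : ℕ}
    (B : Fin N → Set V) (E : Fin N → Fin N → Prop)
    (hB : ∀ i, ConnSet G (B i)) (hdis : ∀ i j, i ≠ j → Disjoint (B i) (B j))
    (hadj : ∀ i j, E i j → AdjSet G (B i) (B j)) :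
    ∃ (p : Fin N → ℂ) (γ : Fin N → Fin N → ℝ → ℂ), Function.Injective p ∧
      (∀ a b, E a b → Continuous (γ a b)) ∧ (∀ a b, E a b → γ a b 0 = p a) ∧
      (∀ a b, E a b → γ a b 1 = p b) ∧
      (∀ a b c d, E a b → E c d → a ≠ c → a ≠ d → b ≠ c → b ≠ d →
        ∀ s t, γ a b s ≠ γ c d t) := by
  obtain ⟨f, γ, hE⟩ := hG
  choose r hr using fun i => (hB i).1
  have : ∀ i j, ∃ g : ℝ → ℝ × ℝ, E i j → (Continuous g ∧ g 0 = f (r i) ∧ g 1 = f (r j) ∧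
      ∀ t, g t ∈ drawn f γ (B i ∪ B j)) := by
    intro i j
    by_cases h : E i j
    · obtain ⟨g, hg⟩ := exists_curve hE B hB r hr i j (hadj i j h)
      exact ⟨g, fun _ => hg⟩
    · exact ⟨fun _ => 0, fun h' => absurd h' h⟩
  choose g hg using this
  refine ⟨fun i => toC (f (r i)), fun i j t => toC (g i j t), ?_, ?_, ?_, ?_, ?_⟩
  · intro i j h
    by_contra hne
    have := hE.1 (toC_inj h)
    exact Set.disjoint_left.1 (hdis i j hne) (hr i) (this ▸ hr j)
  · intro a b h
    exact toC_cont.comp (hg a b h).1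
  · intro a b h
    simp only [(hg a b h).2.1]
  · intro a b h
    simp only [(hg a b h).2.2.1]
  · intro a b c d hab hcd h1 h2 h3 h4 s t heq
    refine drawn_disjoint hE ?_ ((hg a b hab).2.2.2 s) ((hg c d hcd).2.2.2 t) (toC_inj heq)
    rw [Set.disjoint_union_left, Set.disjoint_union_right, Set.disjoint_union_right]
    exact ⟨⟨hdis _ _ h1, hdis _ _ h2⟩, ⟨hdis _ _ h3, hdis _ _ h4⟩⟩

theorem planar_K5Free {V : Type*} {G : SimpleGraph V} (hG : G.IsPlanar) : K5Free G := by
  intro B hB hdis hadj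
  obtain ⟨p, γ, a, b, c, d, e⟩ := curves_of_model hG B (fun i j => i < j) hB
    (fun i j hij => by
      rcases lt_or_gt_of_ne hij with h | h
      · exact hdis i j h
      · exact (hdis j i h).symm) hadj
  exact no_K5_curves p a γ b c d e

theorem planar_K33Free {V : Type*} {G : SimpleGraph V} (hG : G.IsPlanar) : K33Free G := by
  intro B hB hdis hadj
  obtain ⟨p, γ, a, b, c, d, e⟩ := curves_of_model hG B (fun i j => i < 3 ∧ 3 ≤ j) hB
    (fun i j hij => by
      rcases lt_or_gt_of_ne hij with h | h
      · exact hdis i j h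
      · exact (hdis j i h).symm) hadj
  exact no_K33_curves p a γ b c d e

/-! ### Convenient forms -/
section
variable {V : Type*} {G : SimpleGraph V}

lemma connSet_singleton (v : V) : ConnSet G {v} := by
  refine ⟨⟨v, rfl⟩, fun A hA hne hAB => ?_⟩
  exact absurd (Set.Subset.antisymm hA (by
    obtain ⟨x, hx⟩ := hne
    have := hA hx
    rw [Set.mem_singleton_iff] at this
    subst this
    simpa using hx)) hAB

lemma ConnSet.union {A B : Set V} (hA : ConnSet G A) (hB : ConnSet G B) (h : AdjSet G A B) :
    ConnSet G (A ∪ B) := by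
  refine ⟨hA.1.mono subset_union_left, fun X hX hne hXne => ?_⟩
  by_contra hcon
  push Not at hcon
  have aux : ∀ C : Set V, ConnSet G C → C ⊆ A ∪ B → (X ∩ C).Nonempty → C ⊆ X := by
    intro C hC hCs hn
    by_contra hnot
    obtain ⟨u, hu, v, hv, huv⟩ := hC.2 (X ∩ C) inter_subset_right hn
      (fun h => hnot (by rw [← h]; exact inter_subset_left))
    exact hcon u hu.1 v ⟨hCs hv.1, fun hvX => hv.2 ⟨hvX, hv.1⟩⟩ huv
  obtain ⟨u, hu, v, hv, huv⟩ := h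
  have hor : A ⊆ X ∨ B ⊆ X := by
    obtain ⟨x, hx⟩ := hne
    rcases hX hx with h | h
    · exact Or.inl (aux A hA subset_union_left ⟨x, hx, h⟩)
    · exact Or.inr (aux B hB subset_union_right ⟨x, hx, h⟩)
  have huX : u ∈ X ∧ v ∈ X := by
    rcases hor with h | h
    · refine ⟨h hu, ?_⟩
      by_contra hvX
      exact hcon u (h hu) v ⟨Or.inr hv, hvX⟩ huv
    · refine ⟨?_, h hv⟩
      by_contra hvX
      exact hcon v (h hv) u ⟨Or.inl hu, hvX⟩ huv.symm
  exact hXne (Set.Subset.antisymm hX (union_subset (aux A hA subset_union_left ⟨u, huX.1, hu⟩)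
    (aux B hB subset_union_right ⟨v, huX.2, hv⟩)))

lemma AdjSet.symm {A B : Set V} (h : AdjSet G A B) : AdjSet G B A := by
  obtain ⟨u, hu, v, hv, huv⟩ := h
  exact ⟨v, hv, u, hu, huv.symm⟩

lemma connSet_pair {u v : V} (h : G.Adj u v) : ConnSet G {u, v} :=
  (connSet_singleton u).union (connSet_singleton v) ⟨u, rfl, v, rfl, h⟩

lemma ConnSet.insert {u v : V} {B : Set V} (hB : ConnSet G B) (hv : v ∈ B) (h : G.Adj u v) :
    ConnSet G (insert u B) :=
  (connSet_singleton u).union hB ⟨u, rfl, v, hv, h⟩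

lemma K5Free.elim (h : K5Free G) (A B C D E : Set V) (hA : ConnSet G A) (hB : ConnSet G B)
    (hC : ConnSet G C) (hD : ConnSet G D) (hE : ConnSet G E)
    (dAB : Disjoint A B) (dAC : Disjoint A C) (dAD : Disjoint A D) (dAE : Disjoint A E)
    (dBC : Disjoint B C) (dBD : Disjoint B D) (dBE : Disjoint B E)
    (dCD : Disjoint C D) (dCE : Disjoint C E) (dDE : Disjoint D E)
    (aAB : AdjSet G A B) (aAC : AdjSet G A C) (aAD : AdjSet G A D) (aAE : AdjSet G A E)
    (aBC : AdjSet G B C) (aBD : AdjSet G B D) (aBE : AdjSet G B E)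
    (aCD : AdjSet G C D) (aCE : AdjSet G C E) (aDE : AdjSet G D E) : False := by
  refine h ![A, B, C, D, E] ?_ ?_ ?_
  · intro i; fin_cases i <;> assumption
  · intro i j hij
    fin_cases i <;> fin_cases j <;> first | exact absurd hij (by decide) | assumption
  · intro i j hij
    fin_cases i <;> fin_cases j <;> first | exact absurd hij (by decide) | assumption

lemma K33Free.elim (h : K33Free G) (A B C D E F : Set V) (hA : ConnSet G A) (hB : ConnSet G B)
    (hC : ConnSet G C) (hD : ConnSet G D) (hE : ConnSet G E) (hF : ConnSet G F)
    (dAB : Disjoint A B) (dAC : Disjoint A C) (dAD : Disjoint A D) (dAE : Disjoint A E)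
    (dAF : Disjoint A F)
    (dBC : Disjoint B C) (dBD : Disjoint B D) (dBE : Disjoint B E) (dBF : Disjoint B F)
    (dCD : Disjoint C D) (dCE : Disjoint C E) (dCF : Disjoint C F) (dDE : Disjoint D E)
    (dDF : Disjoint D F) (dEF : Disjoint E F)
    (aAD : AdjSet G A D) (aAE : AdjSet G A E) (aAF : AdjSet G A F)
    (aBD : AdjSet G B D) (aBE : AdjSet G B E) (aBF : AdjSet G B F)
    (aCD : AdjSet G C D) (aCE : AdjSet G C E) (aCF : AdjSet G C F) : False := by
  refine h ![A, B, C, D, E, F] ?_ ?_ ?_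
  · intro i; fin_cases i <;> assumption
  · intro i j hij
    fin_cases i <;> fin_cases j <;> first | exact absurd hij (by decide) | assumption
  · intro i j hij
    fin_cases i <;> fin_cases j <;> first | exact absurd hij (by decide) | assumption

end
end

section
open Set
set_option linter.all false
set_option linter.unusedSectionVars false
set_option linter.unusedSimpArgs false

/-! ### Counting adjacent ordered pairs -/

noncomputable def ad {V : Type*} (G : SimpleGraph V) (u v : V) : ℕ :=
  open Classical in if G.Adj u v then 1 else 0

noncomputable def cnt {V : Type*} (G : SimpleGraph V) (A B : Finset V) : ℕ :=
  ∑ u ∈ A, ∑ v ∈ B, ad G u v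

section
variable {V : Type*} [DecidableEq V] {G H : SimpleGraph V}

lemma ad_congr {u v x y : V} (h : G.Adj u v ↔ H.Adj x y) : ad G u v = ad H x y := by
  unfold ad; by_cases h1 : G.Adj u v
  · rw [if_pos h1, if_pos (h.1 h1)]
  · rw [if_neg h1, if_neg (fun h2 => h1 (h.2 h2))]

lemma ad_comm (u v : V) : ad G u v = ad G v u := ad_congr (G.adj_comm u v)

@[simp] lemma ad_self (u : V) : ad G u u = 0 := by simp [ad]

lemma ad_le (u v : V) : ad G u v ≤ 1 := by unfold ad; split_ifs <;> simp

lemma ad_one {u v : V} : ad G u v = 1 ↔ G.Adj u v := by unfold ad; split_ifs <;> simp_all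

lemma ad_zero {u v : V} : ad G u v = 0 ↔ ¬ G.Adj u v := by unfold ad; split_ifs <;> simp_all

lemma ad_mono (h : G ≤ H) (u v : V) : ad G u v ≤ ad H u v := by
  unfold ad
  split_ifs with h1 h2 <;> simp_all
  exact absurd (h h1) h2

lemma cnt_comm (A B : Finset V) : cnt G A B = cnt G B A := by
  unfold cnt
  rw [Finset.sum_comm]
  simp only [ad_comm]

lemma cnt_union_left {A B C : Finset V} (h : Disjoint A B) :
    cnt G (A ∪ B) C = cnt G A C + cnt G B C := by
  unfold cnt; rw [Finset.sum_union h]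

lemma cnt_union_right {A B C : Finset V} (h : Disjoint A B) :
    cnt G C (A ∪ B) = cnt G C A + cnt G C B := by
  rw [cnt_comm, cnt_union_left h, cnt_comm, cnt_comm B]

lemma cnt_union_self {A B : Finset V} (h : Disjoint A B) :
    cnt G (A ∪ B) (A ∪ B) = cnt G A A + 2 * cnt G A B + cnt G B B := by
  rw [cnt_union_left h, cnt_union_right h, cnt_union_right h, cnt_comm B A]; ring

lemma cnt_insert_left {v : V} {A B : Finset V} (h : v ∉ A) :
    cnt G (insert v A) B = cnt G {v} B + cnt G A B := by
  unfold cnt; rw [Finset.sum_insert h]; simp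

lemma cnt_insert_right {v : V} {A B : Finset V} (h : v ∉ A) :
    cnt G B (insert v A) = cnt G B {v} + cnt G B A := by
  rw [cnt_comm, cnt_insert_left h, cnt_comm, cnt_comm A]

@[simp] lemma cnt_singleton (u v : V) : cnt G {u} {v} = ad G u v := by simp [cnt]

@[simp] lemma cnt_empty_left (A : Finset V) : cnt G ∅ A = 0 := by simp [cnt]
@[simp] lemma cnt_empty_right (A : Finset V) : cnt G A ∅ = 0 := by simp [cnt]

lemma cnt_insert_self {v : V} {A : Finset V} (h : v ∉ A) :
    cnt G (insert v A) (insert v A) = 2 * cnt G {v} A + cnt G A A := by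
  rw [cnt_insert_left h, cnt_insert_right h, cnt_insert_right h, cnt_comm A {v}]
  simp; ring

lemma cnt_single_eq (v : V) (B : Finset V) : cnt G {v} B = ∑ b ∈ B, ad G v b := by simp [cnt]

lemma cnt_left_sum (A B : Finset V) : cnt G A B = ∑ a ∈ A, cnt G {a} B := by simp [cnt]

lemma cnt_right_sum (A B : Finset V) : cnt G A B = ∑ b ∈ B, cnt G A {b} := by
  rw [cnt_comm, cnt_left_sum]; simp only [cnt_comm {_} A]

lemma cnt_right_sum' (A B : Finset V) : cnt G A B = ∑ b ∈ B, cnt G {b} A := by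
  rw [cnt_comm, cnt_left_sum]

lemma cnt_single_card [DecidableRel G.Adj] (v : V) (B : Finset V) :
    cnt G {v} B = (B.filter (fun b => G.Adj v b)).card := by
  rw [cnt_single_eq, Finset.card_filter]
  exact Finset.sum_congr rfl fun b _ => by unfold ad; split_ifs <;> rfl

lemma cnt_mono (h : G ≤ H) (A B : Finset V) : cnt G A B ≤ cnt H A B :=
  Finset.sum_le_sum fun u _ => Finset.sum_le_sum fun v _ => ad_mono h u v

lemma cnt_mono_sets {A A' B B' : Finset V} (h : A ⊆ A') (h' : B ⊆ B') :
    cnt G A B ≤ cnt G A' B' :=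
  (Finset.sum_le_sum fun _ _ => Finset.sum_le_sum_of_subset h').trans
    (Finset.sum_le_sum_of_subset h)

lemma cnt_le_mul (A B : Finset V) : cnt G A B ≤ A.card * B.card := by
  calc cnt G A B ≤ ∑ u ∈ A, ∑ v ∈ B, 1 :=
        Finset.sum_le_sum fun u _ => Finset.sum_le_sum fun v _ => ad_le u v
    _ = A.card * B.card := by simp

lemma cnt_single_le (v : V) (B : Finset V) : cnt G {v} B ≤ B.card := by
  simpa using cnt_le_mul (G := G) {v} B

lemma cnt_self_le (A : Finset V) : cnt G A A + A.card ≤ A.card * A.card := by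
  induction A using Finset.induction_on with
  | empty => simp
  | insert v A hv ih =>
    rw [cnt_insert_self hv, Finset.card_insert_of_notMem hv]
    have := cnt_single_le (G := G) v A
    nlinarith

lemma cnt_eq_zero {A B : Finset V} : cnt G A B = 0 ↔ ∀ a ∈ A, ∀ b ∈ B, ¬ G.Adj a b := by
  unfold cnt
  simp [Finset.sum_eq_zero_iff, ad_zero]

lemma cnt_even (A : Finset V) : Even (cnt G A A) := by
  induction A using Finset.induction_on with
  | empty => simp
  | insert v A hv ih =>
    rw [cnt_insert_self hv]
    exact (even_two_mul _).add ih

lemma cnt_self_two {a b : V} : cnt G {a, b} {a, b} = 2 * ad G a b := by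
  by_cases h : a = b
  · subst h; simp
  · rw [cnt_insert_self (by simpa using h)]; simp

lemma cnt_self_three {a b c : V} (hab : a ≠ b) (hac : a ≠ c) (hbc : b ≠ c) :
    cnt G {a, b, c} {a, b, c} = 2 * (ad G a b + ad G a c + ad G b c) := by
  rw [cnt_insert_self (by simp [hab, hac]), cnt_self_two, cnt_insert_right (by simpa using hbc)]
  simp; ring

lemma cnt_single_two (v : V) {a b : V} (hab : a ≠ b) :
    cnt G {v} {a, b} = ad G v a + ad G v b := by
  rw [cnt_insert_right (by simpa using hab)]; simp

lemma cnt_single_three (v : V) {a b c : V} (hab : a ≠ b) (hac : a ≠ c) (hbc : b ≠ c) :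
    cnt G {v} {a, b, c} = ad G v a + ad G v b + ad G v c := by
  rw [cnt_insert_right (by simp [hab, hac]), cnt_single_two v hbc]; simp; ring

lemma two_mul_edges [Fintype V] : 2 * G.edgeSet.ncard = cnt G Finset.univ Finset.univ := by
  classical
  rw [← SimpleGraph.coe_edgeFinset, Set.ncard_coe_finset,
    ← SimpleGraph.sum_degrees_eq_twice_card_edges, cnt_left_sum]
  refine Finset.sum_congr rfl fun v _ => ?_
  rw [cnt_single_card, ← SimpleGraph.card_neighborFinset_eq_degree]
  congr 1
  ext w; simp

/-- edges touching a set -/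
lemma cnt_compl [Fintype V] (S : Finset V) : cnt G Finset.univ Finset.univ =
    cnt G S S + 2 * cnt G S Sᶜ + cnt G Sᶜ Sᶜ := by
  rw [← cnt_union_self disjoint_compl_right]; simp
end

/-! ### Contraction and the edge bound -/
section
variable {V : Type*}

def contractE (G : SimpleGraph V) (u v : V) : SimpleGraph V where
  Adj a b := a ≠ b ∧ a ≠ v ∧ b ≠ v ∧ (G.Adj a b ∨ (a = u ∧ G.Adj v b) ∨ (b = u ∧ G.Adj a v))
  symm := ⟨fun a b h => by
    obtain ⟨h1, h2, h3, h4⟩ := h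
    refine ⟨h1.symm, h3, h2, ?_⟩
    rcases h4 with h | ⟨h, h'⟩ | ⟨h, h'⟩
    · exact Or.inl h.symm
    · exact Or.inr (Or.inr ⟨h, h'.symm⟩)
    · exact Or.inr (Or.inl ⟨h, h'.symm⟩)⟩
  loopless := ⟨fun a h => h.1 rfl⟩

lemma K5Free.mono {G H : SimpleGraph V} (h : G ≤ H) (hH : K5Free H) : K5Free G := by
  intro B hB hd ha
  refine hH B (fun i => ⟨(hB i).1, fun A h1 h2 h3 => ?_⟩) hd (fun i j hij => ?_)
  · obtain ⟨u, hu, v, hv, huv⟩ := (hB i).2 A h1 h2 h3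
    exact ⟨u, hu, v, hv, h huv⟩
  · obtain ⟨u, hu, v, hv, huv⟩ := ha i j hij
    exact ⟨u, hu, v, hv, h huv⟩

open Classical in
lemma K5Free.contract {G : SimpleGraph V} (hG : K5Free G) {u v : V} (huv : G.Adj u v) :
    K5Free (contractE G u v) := by
  intro B hB hd ha
  have hne : u ≠ v := huv.ne
  have hd' : ∀ i j, i ≠ j → Disjoint (B i) (B j) := fun i j hij => by
    rcases lt_or_gt_of_ne hij with h | h
    · exact hd i j h
    · exact (hd j i h).symm
  have ha' : ∀ i j, i ≠ j → AdjSet (contractE G u v) (B i) (B j) := fun i j hij => by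
    rcases lt_or_gt_of_ne hij with h | h
    · exact ha i j h
    · exact (ha j i h).symm
  have hv : ∀ i, v ∉ B i := by
    intro i hi
    have hsing : ({v} : Set V) = B i := by
      by_contra hcon
      obtain ⟨x, hx, y, hy, hxy⟩ := (hB i).2 {v} (by simpa using hi) ⟨v, rfl⟩ hcon
      exact hxy.2.1 hx
    obtain ⟨j, hj⟩ : ∃ j : Fin 5, i ≠ j := by
      by_cases h : i = 0
      · exact ⟨1, by rw [h]; decide⟩
      · exact ⟨0, h⟩
    obtain ⟨x, hx, y, hy, hxy⟩ := ha' i j hj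
    rw [← hsing] at hx
    exact hxy.2.1 hx
  set B' : Fin 5 → Set V := fun i => if u ∈ B i then insert v (B i) else B i with hB'
  have hsub : ∀ i, B i ⊆ B' i := by
    intro i; simp only [hB']; split_ifs
    · exact subset_insert _ _
    · exact subset_rfl
  have hmem : ∀ i x, x ∈ B' i → x ∈ B i ∨ (x = v ∧ u ∈ B i) := by
    intro i x hx
    simp only [hB'] at hx
    split_ifs at hx with h
    · rcases hx with hx | hx
      · exact Or.inr ⟨hx, h⟩
      · exact Or.inl hx
    · exact Or.inl hx
  have hvB : ∀ i, u ∈ B i → v ∈ B' i := by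
    intro i h; simp only [hB']; rw [if_pos h]; exact mem_insert _ _
  refine hG B' ?_ ?_ ?_
  · intro i
    refine ⟨(hB i).1.mono (hsub i), fun A hA hAn hAne => ?_⟩
    by_cases hu : u ∈ B i
    · have huB' := hsub i hu
      have hvB' := hvB i hu
      by_cases h1 : u ∈ A
      · by_cases h2 : v ∈ A
        · obtain ⟨x, hx, y, hy, hxy⟩ := (hB i).2 (A \ {v}) (fun x hx => by
            rcases hmem i x (hA hx.1) with h | h
            · exact h
            · exact absurd h.1 hx.2) ⟨u, h1, hne⟩ (fun h => hAne (by
              refine Set.Subset.antisymm hA (fun x hx => ?_)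
              rcases hmem i x hx with h' | h'
              · rw [← h] at h'; exact h'.1
              · rw [h'.1]; exact h2))
          have hyA : y ∉ A := fun h => hy.2 ⟨h, fun h' => hv i (h' ▸ hy.1)⟩
          rcases hxy.2.2.2 with h | ⟨rfl, h⟩ | ⟨rfl, h⟩
          · exact ⟨x, hx.1, y, ⟨hsub i hy.1, hyA⟩, h⟩
          · exact ⟨v, h2, y, ⟨hsub i hy.1, hyA⟩, h⟩
          · exact absurd h1 hyA
        · exact ⟨u, h1, v, ⟨hvB', h2⟩, huv⟩
      · by_cases h2 : v ∈ A
        · exact ⟨v, h2, u, ⟨huB', h1⟩, huv.symm⟩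
        · obtain ⟨x, hx, y, hy, hxy⟩ := (hB i).2 A (fun x hx => by
            rcases hmem i x (hA hx) with h | h
            · exact h
            · exact absurd (h.1 ▸ hx) h2) hAn (fun h => h1 (h ▸ hu))
          rcases hxy.2.2.2 with h | ⟨rfl, h⟩ | ⟨rfl, h⟩
          · exact ⟨x, hx, y, ⟨hsub i hy.1, hy.2⟩, h⟩
          · exact absurd hx h1
          · exact ⟨x, hx, v, ⟨hvB', h2⟩, h⟩
    · have he : B' i = B i := by simp only [hB']; rw [if_neg hu]
      rw [he] at hA hAne ⊢
      obtain ⟨x, hx, y, hy, hxy⟩ := (hB i).2 A hA hAn hAne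
      rcases hxy.2.2.2 with h | ⟨rfl, h⟩ | ⟨rfl, h⟩
      · exact ⟨x, hx, y, hy, h⟩
      · exact absurd (hA hx) hu
      · exact absurd hy.1 hu
  · intro i j hij
    rw [Set.disjoint_left]
    intro x hx hx'
    have hdij := Set.disjoint_left.1 (hd i j hij)
    rcases hmem i x hx with h | h <;> rcases hmem j x hx' with h' | h'
    · exact hdij h h'
    · exact hv i (h'.1 ▸ h)
    · exact hv j (h.1 ▸ h')
    · exact hdij h.2 h'.2
  · intro i j hij
    obtain ⟨x, hx, y, hy, hxy⟩ := ha i j hij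
    rcases hxy.2.2.2 with h | ⟨rfl, h⟩ | ⟨rfl, h⟩
    · exact ⟨x, hsub i hx, y, hsub j hy, h⟩
    · exact ⟨v, hvB i hx, y, hsub j hy, h⟩
    · exact ⟨x, hsub i hx, v, hvB j hy, h⟩

variable [DecidableEq V]

lemma cnt_contract {G : SimpleGraph V} {u v : V} (huv : G.Adj u v) {X : Finset V} (hu : u ∈ X)
    (hv : v ∈ X) :
    cnt (contractE G u v) (X.erase v) (X.erase v) + 2 +
      2 * ∑ b ∈ (X.erase v).erase u, ad G u b * ad G v b = cnt G X X := by
  have hne : u ≠ v := huv.ne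
  set Y := (X.erase v).erase u with hY
  have huY : u ∉ Y := by simp [hY]
  have hvY : v ∉ Y := by simp [hY]
  have e1 : X.erase v = insert u Y := by rw [hY, Finset.insert_erase]; simp [hu, hne]
  have e2 : X = insert v (insert u Y) := by rw [← e1, Finset.insert_erase hv]
  rw [e1]
  conv_rhs => rw [e2]
  rw [cnt_insert_self huY, cnt_insert_self (A := insert u Y) (v := v) (by simp [hne.symm, hvY]),
    cnt_insert_self huY, cnt_insert_right huY (B := {v})]
  have e3 : cnt (contractE G u v) Y Y = cnt G Y Y := by
    unfold cnt
    refine Finset.sum_congr rfl fun a ha => Finset.sum_congr rfl fun b hb => ?_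
    have h1 : a ≠ u := fun h => huY (h ▸ ha)
    have h2 : b ≠ u := fun h => huY (h ▸ hb)
    have h3 : a ≠ v := fun h => hvY (h ▸ ha)
    have h4 : b ≠ v := fun h => hvY (h ▸ hb)
    have : (contractE G u v).Adj a b ↔ G.Adj a b := by
      constructor
      · rintro ⟨-, -, -, h | h | h⟩
        · exact h
        · exact absurd h.1 h1
        · exact absurd h.1 h2
      · exact fun h => ⟨h.ne, h3, h4, Or.inl h⟩
    exact ad_congr this
  have e4 : cnt (contractE G u v) {u} Y + ∑ b ∈ Y, ad G u b * ad G v b =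
      cnt G {u} Y + cnt G {v} Y := by
    rw [cnt_single_eq, cnt_single_eq, cnt_single_eq, ← Finset.sum_add_distrib,
      ← Finset.sum_add_distrib]
    refine Finset.sum_congr rfl fun b hb => ?_
    have h2 : b ≠ u := fun h => huY (h ▸ hb)
    have h4 : b ≠ v := fun h => hvY (h ▸ hb)
    have : (contractE G u v).Adj u b ↔ G.Adj u b ∨ G.Adj v b := by
      constructor
      · rintro ⟨-, -, -, h | h | h⟩
        · exact Or.inl h
        · exact Or.inr h.2
        · exact absurd h.1 h2
      · rintro (h | h)
        · exact ⟨h2.symm, hne, h4, Or.inl h⟩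
        · exact ⟨h2.symm, hne, h4, Or.inr (Or.inl ⟨rfl, h⟩)⟩
    by_cases h5 : G.Adj u b <;> by_cases h6 : G.Adj v b <;> simp [ad, this, h5, h6]
  have e5 : cnt G {v} {u} = 1 := by rw [cnt_singleton, ad_one]; exact huv.symm
  rw [e3, e5]
  linarith

lemma exists_min_sub {G : SimpleGraph V} (X : Finset V) (N : ℕ) (h : N ≤ cnt G X X) :
    ∃ H ≤ G, N ≤ cnt H X X ∧ cnt H X X ≤ N + 1 := by
  have hex : ∃ k, ∃ H ≤ G, N ≤ cnt H X X ∧ cnt H X X = k := ⟨_, G, le_rfl, h, rfl⟩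
  classical
  obtain ⟨H, hH, hN, hk⟩ := Nat.find_spec hex
  refine ⟨H, hH, hN, ?_⟩
  by_contra hcon
  push Not at hcon
  have hpos : cnt H X X ≠ 0 := by omega
  have : ∃ a ∈ X, ∃ b ∈ X, H.Adj a b := by
    by_contra hno; push Not at hno
    exact hpos (cnt_eq_zero.2 hno)
  obtain ⟨a, ha, b, hb, hab⟩ := this
  have hne := hab.ne
  let H' := H.deleteEdges {s(a, b)}
  have hle : H' ≤ H := SimpleGraph.deleteEdges_le _
  have key : cnt H' X X + 2 = cnt H X X := by
    have e : ∀ x y, ad H x y = ad H' x y + ((if x = a ∧ y = b then 1 else 0) +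
        (if x = b ∧ y = a then 1 else 0)) := by
      intro x y
      have : H'.Adj x y ↔ H.Adj x y ∧ ¬ ((x = a ∧ y = b) ∨ (x = b ∧ y = a)) := by
        simp [H', SimpleGraph.deleteEdges_adj]
      unfold ad
      by_cases h1 : x = a ∧ y = b
      · obtain ⟨rfl, rfl⟩ := h1
        simp [this, hab, hne]
      · by_cases h2 : x = b ∧ y = a
        · obtain ⟨rfl, rfl⟩ := h2
          simp [this, hab.symm, hne.symm]
        · simp [this, h1, h2]
    unfold cnt
    simp only [e, Finset.sum_add_distrib]
    have s1 : ∀ a ∈ X, ∀ b ∈ X, ∑ x ∈ X, ∑ y ∈ X, (if x = a ∧ y = b then 1 else 0) = 1 := by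
      intro a ha b hb
      simp [ite_and, ha, hb]
    rw [s1 a ha b hb, s1 b hb a ha]
  have := Nat.find_min hex (m := cnt H' X X) (by omega)
  exact this ⟨H', hle.trans hH, by omega, rfl⟩

lemma K5Free.elim_single {G : SimpleGraph V} (h : K5Free G) {a b c d e : V}
    (aAB : G.Adj a b) (aAC : G.Adj a c) (aAD : G.Adj a d) (aAE : G.Adj a e)
    (aBC : G.Adj b c) (aBD : G.Adj b d) (aBE : G.Adj b e)
    (aCD : G.Adj c d) (aCE : G.Adj c e) (aDE : G.Adj d e) : False := by
  refine h.elim {a} {b} {c} {d} {e} (connSet_singleton _) (connSet_singleton _)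
    (connSet_singleton _) (connSet_singleton _) (connSet_singleton _)
    ?_ ?_ ?_ ?_ ?_ ?_ ?_ ?_ ?_ ?_ ⟨_, rfl, _, rfl, aAB⟩
    ⟨_, rfl, _, rfl, aAC⟩ ⟨_, rfl, _, rfl, aAD⟩ ⟨_, rfl, _, rfl, aAE⟩ ⟨_, rfl, _, rfl, aBC⟩
    ⟨_, rfl, _, rfl, aBD⟩ ⟨_, rfl, _, rfl, aBE⟩ ⟨_, rfl, _, rfl, aCD⟩ ⟨_, rfl, _, rfl, aCE⟩
    ⟨_, rfl, _, rfl, aDE⟩ <;> rw [Set.disjoint_singleton] <;>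
    exact SimpleGraph.Adj.ne (by assumption)

/-- The neighbourhood configuration of Mader's argument. -/
lemma mader_nbhd {G : SimpleGraph V} (h : K5Free G) (v : V) (N : Finset V)
    (hN : ∀ w ∈ N, G.Adj v w) (h4 : 4 ≤ N.card) (h5 : N.card ≤ 5)
    (hd : ∀ w ∈ N, 3 ≤ cnt G {w} N) : False := by
  classical
  have hcl : ∀ w1 ∈ N, ∀ w2 ∈ N, w1 ≠ w2 → ¬ G.Adj w1 w2 → N.card = 5 ∧
      ∀ x ∈ N, x ≠ w1 → x ≠ w2 → G.Adj w1 x := by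
    intro w1 h1 w2 h2 hne hna
    have hc := hd w1 h1
    rw [cnt_single_card] at hc
    have hsub : (N.filter (fun b => G.Adj w1 b)) ⊆ (N.erase w1).erase w2 := by
      intro x hx
      simp only [Finset.mem_filter, Finset.mem_erase] at hx ⊢
      exact ⟨fun h => hna (h ▸ hx.2), fun h => G.loopless.irrefl w1 (by rw [h] at hx; exact hx.2), hx.1⟩
    have hcard : ((N.erase w1).erase w2).card = N.card - 2 := by
      rw [Finset.card_erase_of_mem (by simp [h2, hne.symm]), Finset.card_erase_of_mem h1]; omega
    have := Finset.card_le_card hsub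
    refine ⟨by omega, fun x hx hx1 hx2 => ?_⟩
    have heq := Finset.eq_of_subset_of_card_le hsub (by omega)
    have : x ∈ (N.erase w1).erase w2 := by simp [hx, hx1, hx2]
    rw [← heq] at this
    exact (Finset.mem_filter.1 this).2
  by_cases hall : ∀ w1 ∈ N, ∀ w2 ∈ N, w1 ≠ w2 → G.Adj w1 w2
  · obtain ⟨M, hM, hMc⟩ := Finset.exists_subset_card_eq h4
    obtain ⟨a, b, c, d, hab, hac, had, hbc, hbd, hcd, rfl⟩ := Finset.card_eq_four.1 hMc
    have ha : a ∈ N := hM (by simp)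
    have hb : b ∈ N := hM (by simp)
    have hc : c ∈ N := hM (by simp)
    have hd : d ∈ N := hM (by simp)
    exact h.elim_single (hN a ha) (hN b hb) (hN c hc) (hN d hd) (hall a ha b hb hab)
      (hall a ha c hc hac) (hall a ha d hd had) (hall b hb c hc hbc) (hall b hb d hd hbd)
      (hall c hc d hd hcd)
  · push Not at hall
    obtain ⟨w1, h1, w2, h2, hne, hna⟩ := hall
    obtain ⟨hc5, ha1⟩ := hcl w1 h1 w2 h2 hne hna
    obtain ⟨-, ha2⟩ := hcl w2 h2 w1 h1 hne.symm (fun h => hna h.symm)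
    have hc3 : ((N.erase w1).erase w2).card = 3 := by
      rw [Finset.card_erase_of_mem (by simp [h2, hne.symm]), Finset.card_erase_of_mem h1]; omega
    obtain ⟨x, y, z, hxy, hxz, hyz, hset⟩ := Finset.card_eq_three.1 hc3
    have hm : ∀ t, t = x ∨ t = y ∨ t = z → t ∈ N ∧ t ≠ w1 ∧ t ≠ w2 := by
      intro t ht
      have : t ∈ (N.erase w1).erase w2 := by rw [hset]; simpa using ht
      simp only [Finset.mem_erase] at this
      exact ⟨this.2.2, this.2.1, this.1⟩
    -- generic final step
    have fin : ∀ x y z, (x ∈ N ∧ x ≠ w1 ∧ x ≠ w2) → (y ∈ N ∧ y ≠ w1 ∧ y ≠ w2) →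
        (z ∈ N ∧ z ≠ w1 ∧ z ≠ w2) → x ≠ y → x ≠ z → y ≠ z → ¬ G.Adj x y → False := by
      intro x y z hx hy hz hxy hxz hyz hn
      have ax := (hcl x hx.1 y hy.1 hxy hn).2
      have ay := (hcl y hy.1 x hx.1 hxy.symm (fun h => hn h.symm)).2
      have hxw1 := ax w1 h1 hx.2.1.symm hy.2.1.symm
      have hxw2 := ax w2 h2 hx.2.2.symm hy.2.2.symm
      have hyw1 := ay w1 h1 hy.2.1.symm hx.2.1.symm
      have hyw2 := ay w2 h2 hy.2.2.symm hx.2.2.symm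
      have hxz' := ax z hz.1 hxz.symm hyz.symm
      have hyz' := ay z hz.1 hyz.symm hxz.symm
      have hw1z := ha1 z hz.1 hz.2.1 hz.2.2
      have hw2z := ha2 z hz.1 hz.2.2 hz.2.1
      have nv := fun w hw => (hN w hw).ne
      have d1 := nv w1 h1
      have d2 := nv w2 h2
      have d3 := nv x hx.1
      have d4 := nv y hy.1
      have d5 := nv z hz.1
      have e1 := hx.2.1
      have e2 := hx.2.2
      have e3 := hy.2.1
      have e4 := hy.2.2
      have e5 := hz.2.1
      have e6 := hz.2.2
      refine h.elim {v} {z} {w1, x} {w2} {y} (connSet_singleton _) (connSet_singleton _)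
        (connSet_pair hxw1.symm) (connSet_singleton _) (connSet_singleton _)
        ?_ ?_ ?_ ?_ ?_ ?_ ?_ ?_ ?_ ?_
        ⟨v, by simp, z, by simp, hN z hz.1⟩ ⟨v, by simp, x, by simp, hN x hx.1⟩
        ⟨v, by simp, w2, by simp, hN w2 h2⟩ ⟨v, by simp, y, by simp, hN y hy.1⟩
        ⟨z, by simp, x, by simp, hxz'.symm⟩ ⟨z, by simp, w2, by simp, hw2z.symm⟩
        ⟨z, by simp, y, by simp, hyz'.symm⟩ ⟨x, by simp, w2, by simp, hxw2⟩
        ⟨w1, by simp, y, by simp, hyw1.symm⟩ ⟨w2, by simp, y, by simp, hyw2.symm⟩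
      all_goals simp only [Set.disjoint_left, Set.mem_singleton_iff, Set.mem_insert_iff]; grind
    have hx := hm x (by simp)
    have hy := hm y (by simp)
    have hz := hm z (by simp)
    by_cases q1 : G.Adj x y
    · by_cases q2 : G.Adj x z
      · by_cases q3 : G.Adj y z
        · exact h.elim_single (hN w1 h1) (hN x hx.1) (hN y hy.1) (hN z hz.1)
            (ha1 x hx.1 hx.2.1 hx.2.2) (ha1 y hy.1 hy.2.1 hy.2.2) (ha1 z hz.1 hz.2.1 hz.2.2)
            q1 q2 q3
        · exact fin y z x hy hz hx hyz hxy.symm hxz.symm q3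
      · exact fin x z y hx hz hy hxz hxy hyz.symm q2
    · exact fin x y z hx hy hz hxy hxz hyz q1

/-- Mader's bound: `K₅`-minor-free graphs have at most `3n - 6` edges. -/
theorem mader {G : SimpleGraph V} (hG : K5Free G) (X : Finset V) (hX : 3 ≤ X.card) :
    cnt G X X + 12 ≤ 6 * X.card := by
  classical
  induction hk : X.card using Nat.strong_induction_on generalizing G X with
  | _ k ih =>
  subst hk
  by_contra hcon
  push Not at hcon
  by_cases h3 : X.card = 3
  · have := cnt_self_le (G := G) X
    rw [h3] at this hcon; omega
  obtain ⟨H, hHG, hlo, hhi⟩ := exists_min_sub (G := G) X (6 * X.card - 11) (by omega)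
  have hH := hG.mono hHG
  have htri : ∀ u ∈ X, ∀ v ∈ X, H.Adj u v →
      3 ≤ ∑ b ∈ (X.erase v).erase u, ad H u b * ad H v b := by
    intro u hu v hv huv
    have h1 := cnt_contract huv hu hv
    have hc : (X.erase v).card = X.card - 1 := Finset.card_erase_of_mem hv
    have h2 := ih (X.erase v).card (by omega) (hH.contract huv) (X.erase v) (by omega) rfl
    omega
  have hex : ∃ v ∈ X, cnt H {v} X ≤ 5 := by
    by_contra hno
    push Not at hno
    have : ∑ v ∈ X, 6 ≤ ∑ v ∈ X, cnt H {v} X := Finset.sum_le_sum fun v hv => hno v hv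
    rw [← cnt_left_sum] at this
    simp at this
    omega
  obtain ⟨v, hv, hv5⟩ := hex
  set N := X.filter (fun b => H.Adj v b) with hNdef
  rw [cnt_single_card] at hv5
  have hNX : N ⊆ X := Finset.filter_subset _ _
  have hdeg : ∀ w ∈ N, 3 ≤ cnt H {w} N := by
    intro w hw
    have hw' := Finset.mem_filter.1 hw
    have := htri w hw'.1 v hv hw'.2.symm
    refine this.trans ?_
    rw [cnt_single_eq, hNdef, Finset.sum_filter]
    refine (Finset.sum_le_sum_of_subset (s := (X.erase v).erase w) (t := X) ?_).trans ?_
    · exact (Finset.erase_subset _ _).trans (Finset.erase_subset _ _)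
    · refine Finset.sum_le_sum fun b _ => ?_
      split_ifs with h
      · have := ad_one.2 h
        rw [this]; simp
      · rw [ad_zero.2 h]; simp
  by_cases hN0 : N = ∅
  · have hz : cnt H {v} (X.erase v) = 0 := by
      rw [cnt_eq_zero]
      intro a ha b hb hab
      rw [Finset.mem_singleton] at ha
      subst ha
      have : b ∈ N := Finset.mem_filter.2 ⟨Finset.mem_of_mem_erase hb, hab⟩
      rw [hN0] at this; simp at this
    have e1 : X = insert v (X.erase v) := (Finset.insert_erase hv).symm
    have e2 : cnt H X X = cnt H (X.erase v) (X.erase v) := by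
      conv_lhs => rw [e1]
      rw [cnt_insert_self (by simp), hz]; ring
    have hc : (X.erase v).card = X.card - 1 := Finset.card_erase_of_mem hv
    have h2 := ih (X.erase v).card (by omega) hH (X.erase v) (by omega) rfl
    omega
  · obtain ⟨w, hw⟩ := Finset.nonempty_iff_ne_empty.2 hN0
    refine mader_nbhd hH v N (fun w hw => (Finset.mem_filter.1 hw).2) ?_ hv5 hdeg
    have := hdeg w hw
    have h1 : cnt H {w} N ≤ cnt H {w} (N.erase w) := by
      conv_lhs => rw [← Finset.insert_erase hw]
      rw [cnt_insert_right (by simp)]; simp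
    have h2 := cnt_single_le (G := H) w (N.erase w)
    rw [Finset.card_erase_of_mem hw] at h2
    omega
end
end

section
open Set
set_option linter.all false

/-! ### Tutte--Berge -/
section
variable {V : Type*} [Fintype V] [DecidableEq V]

def joinGraph (H : SimpleGraph V) (d : ℕ) : SimpleGraph (V ⊕ Fin d) where
  Adj x y := x ≠ y ∧ ∀ u v, x = Sum.inl u → y = Sum.inl v → H.Adj u v
  symm := ⟨fun x y h => ⟨h.1.symm, fun u v hu hv => (h.2 v u hv hu).symm⟩⟩
  loopless := ⟨fun x h => h.1 rfl⟩

lemma matching_of_perfect (H : SimpleGraph V) (d w : ℕ) (hd : Fintype.card V = 2 * w + 2 + d)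
    (M : (joinGraph H d).Subgraph) (hM : M.IsPerfectMatching) :
    ∃ M' : Finset (Sym2 V), IsMatchingOfSize H M' (w + 1) := by
  classical
  rw [SimpleGraph.Subgraph.isPerfectMatching_iff] at hM
  choose g hg hgu using hM
  have hinv : ∀ x, g (g x) = x := fun x => (hgu (g x) x (hg x).symm).symm
  let A : Finset V := Finset.univ.filter (fun v => ∃ v', g (Sum.inl v) = Sum.inl v')
  let h : V → V := fun v => if hv : ∃ v', g (Sum.inl v) = Sum.inl v' then hv.choose else v
  have hh : ∀ v ∈ A, g (Sum.inl v) = Sum.inl (h v) := by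
    intro v hv
    have hv' := (Finset.mem_filter.1 hv).2
    simp only [h]; rw [dif_pos hv']; exact hv'.choose_spec
  have hhA : ∀ v ∈ A, h v ∈ A := by
    intro v hv
    refine Finset.mem_filter.2 ⟨Finset.mem_univ _, v, ?_⟩
    rw [← hh v hv, hinv]
  have hhh : ∀ v ∈ A, h (h v) = v := by
    intro v hv
    have := hh (h v) (hhA v hv)
    rw [← hh v hv, hinv] at this
    exact (Sum.inl_injective this).symm
  have hadj : ∀ v ∈ A, H.Adj v (h v) := by
    intro v hv
    have := (hg (Sum.inl v)).adj_sub
    rw [hh v hv] at this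
    exact this.2 v (h v) rfl rfl
  have hAc : Aᶜ.card ≤ d := by
    have : ∀ v ∈ Aᶜ, ∃ i : Fin d, g (Sum.inl v) = Sum.inr i := by
      intro v hv
      rw [Finset.mem_compl] at hv
      rcases hgv : g (Sum.inl v) with v' | i
      · exact absurd (Finset.mem_filter.2 ⟨Finset.mem_univ _, v', hgv⟩) hv
      · exact ⟨i, rfl⟩
    have := Finset.card_le_card_of_injOn (s := Aᶜ)
      (t := (Finset.univ : Finset (Fin d)).image (Sum.inr : Fin d → V ⊕ Fin d))
      (fun v => g (Sum.inl v))
      (fun v hv => by obtain ⟨i, hi⟩ := this v hv; simp [hi]) (fun a ha b hb hab => by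
        have := congrArg g hab
        simp only [hinv] at this
        exact Sum.inl_injective this)
    refine this.trans (Finset.card_image_le.trans ?_)
    simp
  have hA2 : 2 * w + 2 ≤ A.card := by
    have := Finset.card_compl A
    have := Finset.card_le_univ A
    omega
  let M0 := A.image (fun v => s(v, h v))
  have hM0 : A.card ≤ 2 * M0.card := by
    refine Finset.card_le_mul_card_image _ 2 ?_
    intro e he
    obtain ⟨v, hv, rfl⟩ := Finset.mem_image.1 he
    refine (Finset.card_le_card (t := {v, h v}) ?_).trans Finset.card_le_two
    intro x hx
    have := (Finset.mem_filter.1 hx).2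
    rcases Sym2.eq_iff.1 this with h1 | h1
    · simp [h1.1]
    · simp [h1.1]
  obtain ⟨M', hM', hc⟩ := Finset.exists_subset_card_eq (s := M0) (n := w + 1) (by omega)
  refine ⟨M', hc, ?_, ?_⟩
  · intro e he
    obtain ⟨v, hv, rfl⟩ := Finset.mem_image.1 (hM' he)
    exact hadj v hv
  · intro e he e' he' hne v hve hve'
    obtain ⟨x, hx, rfl⟩ := Finset.mem_image.1 (hM' he)
    obtain ⟨y, hy, rfl⟩ := Finset.mem_image.1 (hM' he')
    apply hne
    have key : ∀ z ∈ A, v ∈ s(z, h z) → s(z, h z) = s(v, h v) := by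
      intro z hz hv
      rcases Sym2.mem_iff.1 hv with rfl | rfl
      · rfl
      · rw [hhh z hz, Sym2.eq_swap]
    rw [key x hx hve, key y hy hve']

lemma tb_first (H : SimpleGraph V) (w : ℕ) (hm : 2 * w + 2 ≤ Fintype.card V)
    (hno : ¬ ∃ M : Finset (Sym2 V), IsMatchingOfSize H M (w + 1)) :
    ∃ (S : Finset V) (Pt : Finset (Finset V)), (∀ P ∈ Pt, P.Nonempty ∧ Disjoint S P) ∧
      (∀ P ∈ Pt, ∀ Q ∈ Pt, P ≠ Q → Disjoint P Q) ∧
      (∀ u v, H.Adj u v → u ∈ S ∨ v ∈ S ∨ ∃ P ∈ Pt, u ∈ P ∧ v ∈ P) ∧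
      S.card + ∑ P ∈ Pt, P.card / 2 ≤ w := by
  classical
  set d := Fintype.card V - (2 * w + 2) with hd
  have hnp : ¬ ∃ M : (joinGraph H d).Subgraph, M.IsPerfectMatching := by
    rintro ⟨M, hM⟩
    exact hno (matching_of_perfect H d w (by omega) M hM)
  rw [SimpleGraph.tutte] at hnp
  push Not at hnp
  obtain ⟨U, hU⟩ := hnp
  unfold SimpleGraph.IsTutteViolator at hU
  set K := ((⊤ : (joinGraph H d).Subgraph).deleteVerts U) with hK
  have hKv : ∀ x, x ∈ K.verts ↔ x ∉ U := by intro x; simp [hK]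
  have hKa : ∀ x y : K.verts, K.coe.Adj x y ↔ (joinGraph H d).Adj x y := by
    intro x y
    have := (hKv x).1 x.2
    have := (hKv y).1 y.2
    simp [hK]
    tauto
  -- parity
  have hcardK : Nat.card K.verts + U.ncard = 2 * w + 2 + 2 * d := by
    have e1 : Nat.card K.verts = K.verts.ncard := rfl
    have e2 : K.verts = Uᶜ := by ext x; simp [hKv]
    rw [e1, e2, add_comm, Set.ncard_add_ncard_compl, Nat.card_eq_fintype_card]
    simp; omega
  have hpar := SimpleGraph.odd_ncard_oddComponents (G := K.coe)
  have hq : U.ncard + 2 ≤ K.coe.oddComponents.ncard := by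
    by_contra hcon
    have h1 : K.coe.oddComponents.ncard = U.ncard + 1 := by omega
    rw [h1] at hpar
    rcases Nat.even_or_odd U.ncard with h | h
    · have := hpar.1 h.add_one
      rcases this with ⟨a, ha⟩; rcases h with ⟨b, hb⟩; omega
    · have : ¬ Odd (U.ncard + 1) := by simpa using h.add_one
      rw [hpar] at this
      rw [Nat.not_odd_iff_even] at this
      rcases this with ⟨a, ha⟩; rcases h with ⟨b, hb⟩; omega
  -- all new vertices are in U
  have hall : ∀ i : Fin d, Sum.inr i ∈ U := by
    intro i
    by_contra hi
    let z : K.verts := ⟨Sum.inr i, (hKv _).2 hi⟩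
    have hsub : ∀ c : K.coe.ConnectedComponent, c = K.coe.connectedComponentMk z := by
      intro c
      induction c using SimpleGraph.ConnectedComponent.ind with
      | _ x =>
      by_cases hx : x = z
      · rw [hx]
      · apply SimpleGraph.ConnectedComponent.sound
        apply SimpleGraph.Adj.reachable
        rw [hKa]
        exact ⟨fun h => hx (Subtype.ext h), fun u v _ h => by simp [z] at h⟩
    have : K.coe.oddComponents.ncard ≤ 1 := by
      rw [Set.ncard_le_one]
      intro a _ b _
      rw [hsub a, hsub b]
    omega
  -- sets
  let S : Finset V := Finset.univ.filter (fun v => Sum.inl v ∈ U)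
  let part : K.coe.ConnectedComponent → Finset V := fun C =>
    Finset.univ.filter (fun v => ∃ h : Sum.inl v ∈ K.verts, K.coe.connectedComponentMk ⟨_, h⟩ = C)
  have hmem : ∀ C v, v ∈ part C ↔
      ∃ h : Sum.inl v ∈ K.verts, K.coe.connectedComponentMk ⟨_, h⟩ = C := by
    intro C v; simp [part]
  have hpd : ∀ C C', C ≠ C' → Disjoint (part C) (part C') := by
    intro C C' hne
    rw [Finset.disjoint_left]
    intro v h1 h2
    obtain ⟨a, ha⟩ := (hmem _ _).1 h1
    obtain ⟨b, hb⟩ := (hmem _ _).1 h2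
    exact hne (ha.symm.trans hb)
  have hpne : ∀ C, (part C).Nonempty := by
    intro C
    induction C using SimpleGraph.ConnectedComponent.ind with
    | _ x =>
    obtain ⟨x, hx⟩ := x
    rcases x with v | i
    · exact ⟨v, (hmem _ _).2 ⟨hx, rfl⟩⟩
    · exact absurd (hall i) ((hKv _).1 hx)
  have hpc : ∀ C, (part C).card = C.supp.ncard := by
    intro C
    rw [← Set.ncard_coe_finset]
    refine Set.ncard_congr (fun v hv => ⟨Sum.inl v, ((hmem C v).1 (by simpa using hv)).1⟩) ?_ ?_ ?_
    · intro v hv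
      exact ((hmem C v).1 (by simpa using hv)).2
    · intro a b ha hb hab
      simpa using hab
    · rintro ⟨x, hx⟩ hC
      rcases x with v | i
      · exact ⟨v, by
          have : v ∈ part C := (hmem C v).2 ⟨hx, hC⟩
          simpa using this, rfl⟩
      · exact absurd (hall i) ((hKv _).1 hx)
  have hpinj : Function.Injective part := by
    intro C C' h
    by_contra hne
    have := hpd C C' hne
    rw [h] at this
    exact (hpne C').ne_empty (Finset.disjoint_self_iff_empty _ |>.1 this)
  have hSU : S.card + d = U.ncard := by
    have : U = (S.map ⟨Sum.inl, Sum.inl_injective⟩ ∪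
        (Finset.univ : Finset (Fin d)).map ⟨Sum.inr, Sum.inr_injective⟩ : Finset (V ⊕ Fin d)) := by
      ext x
      rcases x with v | i
      · simp [S]
      · simp [hall i]
    rw [this, Set.ncard_coe_finset, Finset.card_union_of_disjoint]
    · simp
    · rw [Finset.disjoint_left]; intro x; simp; rintro v _ rfl; simp
  haveI : Fintype K.coe.ConnectedComponent := Fintype.ofFinite _
  have hsum : ∑ C, (part C).card + S.card = Fintype.card V := by
    rw [← Finset.card_biUnion (fun C _ C' _ h => hpd C C' h), ← Finset.card_univ,
      ← Finset.card_union_of_disjoint]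
    · congr 1
      ext v
      simp only [Finset.mem_union, Finset.mem_biUnion, Finset.mem_univ, true_and, iff_true, hmem]
      by_cases hv : Sum.inl v ∈ U
      · right; simp [S, hv]
      · left; exact ⟨_, (hKv _).2 hv, rfl⟩
    · rw [Finset.disjoint_left]
      intro v h1 h2
      simp only [Finset.mem_biUnion, Finset.mem_univ, true_and, hmem] at h1
      obtain ⟨C, h, -⟩ := h1
      exact (hKv _).1 h (Finset.mem_filter.1 h2).2
  have hodd : 2 * ∑ C, (part C).card / 2 + K.coe.oddComponents.ncard = ∑ C, (part C).card := by
    have : K.coe.oddComponents.ncard = ∑ C, (part C).card % 2 := by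
      have e1 : K.coe.oddComponents =
          ((Finset.univ.filter (fun C => (part C).card % 2 = 1) : Finset _) : Set _) := by
        ext C; simp [hpc, Nat.odd_iff]
      rw [e1, Set.ncard_coe_finset, Finset.card_filter]
      refine Finset.sum_congr rfl fun C _ => ?_
      split_ifs with h
      · exact h.symm
      · omega
    rw [this, Finset.mul_sum, ← Finset.sum_add_distrib]
    exact Finset.sum_congr rfl fun C _ => by omega
  refine ⟨S, Finset.univ.image part, ?_, ?_, ?_, ?_⟩
  · intro P hP
    obtain ⟨C, -, rfl⟩ := Finset.mem_image.1 hP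
    refine ⟨hpne C, ?_⟩
    rw [Finset.disjoint_left]
    intro v h1 h2
    exact (hKv _).1 ((hmem _ _).1 h2).1 (Finset.mem_filter.1 h1).2
  · intro P hP Q hQ hne
    obtain ⟨C, -, rfl⟩ := Finset.mem_image.1 hP
    obtain ⟨C', -, rfl⟩ := Finset.mem_image.1 hQ
    exact hpd C C' (fun h => hne (by rw [h]))
  · intro u v huv
    by_cases hu : Sum.inl u ∈ U
    · left; simp [S, hu]
    by_cases hv : Sum.inl v ∈ U
    · right; left; simp [S, hv]
    right; right
    have hu' := (hKv (Sum.inl u)).2 hu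
    have hv' := (hKv (Sum.inl v)).2 hv
    refine ⟨part (K.coe.connectedComponentMk ⟨_, hu'⟩), Finset.mem_image_of_mem _
      (Finset.mem_univ _), (hmem _ _).2 ⟨hu', rfl⟩, (hmem _ _).2 ⟨hv', ?_⟩⟩
    apply SimpleGraph.ConnectedComponent.sound
    apply SimpleGraph.Adj.reachable
    rw [hKa]
    refine ⟨by simpa using huv.ne.symm, fun a b ha hb => ?_⟩
    rw [← Sum.inl_injective ha, ← Sum.inl_injective hb]
    exact huv.symm
  · rw [Finset.sum_image (fun C _ C' _ h => hpinj h)]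
    omega

/-- Gallai--Edmonds style cover. -/
def IsTB (H : SimpleGraph V) (S : Finset V) (Pt : Finset (Finset V)) (w : ℕ) : Prop :=
  (∀ P ∈ Pt, 3 ≤ P.card ∧ Odd P.card ∧ Disjoint S P) ∧
  (∀ P ∈ Pt, ∀ Q ∈ Pt, P ≠ Q → Disjoint P Q) ∧
  (∀ u v, H.Adj u v → u ∈ S ∨ v ∈ S ∨ ∃ P ∈ Pt, u ∈ P ∧ v ∈ P) ∧
  S.card + ∑ P ∈ Pt, P.card / 2 ≤ w

theorem tutte_berge (H : SimpleGraph V) (w : ℕ) (hm : 2 * w + 2 ≤ Fintype.card V)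
    (hno : ¬ ∃ M : Finset (Sym2 V), IsMatchingOfSize H M (w + 1)) :
    ∃ S Pt, IsTB H S Pt w := by
  classical
  let Q : ℕ → Prop := fun k => ∃ (S : Finset V) (Pt : Finset (Finset V)),
      (∀ P ∈ Pt, P.Nonempty ∧ Disjoint S P) ∧
      (∀ P ∈ Pt, ∀ Q ∈ Pt, P ≠ Q → Disjoint P Q) ∧
      (∀ u v, H.Adj u v → u ∈ S ∨ v ∈ S ∨ ∃ P ∈ Pt, u ∈ P ∧ v ∈ P) ∧
      S.card + ∑ P ∈ Pt, P.card / 2 ≤ w ∧ S.card = k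
  obtain ⟨S0, Pt0, a1, a2, a3, a4⟩ := tb_first H w hm hno
  have hQ0 : Q S0.card := ⟨S0, Pt0, a1, a2, a3, a4, rfl⟩
  have hb : ∀ k, Q k → k ≤ w := by
    rintro k ⟨S, Pt, -, -, -, h, rfl⟩; omega
  have hspec := Nat.findGreatest_spec (P := Q) (hb _ hQ0) hQ0
  obtain ⟨S, Pt, h1, h2, h3, h4, h5⟩ := hspec
  have hodd : ∀ P ∈ Pt, Odd P.card := by
    intro P hP
    by_contra hcon
    rw [Nat.not_odd_iff_even] at hcon
    obtain ⟨x, hx⟩ := (h1 P hP).1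
    have hxS : x ∉ S := fun h => Finset.disjoint_left.1 (h1 P hP).2 h hx
    have hpos : 2 ≤ P.card := by
      have := Finset.card_pos.2 ⟨x, hx⟩
      rcases hcon with ⟨k, hk⟩; omega
    have hce : (P.erase x).card = P.card - 1 := Finset.card_erase_of_mem hx
    have hen : (P.erase x).Nonempty := by rw [← Finset.card_pos]; omega
    have hQn : Q (S.card + 1) := by
      refine ⟨insert x S, insert (P.erase x) (Pt.erase P), ?_, ?_, ?_, ?_, ?_⟩
      · intro R hR
        rcases Finset.mem_insert.1 hR with rfl | hR
        · refine ⟨hen, ?_⟩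
          rw [Finset.disjoint_insert_left]
          exact ⟨by simp, (h1 P hP).2.mono_right (Finset.erase_subset _ _)⟩
        · have hR' := Finset.mem_erase.1 hR
          refine ⟨(h1 R hR'.2).1, ?_⟩
          rw [Finset.disjoint_insert_left]
          exact ⟨fun h => Finset.disjoint_left.1 (h2 R hR'.2 P hP hR'.1) h hx, (h1 R hR'.2).2⟩
      · have aux : ∀ R ∈ Pt.erase P, Disjoint (P.erase x) R := fun R hR =>
          (h2 P hP R (Finset.mem_of_mem_erase hR) (Finset.ne_of_mem_erase hR).symm).mono_left
            (Finset.erase_subset _ _)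
        intro R hR R' hR' hne
        rcases Finset.mem_insert.1 hR with rfl | hR <;>
          rcases Finset.mem_insert.1 hR' with rfl | hR'
        · exact absurd rfl hne
        · exact aux _ hR'
        · exact (aux _ hR).symm
        · exact h2 R (Finset.mem_of_mem_erase hR) R' (Finset.mem_of_mem_erase hR') hne
      · intro u v huv
        by_cases hux : u = x
        · left; simp [hux]
        by_cases hvx : v = x
        · right; left; simp [hvx]
        rcases h3 u v huv with h | h | ⟨R, hR, hu, hv⟩
        · left; simp [h]
        · right; left; simp [h]
        · right; right
          by_cases hRP : R = P
          · exact ⟨P.erase x, by simp, by simp [hux, ← hRP, hu], by simp [hvx, ← hRP, hv]⟩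
          · exact ⟨R, by simp [hRP, hR], hu, hv⟩
      · rw [Finset.card_insert_of_notMem hxS, Finset.sum_insert]
        · have := Finset.add_sum_erase Pt (fun P => P.card / 2) hP
          rcases hcon with ⟨k, hk⟩
          omega
        · intro hmem
          have h6 := h2 P hP _ (Finset.mem_of_mem_erase hmem) (Finset.ne_of_mem_erase hmem).symm
          obtain ⟨y, hy⟩ := hen
          exact Finset.disjoint_left.1 h6 (Finset.mem_of_mem_erase hy) hy
      · exact Finset.card_insert_of_notMem hxS
    have := Nat.le_findGreatest (hb _ hQn) hQn
    omega
  refine ⟨S, Pt.filter (fun P => 3 ≤ P.card), ?_, ?_, ?_, ?_⟩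
  · intro P hP
    have := Finset.mem_filter.1 hP
    exact ⟨this.2, hodd P this.1, (h1 P this.1).2⟩
  · intro P hP R hR
    exact h2 P (Finset.mem_filter.1 hP).1 R (Finset.mem_filter.1 hR).1
  · intro u v huv
    rcases h3 u v huv with h | h | ⟨R, hR, hu, hv⟩
    · left; simp [h]
    · right; left; simp [h]
    · right; right
      refine ⟨R, Finset.mem_filter.2 ⟨hR, ?_⟩, hu, hv⟩
      have hne := huv.ne
      have : 2 ≤ R.card := by
        have := Finset.card_le_card (s := {u, v}) (t := R) (by
          intro z hz; simp at hz; rcases hz with rfl | rfl <;> assumption)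
        rwa [Finset.card_pair hne] at this
      rcases hodd R hR with ⟨k, hk⟩; omega
  · refine le_trans ?_ h4
    gcongr
    exact Finset.filter_subset _ _
end
end

section
open Set
set_option linter.all false

section
variable {V : Type*} {T : SimpleGraph V}

lemma K33Free.two (h : K33Free T) {a b x y : V} {C D : Set V} (hab : a ≠ b) (hxy : x ≠ y)
    (hC : ConnSet T C) (hD : ConnSet T D) (hCD : Disjoint C D)
    (aC : a ∉ C) (bC : b ∉ C) (xC : x ∉ C) (yC : y ∉ C)
    (aD : a ∉ D) (bD : b ∉ D) (xD : x ∉ D) (yD : y ∉ D)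
    (ax : T.Adj a x) (ay : T.Adj a y) (bx : T.Adj b x) (by' : T.Adj b y)
    (haD : ∃ v ∈ D, T.Adj a v) (hbD : ∃ v ∈ D, T.Adj b v)
    (hxC : ∃ v ∈ C, T.Adj x v) (hyC : ∃ v ∈ C, T.Adj y v)
    (hCDa : ∃ u ∈ C, ∃ v ∈ D, T.Adj u v) : False := by
  have n1 := ax.ne
  have n2 := ay.ne
  have n3 := bx.ne
  have n4 := by'.ne
  refine h.elim {a} {b} C {x} {y} D (connSet_singleton _) (connSet_singleton _) hC
    (connSet_singleton _) (connSet_singleton _) hD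
    (by simpa using hab) (by simpa using aC) (by simpa using n1) (by simpa using n2)
    (by simpa using aD) (by simpa using bC) (by simpa using n3) (by simpa using n4)
    (by simpa using bD) (by simpa using xC) (by simpa using yC) hCD (by simpa using hxy)
    (by simpa using xD) (by simpa using yD)
    ⟨a, rfl, x, rfl, ax⟩ ⟨a, rfl, y, rfl, ay⟩ ⟨a, rfl, haD⟩ ⟨b, rfl, x, rfl, bx⟩
    ⟨b, rfl, y, rfl, by'⟩ ⟨b, rfl, hbD⟩ ?_ ?_ hCDa
  · obtain ⟨v, hv, h⟩ := hxC; exact ⟨v, hv, x, rfl, h.symm⟩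
  · obtain ⟨v, hv, h⟩ := hyC; exact ⟨v, hv, y, rfl, h.symm⟩

lemma K33Free.points (h : K33Free T) {a b c x y z : V} (hab : a ≠ b) (hac : a ≠ c) (hbc : b ≠ c)
    (hxy : x ≠ y) (hxz : x ≠ z) (hyz : y ≠ z)
    (ax : T.Adj a x) (ay : T.Adj a y) (az : T.Adj a z)
    (bx : T.Adj b x) (by' : T.Adj b y) (bz : T.Adj b z)
    (cx : T.Adj c x) (cy : T.Adj c y) (cz : T.Adj c z) : False := by
  refine h.two (a := a) (b := b) (x := x) (y := y) (C := {c}) (D := {z}) hab hxy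
    (connSet_singleton _) (connSet_singleton _) (by simpa using cz.ne)
    (by simpa using hac) (by simpa using hbc) (by simpa using cx.ne.symm)
    (by simpa using cy.ne.symm) (by simpa using az.ne) (by simpa using bz.ne)
    (by simpa using hxz) (by simpa using hyz) ax ay bx by' ⟨z, rfl, az⟩ ⟨z, rfl, bz⟩
    ⟨c, rfl, cx.symm⟩ ⟨c, rfl, cy.symm⟩ ⟨c, rfl, z, rfl, cz⟩

lemma K5Free.two (h : K5Free T) {x y z : V} {C D : Set V}
    (hC : ConnSet T C) (hD : ConnSet T D) (hCD : Disjoint C D)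
    (xC : x ∉ C) (yC : y ∉ C) (zC : z ∉ C) (xD : x ∉ D) (yD : y ∉ D) (zD : z ∉ D)
    (xy : T.Adj x y) (xz : T.Adj x z) (yz : T.Adj y z)
    (hxC : ∃ v ∈ C, T.Adj x v) (hyC : ∃ v ∈ C, T.Adj y v) (hzC : ∃ v ∈ C, T.Adj z v)
    (hxD : ∃ v ∈ D, T.Adj x v) (hyD : ∃ v ∈ D, T.Adj y v) (hzD : ∃ v ∈ D, T.Adj z v)
    (hCDa : ∃ u ∈ C, ∃ v ∈ D, T.Adj u v) : False :=
  h.elim {x} {y} {z} C D (connSet_singleton _) (connSet_singleton _) (connSet_singleton _)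
    hC hD (by simpa using xy.ne) (by simpa using xz.ne) (by simpa using xC) (by simpa using xD)
    (by simpa using yz.ne) (by simpa using yC) (by simpa using yD) (by simpa using zC)
    (by simpa using zD) hCD ⟨x, rfl, y, rfl, xy⟩ ⟨x, rfl, z, rfl, xz⟩ ⟨x, rfl, hxC⟩
    ⟨x, rfl, hxD⟩ ⟨y, rfl, z, rfl, yz⟩ ⟨y, rfl, hyC⟩ ⟨y, rfl, hyD⟩ ⟨z, rfl, hzC⟩ ⟨z, rfl, hzD⟩ hCDa

end

section
variable {V : Type*} [Fintype V] [DecidableEq V]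

/-- combinatorial triangulation -/
structure PT (T : SimpleGraph V) : Prop where
  k5 : K5Free T
  k33 : K33Free T
  hn : 11 ≤ Fintype.card V
  edges : cnt T Finset.univ Finset.univ + 12 = 6 * Fintype.card V

variable {T G H : SimpleGraph V}

lemma PT.mindeg (h : PT T) (v : V) : 3 ≤ cnt T {v} (Finset.univ.erase v) := by
  have h1 := mader h.k5 (Finset.univ.erase v) (by
    rw [Finset.card_erase_of_mem (Finset.mem_univ _), Finset.card_univ]; have := h.hn; omega)
  have h2 := cnt_insert_self (G := T) (v := v) (A := Finset.univ.erase v) (by simp)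
  rw [Finset.insert_erase (Finset.mem_univ _)] at h2
  rw [Finset.card_erase_of_mem (Finset.mem_univ _), Finset.card_univ] at h1
  have := h.edges
  have := h.hn
  omega

/-- a vertex with few neighbours in `S` has a neighbour outside `S` -/
lemma PT.exists_nbr (h : PT T) (v : V) (S : Finset V) (hS : cnt T {v} S ≤ 2) :
    ∃ y, y ∉ S ∧ T.Adj v y := by
  by_contra hcon
  push Not at hcon
  have h1 := h.mindeg v
  have h2 : cnt T {v} (Finset.univ.erase v) ≤ cnt T {v} S := by
    rw [cnt_single_eq, cnt_single_eq]
    refine Finset.sum_le_sum_of_ne_zero fun x _ hx => ?_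
    by_contra hxS
    exact hx (ad_zero.2 (hcon x hxS))
  omega

/-- the full vertices of `W` w.r.t. a triple -/
noncomputable def fullSet (T : SimpleGraph V) (a b c : V) (W : Finset V) : Finset V :=
  open Classical in W.filter (fun x => T.Adj a x ∧ T.Adj b x ∧ T.Adj c x)

lemma mem_fullSet {a b c x : V} {W : Finset V} :
    x ∈ fullSet T a b c W ↔ x ∈ W ∧ T.Adj a x ∧ T.Adj b x ∧ T.Adj c x := by
  simp [fullSet]

lemma full_card_le (h : K33Free T) {a b c : V} (hab : a ≠ b) (hac : a ≠ c) (hbc : b ≠ c)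
    (W : Finset V) : (fullSet T a b c W).card ≤ 2 := by
  by_contra hcon
  push Not at hcon
  obtain ⟨x, hx, y, hy, z, hz, hxy, hxz, hyz⟩ := Finset.two_lt_card.1 hcon
  rw [mem_fullSet] at hx hy hz
  exact h.points hab hac hbc hxy hxz hyz hx.2.1 hy.2.1 hz.2.1 hx.2.2.1 hy.2.2.1 hz.2.2.1
    hx.2.2.2 hy.2.2.2 hz.2.2.2

lemma cnt_triple_le {a b c : V} (hab : a ≠ b) (hac : a ≠ c) (hbc : b ≠ c) (x : V) :
    cnt T {x} {a, b, c} ≤ 2 + open Classical in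
      (if T.Adj a x ∧ T.Adj b x ∧ T.Adj c x then 1 else 0) := by
  rw [cnt_single_three x hab hac hbc]
  have h1 := ad_le (G := T) x a
  have h2 := ad_le (G := T) x b
  have h3 := ad_le (G := T) x c
  split_ifs with h
  · omega
  · by_contra hcon
    have e1 : ad T x a = 1 := by omega
    have e2 : ad T x b = 1 := by omega
    have e3 : ad T x c = 1 := by omega
    exact h ⟨(ad_one.1 e1).symm, (ad_one.1 e2).symm, (ad_one.1 e3).symm⟩

lemma cnt_triple_sum_le {a b c : V} (hab : a ≠ b) (hac : a ≠ c) (hbc : b ≠ c) (W : Finset V) :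
    cnt T {a, b, c} W ≤ 2 * W.card + (fullSet T a b c W).card := by
  classical
  rw [cnt_right_sum', fullSet, Finset.card_filter, mul_comm, ← smul_eq_mul, ← Finset.sum_const,
    ← Finset.sum_add_distrib]
  exact Finset.sum_le_sum fun x _ => by
    have := cnt_triple_le (T := T) hab hac hbc x
    convert this

lemma cnt_const_le {A W : Finset V} : cnt T A W ≤ A.card * W.card := cnt_le_mul A W

lemma cnt_split (W S : Finset V) (hS : S ⊆ W) :
    cnt G W W = cnt G S S + 2 * cnt G S (W \ S) + cnt G (W \ S) (W \ S) := by
  rw [← cnt_union_self Finset.disjoint_sdiff, Finset.union_sdiff_of_subset hS]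

lemma IsTB.rest_le {S : Finset V} {Pt : Finset (Finset V)} {w : ℕ} (h : IsTB H S Pt w)
    (W : Finset V) (hW : Disjoint W S) : cnt H W W ≤ ∑ P ∈ Pt, cnt H (P ∩ W) (P ∩ W) := by
  classical
  have key : ∀ u ∈ W, ∀ v ∈ W, ad H u v ≤
      ∑ P ∈ Pt, (if u ∈ P then (if v ∈ P then ad H u v else 0) else 0) := by
    intro u hu v hv
    by_cases hadj : H.Adj u v
    · rcases h.2.2.1 u v hadj with h1 | h1 | ⟨P, hP, h1, h2⟩
      · exact absurd h1 (Finset.disjoint_left.1 hW hu)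
      · exact absurd h1 (Finset.disjoint_left.1 hW hv)
      · refine le_trans ?_ (Finset.single_le_sum (f := fun P =>
          (if u ∈ P then (if v ∈ P then ad H u v else 0) else 0)) (fun _ _ => Nat.zero_le _) hP)
        simp [h1, h2]
    · rw [ad_zero.2 hadj]; exact Nat.zero_le _
  calc cnt H W W ≤ ∑ u ∈ W, ∑ v ∈ W, ∑ P ∈ Pt,
        (if u ∈ P then (if v ∈ P then ad H u v else 0) else 0) :=
        Finset.sum_le_sum fun u hu => Finset.sum_le_sum fun v hv => key u hu v hv
    _ = ∑ u ∈ W, ∑ P ∈ Pt, ∑ v ∈ W, (if u ∈ P then (if v ∈ P then ad H u v else 0) else 0) :=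
        Finset.sum_congr rfl fun u _ => Finset.sum_comm
    _ = ∑ P ∈ Pt, ∑ u ∈ W, ∑ v ∈ W, (if u ∈ P then (if v ∈ P then ad H u v else 0) else 0) :=
        Finset.sum_comm
    _ = _ := by
        refine Finset.sum_congr rfl fun P _ => ?_
        unfold cnt
        rw [Finset.inter_comm, ← Finset.filter_mem_eq_inter, Finset.sum_filter]
        refine Finset.sum_congr rfl fun u _ => ?_
        split_ifs with h1
        · rw [Finset.sum_filter]
        · simp

/-- parts: total bound -/
lemma IsTB.parts_le (hT : K5Free T) (hle : H ≤ T) {S : Finset V} {Pt : Finset (Finset V)} {w : ℕ}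
    (h : IsTB H S Pt w) (W : Finset V) :
    ∑ P ∈ Pt, cnt H (P ∩ W) (P ∩ W) + 6 * Pt.card ≤ 12 * ∑ P ∈ Pt, P.card / 2 := by
  rw [mul_comm 6, ← smul_eq_mul (a := Pt.card), ← Finset.sum_const, ← Finset.sum_add_distrib,
    Finset.mul_sum]
  refine Finset.sum_le_sum fun P hP => ?_
  obtain ⟨h1, h2, h3⟩ := h.1 P hP
  have := mader hT P h1
  have := cnt_mono hle (P ∩ W) (P ∩ W)
  have := cnt_mono_sets (G := T) (A := P ∩ W) (A' := P) (B := P ∩ W) (B' := P)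
    Finset.inter_subset_left Finset.inter_subset_left
  rcases h2 with ⟨k, hk⟩
  omega

lemma IsTB.card_parts {S : Finset V} {Pt : Finset (Finset V)} {w : ℕ} (h : IsTB H S Pt w) :
    Pt.card ≤ ∑ P ∈ Pt, P.card / 2 := by
  rw [Finset.card_eq_sum_ones]
  exact Finset.sum_le_sum fun P hP => by have := (h.1 P hP).1; omega

/-- graphs without a 4-matching supported on `W` -/
lemma no4_bound (hT : PT T) (hle : H ≤ T) (W : Finset V) (hW : 9 ≤ W.card)
    (hsup : ∀ u v, H.Adj u v → u ∈ W)
    (hno : ¬ ∃ M : Finset (Sym2 V), IsMatchingOfSize H M 4) :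
    cnt H Finset.univ Finset.univ + 2 ≤ 4 * W.card := by
  classical
  obtain ⟨S, Pt, hTB⟩ := tutte_berge H 3 (by have := hT.hn; omega) hno
  have e0 : cnt H Finset.univ Finset.univ = cnt H W W := by
    rw [cnt_split Finset.univ W (Finset.subset_univ _)]
    have h1 : cnt H W (Finset.univ \ W) = 0 := by
      rw [cnt_eq_zero]; intro a _ b hb hab
      exact (Finset.mem_sdiff.1 hb).2 (hsup b a hab.symm)
    have h2 : cnt H (Finset.univ \ W) (Finset.univ \ W) = 0 := by
      rw [cnt_eq_zero]; intro a _ b hb hab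
      exact (Finset.mem_sdiff.1 hb).2 (hsup b a hab.symm)
    omega
  rw [e0]
  set S' := W ∩ S with hS'
  have hS'W : S' ⊆ W := Finset.inter_subset_left
  have hS'c : S'.card ≤ S.card := Finset.card_le_card Finset.inter_subset_right
  set R := W \ S' with hR
  have hRc : R.card + S'.card = W.card := by
    rw [hR, Finset.card_sdiff_of_subset hS'W]
    have := Finset.card_le_card hS'W; omega
  have hRS : Disjoint R S := by
    rw [Finset.disjoint_left]; intro x hx hxS
    rw [hR, Finset.mem_sdiff] at hx
    exact hx.2 (Finset.mem_inter.2 ⟨hx.1, hxS⟩)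
  have e1 := cnt_split (G := H) W S' hS'W
  rw [← hR] at e1
  have e2 := hTB.rest_le R hRS
  have e3 := hTB.parts_le hT.k5 hle R
  have e4 := hTB.card_parts
  have e5 := hTB.2.2.2
  have b1 : cnt H S' S' + S'.card ≤ S'.card * S'.card := cnt_self_le S'
  have b2 : cnt H S' R ≤ S'.card * R.card := cnt_le_mul _ _
  have hs3 : S.card ≤ 3 := by omega
  -- easy case: few vertices
  by_cases hs : S'.card = 3
  · have hJ : ∑ P ∈ Pt, P.card / 2 = 0 := by omega
    have hz : cnt H R R = 0 := by omega
    obtain ⟨a, b, c, hab, hac, hbc, habc⟩ := Finset.card_eq_three.1 hs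
    have h1 := cnt_triple_sum_le (T := T) hab hac hbc R
    have h2 := full_card_le hT.k33 hab hac hbc R
    have h3 := cnt_mono hle S' R
    rw [← habc] at h1
    rw [hs] at b1
    omega
  have hs2 : S'.card ≤ 2 := by omega
  by_cases hJ2 : Pt.card = 0
  · have hz : cnt H R R = 0 := by
      have : Pt = ∅ := Finset.card_eq_zero.1 hJ2
      rw [this] at e2; simpa using e2
    interval_cases hh : S'.card <;> omega
  -- if |S'| = 2 and |S| = 2, one part of size three
  by_cases hs' : S'.card = 2
  · have hPt : Pt.card = 1 := by omega
    obtain ⟨P, rfl⟩ := Finset.card_eq_one.1 hPt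
    have hP3 : P.card / 2 ≤ 1 := by simp at e5; omega
    have hPc : P.card ≤ 3 := by omega
    simp only [Finset.sum_singleton] at e2
    set Q := P ∩ R with hQ
    have hQR : Q ⊆ R := Finset.inter_subset_right
    have hQc : Q.card ≤ 3 := (Finset.card_le_card Finset.inter_subset_left).trans hPc
    have hdis : Disjoint S' Q := by
      rw [Finset.disjoint_left]; intro x hx hxQ
      have := hQR hxQ
      rw [hR, Finset.mem_sdiff] at this
      exact this.2 hx
    have f1 := cnt_union_self (G := H) hdis
    have f2 : cnt H S' R = cnt H S' Q + cnt H S' (R \ Q) := by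
      rw [← cnt_union_right Finset.disjoint_sdiff, Finset.union_sdiff_of_subset hQR]
    have f3 : cnt H S' (R \ Q) ≤ S'.card * (R \ Q).card := cnt_le_mul _ _
    have f4 : (R \ Q).card + Q.card = R.card := by
      rw [Finset.card_sdiff_of_subset hQR]
      have := Finset.card_le_card hQR; omega
    by_cases hQ0 : Q.card = 0
    · have hQe : Q = ∅ := Finset.card_eq_zero.1 hQ0
      rw [hQe] at e2
      simp at e2
      rw [hs'] at b1 b2
      omega
    · have hu : (S' ∪ Q).card = 2 + Q.card := by rw [Finset.card_union_of_disjoint hdis, hs']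
      have f5 := mader hT.k5 (S' ∪ Q) (by omega)
      have f6 := cnt_mono hle (S' ∪ Q) (S' ∪ Q)
      rw [hs'] at f3
      omega
  · have : S'.card ≤ 1 := by omega
    interval_cases hh : S'.card <;> omega
end
end

section
open Set
set_option linter.all false

section
variable {V : Type*} [Fintype V] [DecidableEq V] {T G : SimpleGraph V} {c : Sym2 V → ℕ}

/-- a representing subgraph for a colouring without rainbow 5-matching -/
structure CRep (T G : SimpleGraph V) (c : Sym2 V → ℕ) : Prop where
  le : G ≤ T
  inj : Set.InjOn c G.edgeSet
  surj : ∀ x y, T.Adj x y → ∃ u v, G.Adj u v ∧ c s(u, v) = c s(x, y)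
  big : 4 * Fintype.card V + 2 ≤ cnt G Finset.univ Finset.univ
  no : ¬ HasRainbowMatching T c 5

/-- edges of `G` whose colour is not `k` -/
def Gd (G : SimpleGraph V) (c : Sym2 V → ℕ) (k : ℕ) : SimpleGraph V where
  Adj u v := G.Adj u v ∧ c s(u, v) ≠ k
  symm := ⟨fun u v h => ⟨h.1.symm, by rw [Sym2.eq_swap]; exact h.2⟩⟩
  loopless := ⟨fun u h => h.1.ne rfl⟩

lemma Gd_le (k : ℕ) : Gd G c k ≤ G := fun _ _ h => h.1

lemma Gd_adj {k : ℕ} {u v : V} : (Gd G c k).Adj u v ↔ G.Adj u v ∧ c s(u, v) ≠ k := Iff.rfl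

lemma rm_insert {k : ℕ} {M : Finset (Sym2 V)} (hM : IsMatchingOfSize T M k ∧ Set.InjOn c (M : Set (Sym2 V)))
    {x y : V} (hxy : T.Adj x y) (hd : ∀ e ∈ M, x ∉ e ∧ y ∉ e) (hc : ∀ e ∈ M, c s(x, y) ≠ c e) :
    IsMatchingOfSize T (insert s(x, y) M) (k + 1) ∧
      Set.InjOn c ((insert s(x, y) M : Finset (Sym2 V)) : Set (Sym2 V)) := by
  have hnot : s(x, y) ∉ M := fun h => (hd _ h).1 (by simp)
  obtain ⟨⟨h1, h2, h3⟩, h4⟩ := hM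
  refine ⟨⟨by rw [Finset.card_insert_of_notMem hnot, h1], ?_, ?_⟩, ?_⟩
  · intro e he
    rw [Finset.coe_insert] at he
    rcases he with rfl | he
    · exact hxy
    · exact h2 he
  · intro e he e' he' hne v hv hv'
    rw [Finset.mem_insert] at he he'
    rcases he with rfl | he <;> rcases he' with rfl | he'
    · exact hne rfl
    · rcases Sym2.mem_iff.1 hv with rfl | rfl
      · exact (hd _ he').1 hv'
      · exact (hd _ he').2 hv'
    · rcases Sym2.mem_iff.1 hv' with rfl | rfl
      · exact (hd _ he).1 hv
      · exact (hd _ he).2 hv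
    · exact h3 e he e' he' hne v hv hv'
  · rw [Finset.coe_insert, Set.injOn_insert (by exact_mod_cast hnot)]
    refine ⟨h4, ?_⟩
    rintro ⟨e, he, hce⟩
    exact hc e he hce.symm

namespace CRep

lemma no5 (R : CRep T G c) {a₁ b₁ a₂ b₂ a₃ b₃ a₄ b₄ a₅ b₅ : V}
    (h₁ : T.Adj a₁ b₁) (h₂ : T.Adj a₂ b₂) (h₃ : T.Adj a₃ b₃) (h₄ : T.Adj a₄ b₄) (h₅ : T.Adj a₅ b₅)
    (hn : [a₁, b₁, a₂, b₂, a₃, b₃, a₄, b₄, a₅, b₅].Nodup)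
    (hc : [c s(a₁, b₁), c s(a₂, b₂), c s(a₃, b₃), c s(a₄, b₄), c s(a₅, b₅)].Nodup) : False := by
  simp only [List.nodup_cons, List.mem_cons, not_or, List.not_mem_nil, not_false_eq_true] at hn hc
  have m0 : IsMatchingOfSize T (∅ : Finset (Sym2 V)) 0 ∧
      Set.InjOn c ((∅ : Finset (Sym2 V)) : Set (Sym2 V)) := by simp [IsMatchingOfSize]
  have m1 := rm_insert m0 h₅ (by simp) (by simp)
  have m2 := rm_insert m1 h₄ (by simp [hn]) (by simp [hc])
  have m3 := rm_insert m2 h₃ (by simp [hn]) (by simp [hc])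
  have m4 := rm_insert m3 h₂ (by simp [hn]) (by simp [hc])
  have m5 := rm_insert m4 h₁ (by simp [hn]) (by simp [hc])
  exact R.no ⟨_, m5⟩

lemma col_ne (R : CRep T G c) {a b x y : V} (h : G.Adj a b) (h' : G.Adj x y) (h1 : a ≠ x) (h2 : a ≠ y) :
    c s(a, b) ≠ c s(x, y) := by
  intro h3
  have := R.inj h h' h3
  simp only [Sym2.eq_iff] at this
  tauto

lemma no_1_4 (R : CRep T G c) {a₁ b₁ a₂ b₂ a₃ b₃ a₄ b₄ x y : V} (hxy : T.Adj x y)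
    (h₁ : (Gd G c (c s(x, y))).Adj a₁ b₁) (h₂ : (Gd G c (c s(x, y))).Adj a₂ b₂)
    (h₃ : (Gd G c (c s(x, y))).Adj a₃ b₃) (h₄ : (Gd G c (c s(x, y))).Adj a₄ b₄)
    (hn : [x, y, a₁, b₁, a₂, b₂, a₃, b₃, a₄, b₄].Nodup) : False := by
  refine R.no5 hxy (R.le h₁.1) (R.le h₂.1) (R.le h₃.1) (R.le h₄.1) hn ?_
  simp only [List.nodup_cons, List.mem_cons, not_or, List.not_mem_nil, not_false_eq_true] at hn ⊢
  have := h₁.2.symm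
  have := h₂.2.symm
  have := h₃.2.symm
  have := h₄.2.symm
  have := R.col_ne h₁.1 h₂.1 (by tauto) (by tauto)
  have := R.col_ne h₁.1 h₃.1 (by tauto) (by tauto)
  have := R.col_ne h₁.1 h₄.1 (by tauto) (by tauto)
  have := R.col_ne h₂.1 h₃.1 (by tauto) (by tauto)
  have := R.col_ne h₂.1 h₄.1 (by tauto) (by tauto)
  have := R.col_ne h₃.1 h₄.1 (by tauto) (by tauto)
  simp only [List.nodup_nil, and_true]
  tauto

lemma no_2_3 (R : CRep T G c) {a₁ b₁ a₂ b₂ a₃ b₃ x y z w : V} (hxy : T.Adj x y) (hzw : T.Adj z w)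
    (hne : c s(x, y) ≠ c s(z, w))
    (h₁ : (Gd G c (c s(x, y))).Adj a₁ b₁) (h₂ : (Gd G c (c s(x, y))).Adj a₂ b₂)
    (h₃ : (Gd G c (c s(x, y))).Adj a₃ b₃)
    (k₁ : c s(a₁, b₁) ≠ c s(z, w)) (k₂ : c s(a₂, b₂) ≠ c s(z, w)) (k₃ : c s(a₃, b₃) ≠ c s(z, w))
    (hn : [x, y, z, w, a₁, b₁, a₂, b₂, a₃, b₃].Nodup) : False := by
  refine R.no5 hxy hzw (R.le h₁.1) (R.le h₂.1) (R.le h₃.1) hn ?_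
  simp only [List.nodup_cons, List.mem_cons, not_or, List.not_mem_nil, not_false_eq_true] at hn ⊢
  have := h₁.2.symm
  have := h₂.2.symm
  have := h₃.2.symm
  have := k₁.symm
  have := k₂.symm
  have := k₃.symm
  have := R.col_ne h₁.1 h₂.1 (by tauto) (by tauto)
  have := R.col_ne h₁.1 h₃.1 (by tauto) (by tauto)
  have := R.col_ne h₂.1 h₃.1 (by tauto) (by tauto)
  simp only [List.nodup_nil, and_true]
  tauto

lemma lost (R : CRep T G c) {k : ℕ} : ∃ e₀ : Sym2 V, ∀ u v, G.Adj u v → (Gd G c k).Adj u v ∨ s(u, v) = e₀ := by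
  by_cases h : ∃ u v, G.Adj u v ∧ c s(u, v) = k
  · obtain ⟨u, v, huv, hc⟩ := h
    refine ⟨s(u, v), fun x y hxy => ?_⟩
    by_cases hk : c s(x, y) = k
    · right; exact R.inj hxy huv (hk.trans hc.symm)
    · left; exact ⟨hxy, hk⟩
  · push Not at h
    rcases isEmpty_or_nonempty V with hV | ⟨⟨v⟩⟩
    · have h1 := R.big
      have h2 := cnt_le_mul (G := G) Finset.univ Finset.univ
      rw [Finset.card_univ, Fintype.card_eq_zero] at h2
      omega
    · exact ⟨s(v, v), fun u w huw => Or.inl ⟨huw, h u w huw⟩⟩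

lemma cnt_Gd (R : CRep T G c) (k : ℕ) : cnt G Finset.univ Finset.univ ≤ cnt (Gd G c k) Finset.univ Finset.univ + 2 := by
  obtain ⟨e₀, h⟩ := R.lost (k := k)
  rw [← two_mul_edges, ← two_mul_edges]
  have : G.edgeSet ⊆ insert e₀ (Gd G c k).edgeSet := by
    intro e he
    induction e using Sym2.ind with
    | _ u v => rcases h u v he with h | h
               · exact Or.inr h
               · exact Or.inl h
  have h1 := Set.ncard_le_ncard this (Set.toFinite _)
  have h2 := Set.ncard_insert_le e₀ (Gd G c k).edgeSet
  omega

end CRep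

/-- systems of distinct representatives -/
lemma sdr {H G : SimpleGraph V} {a b d : V} (hab : a ≠ b) (had : a ≠ d) (hbd : b ≠ d)
    (hl : ∃ e₀ : Sym2 V, ∀ u v, G.Adj u v → H.Adj u v ∨ s(u, v) = e₀)
    (Y : Finset V) (h3 : 3 ≤ Y.card) (h2 : ∀ y ∈ Y, 2 ≤ cnt G {y} {a, b, d})
    (hda : a ∉ Y) (hdb : b ∉ Y) (hdd : d ∉ Y)
    (ha : ∃ y ∈ Y, H.Adj a y) (hb : ∃ y ∈ Y, H.Adj b y) (hd : ∃ y ∈ Y, H.Adj d y) :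
    ∃ x ∈ Y, ∃ y ∈ Y, ∃ z ∈ Y, x ≠ y ∧ x ≠ z ∧ y ≠ z ∧ H.Adj a x ∧ H.Adj b y ∧ H.Adj d z := by
  classical
  obtain ⟨e₀, hl⟩ := hl
  have key : ∀ y ∈ Y, (G.Adj y a ∧ G.Adj y b) ∨ (G.Adj y a ∧ G.Adj y d) ∨ (G.Adj y b ∧ G.Adj y d) := by
    intro y hy
    have := h2 y hy
    rw [cnt_single_three y hab had hbd] at this
    have h1 := ad_le (G := G) y a
    have h2 := ad_le (G := G) y b
    have h3 := ad_le (G := G) y d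
    simp only [← ad_one]
    omega
  -- any two of them see all but one
  have two : ∀ p q r : V, (∀ y ∈ Y, (G.Adj y p ∧ G.Adj y q) ∨ (G.Adj y p ∧ G.Adj y r) ∨ (G.Adj y q ∧ G.Adj y r))
      → p ≠ q → p ∉ Y → q ∉ Y →
      2 ≤ (Y.filter (fun y => H.Adj p y) ∪ Y.filter (fun y => H.Adj q y)).card := by
    intro p q r hk hpq hp hq
    have hsub : ∃ y₀, Y.erase y₀ ⊆ Y.filter (fun y => H.Adj p y) ∪ Y.filter (fun y => H.Adj q y) := by
      by_cases hex : ∃ y₀ ∈ Y, ¬ H.Adj p y₀ ∧ ¬ H.Adj q y₀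
      · obtain ⟨y₀, hy₀, hp0, hq0⟩ := hex
        refine ⟨y₀, fun y hy => ?_⟩
        rw [Finset.mem_erase] at hy
        simp only [Finset.mem_union, Finset.mem_filter]
        have k0 : s(p, y₀) = e₀ ∨ s(q, y₀) = e₀ := by
          rcases hk y₀ hy₀ with h | h | h
          · exact Or.inl ((hl p y₀ h.1.symm).resolve_left hp0)
          · exact Or.inl ((hl p y₀ h.1.symm).resolve_left hp0)
          · exact Or.inr ((hl q y₀ h.1.symm).resolve_left hq0)
        have k1 : ∀ v, v = p ∨ v = q → G.Adj y v → H.Adj v y := by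
          intro v hv hyv
          refine (hl v y hyv.symm).resolve_right fun h => ?_
          rcases k0 with k0 | k0 <;> rw [← k0, Sym2.eq_iff] at h <;> grind
        rcases hk y hy.2 with h | h | h
        · exact Or.inl ⟨hy.2, k1 p (Or.inl rfl) h.1⟩
        · exact Or.inl ⟨hy.2, k1 p (Or.inl rfl) h.1⟩
        · exact Or.inr ⟨hy.2, k1 q (Or.inr rfl) h.1⟩
      · push Not at hex
        refine ⟨p, fun y hy => ?_⟩
        have hy := Finset.mem_of_mem_erase hy
        simp only [Finset.mem_union, Finset.mem_filter]
        by_cases h : H.Adj p y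
        · exact Or.inl ⟨hy, h⟩
        · exact Or.inr ⟨hy, hex y hy h⟩
    obtain ⟨y₀, hs⟩ := hsub
    have := Finset.card_le_card hs
    have := Finset.pred_card_le_card_erase (s := Y) (a := y₀)
    omega
  have three : Y ⊆ Y.filter (fun y => H.Adj a y) ∪ Y.filter (fun y => H.Adj b y) ∪
      Y.filter (fun y => H.Adj d y) := by
    intro y hy
    simp only [Finset.mem_union, Finset.mem_filter]
    by_contra hcon
    have n1 : ∀ v, v = a ∨ v = b ∨ v = d → G.Adj y v → s(v, y) = e₀ := by
      intro v hv hyv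
      refine (hl v y hyv.symm).resolve_left fun h => ?_
      rcases hv with rfl | rfl | rfl <;> tauto
    have n2 : ∀ u v, u = a ∨ u = b ∨ u = d → v = a ∨ v = b ∨ v = d → u ≠ v → G.Adj y u → G.Adj y v → False := by
      intro u v hu hv huv h1 h2
      have := (n1 u hu h1).trans (n1 v hv h2).symm
      rw [Sym2.eq_iff] at this
      grind
    rcases key y hy with h | h | h
    · exact n2 a b (by simp) (by simp) hab h.1 h.2
    · exact n2 a d (by simp) (by simp) had h.1 h.2
    · exact n2 b d (by simp) (by simp) hbd h.1 h.2
  have hall := (Finset.all_card_le_biUnion_card_iff_exists_injective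
    (![Y.filter (fun y => H.Adj a y), Y.filter (fun y => H.Adj b y), Y.filter (fun y => H.Adj d y)] : Fin 3 → Finset V)).1 ?_
  · obtain ⟨f, hf, hm⟩ := hall
    have m0 := hm 0
    have m1 := hm 1
    have m2 := hm 2
    simp [Finset.mem_filter] at m0 m1 m2
    exact ⟨f 0, m0.1, f 1, m1.1, f 2, m2.1, fun h => by simpa using hf h, fun h => by simpa using hf h,
      fun h => by simpa using hf h, m0.2, m1.2, m2.2⟩
  · have one : ∀ v, (∃ y ∈ Y, H.Adj v y) → 1 ≤ (Y.filter (fun y => H.Adj v y)).card := by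
      rintro v ⟨y, hy, hv⟩
      exact Finset.card_pos.2 ⟨y, by simp [hy, hv]⟩
    have three' := h3.trans (Finset.card_le_card three)
    have tab := two a b d key hab hda hdb
    have tad := two a d b (fun y hy => by have := key y hy; tauto) had hda hdd
    have tbd := two b d a (fun y hy => by have := key y hy; tauto) hbd hdb hdd
    have oa := one a ha
    have ob := one b hb
    have od := one d hd
    intro s
    have hs : ∀ s : Finset (Fin 3), s = ∅ ∨ s = {0} ∨ s = {1} ∨ s = {2} ∨ s = {0, 1} ∨ s = {0, 2} ∨
      s = {1, 2} ∨ s = {0, 1, 2} := by decide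
    rcases hs s with rfl | rfl | rfl | rfl | rfl | rfl | rfl | rfl
    · simp
    · simpa using oa
    · simpa using ob
    · simpa using od
    · simpa [Finset.biUnion_insert] using tab
    · simpa [Finset.biUnion_insert] using tad
    · simpa [Finset.biUnion_insert] using tbd
    · simpa [Finset.biUnion_insert, Finset.union_assoc] using three'

/-- Claim A -/
lemma CRep.claimA (R : CRep T G c) (hT : PT T) {x y : V} (hxy : T.Adj x y) (hG : ¬ G.Adj x y) :
    5 ≤ cnt G {x} Finset.univ + cnt G {y} Finset.univ := by
  set k := c s(x, y) with hk
  let H : SimpleGraph V :=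
    { Adj := fun u v => (Gd G c k).Adj u v ∧ u ≠ x ∧ u ≠ y ∧ v ≠ x ∧ v ≠ y
      symm := ⟨fun u v h => ⟨h.1.symm, h.2.2.2.1, h.2.2.2.2, h.2.1, h.2.2.1⟩⟩
      loopless := ⟨fun u h => h.1.ne rfl⟩ }
  have hle : H ≤ Gd G c k := fun u v h => h.1
  set W : Finset V := Finset.univ \ {x, y} with hW
  have hWc : W.card + 2 = Fintype.card V := by
    rw [hW, Finset.card_sdiff_of_subset (Finset.subset_univ _), Finset.card_univ, Finset.card_pair hxy.ne]
    have := hT.hn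
    omega
  have hno : ¬ ∃ M : Finset (Sym2 V), IsMatchingOfSize H M 4 := by
    rintro ⟨M, h1, h2, h3⟩
    have hMe : ∀ e ∈ M, e ∈ (Gd G c k).edgeSet ∧ x ∉ e ∧ y ∉ e := by
      intro e he
      have := h2 he
      induction e using Sym2.ind with
      | _ u v =>
        have h : H.Adj u v := this
        refine ⟨h.1, ?_, ?_⟩
        · rw [Sym2.mem_iff]; have := h.2; tauto
        · rw [Sym2.mem_iff]; have := h.2; tauto
    refine R.no ⟨_, rm_insert (M := M) (k := 4) ⟨⟨h1, ?_, h3⟩, ?_⟩ hxy (fun e he => (hMe e he).2) ?_⟩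
    · intro e he
      exact SimpleGraph.edgeSet_mono ((Gd_le k).trans R.le) (hMe e he).1
    · intro e he e' he' hc
      exact R.inj (SimpleGraph.edgeSet_mono (Gd_le k) (hMe e he).1)
        (SimpleGraph.edgeSet_mono (Gd_le k) (hMe e' he').1) hc
    · intro e he
      have := (hMe e he).1
      induction e using Sym2.ind with
      | _ u v => exact (show (Gd G c k).Adj u v from this).2.symm
  have hb := no4_bound hT (hle.trans ((Gd_le k).trans R.le)) W (by have := hT.hn; omega)
    (fun u v h => by simp [hW, h.2.1, h.2.2.1]) hno
  have hH : cnt H W W = cnt (Gd G c k) W W := by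
    refine Finset.sum_congr rfl fun u hu => Finset.sum_congr rfl fun v hv => ?_
    refine ad_congr (G := H) (H := Gd G c k) (u := u) (v := v) (x := u) (y := v) ⟨fun h => h.1, fun h => ⟨h, ?_⟩⟩
    simp only [hW, Finset.mem_sdiff, Finset.mem_univ, Finset.mem_insert, Finset.mem_singleton, not_or, true_and] at hu hv
    exact ⟨hu.1, hu.2, hv.1, hv.2⟩
  have h1 := cnt_split (G := Gd G c k) Finset.univ {x, y} (Finset.subset_univ _)
  rw [← hW] at h1
  have h2 : cnt (Gd G c k) {x, y} {x, y} = 0 := by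
    rw [cnt_self_two, ad_zero.2 (fun h : (Gd G c k).Adj x y => hG h.1)]
  have h3 : cnt (Gd G c k) {x, y} W ≤ cnt G {x, y} Finset.univ :=
    (cnt_mono (Gd_le k) _ _).trans (cnt_mono_sets le_rfl (Finset.subset_univ _))
  rw [cnt_insert_left (G := G) (by simpa using hxy.ne)] at h3
  have h4 := R.cnt_Gd k
  have h5 := R.big
  have h6 := cnt_mono_sets (G := H) (Finset.subset_univ W) (Finset.subset_univ W)
  omega

end
end

section
open Set
set_option linter.all false

section
variable {V : Type*} [Fintype V] [DecidableEq V] {T G : SimpleGraph V} {c : Sym2 V → ℕ}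

lemma nd10 {α : Type*} {a₁ a₂ a₃ a₄ a₅ a₆ a₇ a₈ a₉ a₀ : α}
    (h0 : a₁ ≠ a₂) (h1 : a₁ ≠ a₃) (h2 : a₁ ≠ a₄) (h3 : a₁ ≠ a₅) (h4 : a₁ ≠ a₆) (h5 : a₁ ≠ a₇)
    (h6 : a₁ ≠ a₈) (h7 : a₁ ≠ a₉) (h8 : a₁ ≠ a₀) (h9 : a₂ ≠ a₃) (h10 : a₂ ≠ a₄) (h11 : a₂ ≠ a₅)
    (h12 : a₂ ≠ a₆) (h13 : a₂ ≠ a₇) (h14 : a₂ ≠ a₈) (h15 : a₂ ≠ a₉) (h16 : a₂ ≠ a₀) (h17 : a₃ ≠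
    a₄) (h18 : a₃ ≠ a₅) (h19 : a₃ ≠ a₆) (h20 : a₃ ≠ a₇) (h21 : a₃ ≠ a₈) (h22 : a₃ ≠ a₉) (h23 :
    a₃ ≠ a₀) (h24 : a₄ ≠ a₅) (h25 : a₄ ≠ a₆) (h26 : a₄ ≠ a₇) (h27 : a₄ ≠ a₈) (h28 : a₄ ≠ a₉)
    (h29 : a₄ ≠ a₀) (h30 : a₅ ≠ a₆) (h31 : a₅ ≠ a₇) (h32 : a₅ ≠ a₈) (h33 : a₅ ≠ a₉) (h34 : a₅ ≠
    a₀) (h35 : a₆ ≠ a₇) (h36 : a₆ ≠ a₈) (h37 : a₆ ≠ a₉) (h38 : a₆ ≠ a₀) (h39 : a₇ ≠ a₈) (h40 :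
    a₇ ≠ a₉) (h41 : a₇ ≠ a₀) (h42 : a₈ ≠ a₉) (h43 : a₈ ≠ a₀) (h44 : a₉ ≠ a₀) :
    [a₁, a₂, a₃, a₄, a₅, a₆, a₇, a₈, a₉, a₀].Nodup := by
  simp only [List.nodup_cons, List.mem_cons, not_or, List.not_mem_nil, not_false_eq_true,
    List.nodup_nil, and_true]
  tauto

lemma rot3 (p q r : V) : ({q, r, p} : Finset V) = {p, q, r} := by
  ext x; simp; tauto

lemma rot3' (p q r : V) : ({r, p, q} : Finset V) = {p, q, r} := by
  ext x; simp; tauto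

lemma cnt_univ_of {x : V} {S : Finset V} (h : ∀ v, G.Adj x v → v ∈ S) :
    cnt G {x} Finset.univ = cnt G {x} S := by
  refine le_antisymm ?_ (cnt_mono_sets le_rfl (Finset.subset_univ _))
  rw [cnt_single_eq, cnt_single_eq]
  refine Finset.sum_le_sum_of_ne_zero fun v _ hv => ?_
  by_contra hvS
  exact hv (ad_zero.2 fun h' => hvS (h v h'))

/-- a vertex with at least two `G`-neighbours but at most two `T`-neighbours in a triple -/
lemma low_facts (hle : G ≤ T) {x p q r : V} (hpq : p ≠ q) (hpr : p ≠ r) (hqr : q ≠ r)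
    (h1 : 2 ≤ cnt G {x} {p, q, r}) (h2 : cnt T {x} {p, q, r} ≤ 2) :
    (T.Adj x p ↔ G.Adj x p) ∧ (T.Adj x q ↔ G.Adj x q) ∧ (T.Adj x r ↔ G.Adj x r) ∧
    ((G.Adj x p ∧ G.Adj x q ∧ ¬ G.Adj x r) ∨ (G.Adj x p ∧ ¬ G.Adj x q ∧ G.Adj x r) ∨
      (¬ G.Adj x p ∧ G.Adj x q ∧ G.Adj x r)) := by
  rw [cnt_single_three x hpq hpr hqr] at h1 h2
  have a1 := ad_mono hle x p
  have a2 := ad_mono hle x q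
  have a3 := ad_mono hle x r
  have b1 := ad_le (G := T) x p
  have b2 := ad_le (G := T) x q
  have b3 := ad_le (G := T) x r
  simp only [← ad_one]
  omega

lemma two_of {x p q r : V} (hpq : p ≠ q) (hpr : p ≠ r) (hqr : q ≠ r)
    (h1 : 2 ≤ cnt G {x} {p, q, r}) (h2 : ¬ G.Adj x r) : G.Adj x p ∧ G.Adj x q := by
  rw [cnt_single_three x hpq hpr hqr, ad_zero.2 h2] at h1
  have b1 := ad_le (G := G) x p
  have b2 := ad_le (G := G) x q
  simp only [← ad_one]
  omega

/-- a triangle of `G`, abstractly -/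
structure IsTri (G : SimpleGraph V) (C : Finset V) : Prop where
  card : C.card = 3
  adj : ∀ u ∈ C, ∀ v ∈ C, u ≠ v → G.Adj u v

lemma IsTri.other {C : Finset V} (h : IsTri G C) {u : V} (hu : u ∈ C) :
    ∃ v ∈ C, ∃ w ∈ C, v ≠ u ∧ w ≠ u ∧ v ≠ w ∧ G.Adj v w ∧ C = {u, v, w} := by
  obtain ⟨x, y, z, hxy, hxz, hyz, rfl⟩ := Finset.card_eq_three.1 h.card
  simp only [Finset.mem_insert, Finset.mem_singleton] at hu
  have := h.adj
  rcases hu with rfl | rfl | rfl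
  · exact ⟨y, by simp, z, by simp, hxy.symm, hxz.symm, hyz, this _ (by simp) _ (by simp) hyz, rfl⟩
  · exact ⟨x, by simp, z, by simp, hxy, hyz.symm, hxz, this _ (by simp) _ (by simp) hxz, by grind⟩
  · exact ⟨x, by simp, y, by simp, hxz, hyz, hxy, this _ (by simp) _ (by simp) hxy, by grind⟩

lemma IsTri.mono {C : Finset V} (h : IsTri G C) (hle : G ≤ T) : IsTri T C :=
  ⟨h.card, fun u hu v hv huv => hle (h.adj u hu v hv huv)⟩

lemma IsTri.conn {C : Finset V} (h : IsTri G C) : ConnSet G (C : Set V) := by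
  refine ⟨?_, fun A hA hne hAC => ?_⟩
  · have := h.card
    exact Finset.card_pos.1 (by omega)
  · obtain ⟨u, hu⟩ := hne
    have : ∃ v ∈ (C : Set V), v ∉ A := by
      by_contra hcon
      push Not at hcon
      exact hAC (Set.Subset.antisymm hA hcon)
    obtain ⟨v, hv, hvA⟩ := this
    exact ⟨u, hu, v, ⟨hv, hvA⟩, h.adj u (hA hu) v hv (by rintro rfl; exact hvA hu)⟩

lemma IsTri.edge {H : SimpleGraph V} {C : Finset V} (h : IsTri G C)
    (hl : ∃ e₀ : Sym2 V, ∀ u v, G.Adj u v → H.Adj u v ∨ s(u, v) = e₀) :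
    ∃ u ∈ C, ∃ v ∈ C, u ≠ v ∧ H.Adj u v := by
  obtain ⟨e₀, hl⟩ := hl
  obtain ⟨x, y, z, hxy, hxz, hyz, rfl⟩ := Finset.card_eq_three.1 h.card
  have a1 := h.adj x (by simp) y (by simp) hxy
  have a2 := h.adj x (by simp) z (by simp) hxz
  rcases hl x y a1 with h1 | h1
  · exact ⟨x, by simp, y, by simp, hxy, h1⟩
  · rcases hl x z a2 with h2 | h2
    · exact ⟨x, by simp, z, by simp, hxz, h2⟩
    · rw [← h1, Sym2.eq_iff] at h2
      grind

lemma CRep.noLow (R : CRep T G c) (hT : PT T) {S : Finset V} {x y : V}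
    (hx : ∀ v, G.Adj x v → v ∈ S) (hy : ∀ v, G.Adj y v → v ∈ S)
    (hx2 : cnt G {x} S ≤ 2) (hy2 : cnt G {y} S ≤ 2) (hyS : y ∉ S) : ¬ T.Adj x y := by
  intro h
  have := R.claimA hT h (fun h' => hyS (hx y h'))
  rw [cnt_univ_of hx, cnt_univ_of hy] at this
  omega

/-- configuration 3.I -/
structure CfgI (T G : SimpleGraph V) (p q r h : V) (C : Finset V) : Prop where
  pq : p ≠ q
  pr : p ≠ r
  qr : q ≠ r
  ph : G.Adj p h
  qh : G.Adj q h
  rh : G.Adj r h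
  tri : IsTri G C
  pC : p ∉ C
  qC : q ∉ C
  rC : r ∉ C
  hC : h ∉ C
  aC : ∃ u ∈ C, G.Adj p u
  bC : ∃ u ∈ C, G.Adj q u
  cC : ∃ u ∈ C, G.Adj r u
  cov : ∀ u v, G.Adj u v → u ∈ ({p, q, r} : Finset V) ∨ v ∈ ({p, q, r} : Finset V) ∨ (u ∈ C ∧ v ∈ C)
  low : ∀ x, x ∉ ({p, q, r} : Finset V) → x ∉ C → x ≠ h →
    2 ≤ cnt G {x} {p, q, r} ∧ cnt T {x} {p, q, r} ≤ 2

lemma CfgI.rot {p q r h : V} {C : Finset V} (K : CfgI T G p q r h C) : CfgI T G q r p h C := by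
  have e : ({q, r, p} : Finset V) = {p, q, r} := rot3 _ _ _
  refine ⟨K.qr, K.pq.symm, K.pr.symm, K.qh, K.rh, K.ph, K.tri, K.qC, K.rC, K.pC, K.hC, K.bC, K.cC,
    K.aC, ?_, ?_⟩
  · rw [e]; exact K.cov
  · rw [e]; exact K.low

lemma k33_pair_C (hT : K33Free T) {p q r h x₁ x₂ : V} {C : Set V} (hC : ConnSet T C)
    (pq : p ≠ q) (pr : p ≠ r) (qr : q ≠ r) (ph : T.Adj p h) (qh : T.Adj q h) (rh : T.Adj r h)
    (pC : p ∉ C) (qC : q ∉ C) (rC : r ∉ C) (hhC : h ∉ C) (aC : ∃ u ∈ C, T.Adj r u)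
    (x12 : x₁ ≠ x₂) (x1 : x₁ ∉ C) (x2 : x₂ ∉ C) (x1r : x₁ ≠ r) (x2r : x₂ ≠ r) (x1h : x₁ ≠ h) (x2h : x₂ ≠ h)
    (p1 : T.Adj p x₁) (p2 : T.Adj p x₂) (q1 : T.Adj q x₁) (q2 : T.Adj q x₂)
    (c1 : ∃ u ∈ C, T.Adj x₁ u) (c2 : ∃ u ∈ C, T.Adj x₂ u) : False := by
  obtain ⟨u, hu, hru⟩ := aC
  have := ph.ne
  have := qh.ne
  refine hT.two (C := C) (D := {r, h}) pq x12 hC (connSet_pair rh) ?_ pC qC x1 x2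
    (by simp; tauto) (by simp; tauto) (by simp; tauto) (by simp; tauto) p1 p2 q1 q2
    ⟨h, by simp, ph⟩ ⟨h, by simp, qh⟩ c1 c2 ⟨u, hu, r, by simp, hru.symm⟩
  rw [Set.disjoint_right]
  rintro v (rfl | rfl) <;> assumption

lemma k33_pair_h (hT : K33Free T) {p q r h x₁ x₂ : V} {C : Set V} (hC : ConnSet T C)
    (pq : p ≠ q) (pr : p ≠ r) (qr : q ≠ r) (ph : T.Adj p h) (qh : T.Adj q h) (rh : T.Adj r h)
    (pC : p ∉ C) (qC : q ∉ C) (rC : r ∉ C) (hhC : h ∉ C) (aC : ∃ u ∈ C, T.Adj r u)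
    (apC : ∃ u ∈ C, T.Adj p u) (aqC : ∃ u ∈ C, T.Adj q u)
    (x12 : x₁ ≠ x₂) (x1 : x₁ ∉ C) (x2 : x₂ ∉ C) (x1r : x₁ ≠ r) (x2r : x₂ ≠ r) (x1h : x₁ ≠ h) (x2h : x₂ ≠ h)
    (p1 : T.Adj p x₁) (p2 : T.Adj p x₂) (q1 : T.Adj q x₁) (q2 : T.Adj q x₂)
    (c1 : T.Adj x₁ h) (c2 : T.Adj x₂ h) : False := by
  obtain ⟨u, hu, hru⟩ := aC
  obtain ⟨u', hu', hpu⟩ := apC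
  obtain ⟨u'', hu'', hqu⟩ := aqC
  have := ph.ne
  have := qh.ne
  have := rh.ne
  refine hT.two (C := {h}) (D := insert r C) pq x12 (connSet_singleton _) (hC.insert hu hru) ?_
    (by simp; tauto) (by simp; tauto) (by simp; tauto) (by simp; tauto)
    (by simp; tauto) (by simp; tauto) (by simp; tauto) (by simp; tauto) p1 p2 q1 q2
    ⟨u', by simp [hu'], hpu⟩ ⟨u'', by simp [hu''], hqu⟩ ⟨h, rfl, c1⟩ ⟨h, rfl, c2⟩
    ⟨h, rfl, r, by simp, rh.symm⟩
  rw [Set.disjoint_left]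
  rintro v rfl
  simp; tauto

lemma CfgI.same_C {p q r h : V} {C : Finset V} (K : CfgI T G p q r h C) (R : CRep T G c) (hT : PT T) {x₁ x₂ : V} (h12 : x₁ ≠ x₂)
    (n1 : x₁ ∉ ({p, q, r} : Finset V)) (n2 : x₂ ∉ ({p, q, r} : Finset V)) (m1 : x₁ ∉ C) (m2 : x₂ ∉ C)
    (l1 : x₁ ≠ h) (l2 : x₂ ≠ h) (r1 : ¬ G.Adj x₁ r) (r2 : ¬ G.Adj x₂ r)
    (c1 : ∃ u ∈ C, T.Adj x₁ u) (c2 : ∃ u ∈ C, T.Adj x₂ u) : False := by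
  obtain ⟨u, hu, hru⟩ := K.cC
  have a1 := two_of K.pq K.pr K.qr (K.low x₁ n1 m1 l1).1 r1
  have a2 := two_of K.pq K.pr K.qr (K.low x₂ n2 m2 l2).1 r2
  simp at n1 n2
  exact k33_pair_C hT.k33 (C := (C : Set V)) (K.tri.mono R.le).conn K.pq K.pr K.qr (R.le K.ph) (R.le K.qh) (R.le K.rh)
    K.pC K.qC K.rC K.hC ⟨u, hu, R.le hru⟩ h12 m1 m2 (by tauto) (by tauto) l1 l2 (R.le a1.1.symm)
    (R.le a2.1.symm) (R.le a1.2.symm) (R.le a2.2.symm) c1 c2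

lemma CfgI.same_h {p q r h : V} {C : Finset V} (K : CfgI T G p q r h C) (R : CRep T G c) (hT : PT T) {x₁ x₂ : V} (h12 : x₁ ≠ x₂)
    (n1 : x₁ ∉ ({p, q, r} : Finset V)) (n2 : x₂ ∉ ({p, q, r} : Finset V)) (m1 : x₁ ∉ C) (m2 : x₂ ∉ C)
    (l1 : x₁ ≠ h) (l2 : x₂ ≠ h) (r1 : ¬ G.Adj x₁ r) (r2 : ¬ G.Adj x₂ r)
    (c1 : T.Adj x₁ h) (c2 : T.Adj x₂ h) : False := by
  obtain ⟨u, hu, hru⟩ := K.cC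
  obtain ⟨u', hu', hru'⟩ := K.aC
  obtain ⟨u'', hu'', hru''⟩ := K.bC
  have a1 := two_of K.pq K.pr K.qr (K.low x₁ n1 m1 l1).1 r1
  have a2 := two_of K.pq K.pr K.qr (K.low x₂ n2 m2 l2).1 r2
  simp at n1 n2
  exact k33_pair_h hT.k33 (C := (C : Set V)) (K.tri.mono R.le).conn K.pq K.pr K.qr (R.le K.ph) (R.le K.qh) (R.le K.rh)
    K.pC K.qC K.rC K.hC ⟨u, hu, R.le hru⟩ ⟨u', hu', R.le hru'⟩ ⟨u'', hu'', R.le hru''⟩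
    h12 m1 m2 (by tauto) (by tauto) l1 l2 (R.le a1.1.symm)
    (R.le a2.1.symm) (R.le a1.2.symm) (R.le a2.2.symm) c1 c2

/-- every low vertex attaches to `C` or to `h` -/
lemma CfgI.attach {p q r h : V} {C : Finset V} (K : CfgI T G p q r h C) (R : CRep T G c) (hT : PT T) {x : V}
    (n1 : x ∉ ({p, q, r} : Finset V)) (m1 : x ∉ C) (l1 : x ≠ h) :
    T.Adj x h ∨ ∃ u ∈ C, T.Adj x u := by
  have lx := K.low x n1 m1 l1
  obtain ⟨y, hy, hxy⟩ := hT.exists_nbr x {p, q, r} lx.2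
  by_cases hyh : y = h
  · exact Or.inl (hyh ▸ hxy)
  by_cases hyC : y ∈ C
  · exact Or.inr ⟨y, hyC, hxy⟩
  exfalso
  have ly := K.low y hy hyC hyh
  refine R.noLow hT (S := {p, q, r}) ?_ ?_ ((cnt_mono R.le _ _).trans lx.2)
    ((cnt_mono R.le _ _).trans ly.2) hy hxy
  · intro v hv
    have := K.cov x v hv
    tauto
  · intro v hv
    have := K.cov y v hv
    tauto

/-- three low vertices of the same type -/
lemma CfgI.three {p q r h : V} {C : Finset V} (K : CfgI T G p q r h C) (R : CRep T G c) (hT : PT T) {L : Finset V}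
    (hL : ∀ x ∈ L, x ∉ ({p, q, r} : Finset V) ∧ x ∉ C ∧ x ≠ h) (h3 : 3 ≤ L.card)
    (hr : ∀ x ∈ L, ¬ G.Adj x r) : False := by
  obtain ⟨x, hx, y, hy, z, hz, hxy, hxz, hyz⟩ := Finset.two_lt_card.1 h3
  obtain ⟨x1, x2, x3⟩ := hL x hx
  obtain ⟨y1, y2, y3⟩ := hL y hy
  obtain ⟨z1, z2, z3⟩ := hL z hz
  have rx := hr x hx
  have ry := hr y hy
  have rz := hr z hz
  rcases K.attach R hT x1 x2 x3 with ax | ax <;> rcases K.attach R hT y1 y2 y3 with ay | ay <;>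
    rcases K.attach R hT z1 z2 z3 with az | az
  · exact K.same_h R hT hxy x1 y1 x2 y2 x3 y3 rx ry ax ay
  · exact K.same_h R hT hxy x1 y1 x2 y2 x3 y3 rx ry ax ay
  · exact K.same_h R hT hxz x1 z1 x2 z2 x3 z3 rx rz ax az
  · exact K.same_C R hT hyz y1 z1 y2 z2 y3 z3 ry rz ay az
  · exact K.same_h R hT hyz y1 z1 y2 z2 y3 z3 ry rz ay az
  · exact K.same_C R hT hxz x1 z1 x2 z2 x3 z3 rx rz ax az
  · exact K.same_C R hT hxy x1 y1 x2 y2 x3 y3 rx ry ax ay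
  · exact K.same_C R hT hxy x1 y1 x2 y2 x3 y3 rx ry ax ay

/-- every vertex of the triple has a neighbour in `L'` in the reduced graph -/
lemma CfgI.reach {p q r h : V} {C : Finset V} (K : CfgI T G p q r h C) (R : CRep T G c) (hT : PT T) {L : Finset V}
    (hL : ∀ x ∈ L, x ∉ ({p, q, r} : Finset V) ∧ x ∉ C ∧ x ≠ h) (h3 : 3 ≤ L.card) {x₀ : V}
    (n0 : x₀ ∉ ({p, q, r} : Finset V)) (m0 : x₀ ∉ C) (l0 : x₀ ≠ h) (h0 : x₀ ∉ L)
    (hx : T.Adj x₀ h) : ∃ y ∈ L, (Gd G c (c s(x₀, h))).Adj r y := by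
  by_contra hcon
  push Not at hcon
  by_cases hex : ∃ y ∈ L, G.Adj r y
  · obtain ⟨x₁, hx1, hr1⟩ := hex
    have hc1 : c s(r, x₁) = c s(x₀, h) := by
      by_contra hne
      exact hcon x₁ hx1 ⟨hr1, hne⟩
    -- the other two
    have hL2 : 1 < (L.erase x₁).card := by rw [Finset.card_erase_of_mem hx1]; omega
    obtain ⟨x₂, hx2, x₃, hx3, h23⟩ := Finset.one_lt_card.1 hL2
    rw [Finset.mem_erase] at hx2 hx3
    obtain ⟨u, hu, hru⟩ := K.cC
    obtain ⟨v, hv, w, hw, hvu, hwu, hvw, hGvw, -⟩ := K.tri.other hu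
    have key : ∀ y ∈ L, y ≠ x₁ → G.Adj y p ∧ G.Adj y q := by
      intro y hy hne
      refine two_of K.pq K.pr K.qr (K.low y (hL y hy).1 (hL y hy).2.1 (hL y hy).2.2).1 ?_
      intro hyr
      refine hcon y hy ⟨hyr.symm, fun hc => ?_⟩
      have := R.inj (show s(r, y) ∈ G.edgeSet from hyr.symm) (show s(r, x₁) ∈ G.edgeSet from hr1) (hc.trans hc1.symm)
      rw [Sym2.eq_iff] at this
      grind
    have k2 := key x₂ hx2.2 hx2.1
    have k3 := key x₃ hx3.2 hx3.1
    have l1 := hL x₁ hx1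
    have l2 := hL x₂ hx2.2
    have l3 := hL x₃ hx3.2
    have := K.pC
    have := K.qC
    have := K.rC
    have := K.hC
    have := K.pq
    have := K.pr
    have := K.qr
    have := K.ph.ne
    have := K.qh.ne
    have := K.rh.ne
    simp only [Finset.mem_insert, Finset.mem_singleton, not_or] at l1 l2 l3 n0
    have d1 : r ≠ v := by grind
    have d2 : r ≠ w := by grind
    refine R.no_1_4 hx (a₁ := r) (b₁ := u) (a₂ := v) (b₂ := w) (a₃ := p) (b₃ := x₂) (a₄ := q) (b₄ := x₃)
      ⟨hru, ?_⟩ ⟨hGvw, ?_⟩ ⟨k2.1.symm, ?_⟩ ⟨k3.2.symm, ?_⟩ ?_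
    · rw [← hc1]; intro hc
      have := R.inj (show s(r, u) ∈ G.edgeSet from hru) (show s(r, x₁) ∈ G.edgeSet from hr1) hc
      rw [Sym2.eq_iff] at this
      grind
    · rw [← hc1]; exact (R.col_ne hr1 hGvw d1 d2).symm
    · rw [← hc1]; exact R.col_ne k2.1.symm hr1 K.pr (by grind)
    · rw [← hc1]; exact R.col_ne k3.2.symm hr1 K.qr (by grind)
    · apply nd10 <;> grind
  · push Not at hex
    exact K.three R hT hL h3 (fun x hx h => hex x hx h.symm)

lemma CfgI.false {p q r h : V} {C : Finset V} (K : CfgI T G p q r h C) (R : CRep T G c) (hT : PT T) : False := by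
  set L : Finset V := Finset.univ \ ({p, q, r} ∪ C ∪ {h}) with hLdef
  have hL : ∀ x ∈ L, x ∉ ({p, q, r} : Finset V) ∧ x ∉ C ∧ x ≠ h := by
    intro x hx
    simp [hLdef] at hx ⊢
    tauto
  have hLc : 4 ≤ L.card := by
    have h1 : ({p, q, r} ∪ C ∪ {h} : Finset V).card ≤ 3 + 3 + 1 :=
      (Finset.card_union_le _ _).trans (add_le_add ((Finset.card_union_le _ _).trans
        (add_le_add Finset.card_le_three K.tri.card.le)) (by simp))
    have h2 := Finset.card_sdiff_of_subset (Finset.subset_univ ({p, q, r} ∪ C ∪ {h} : Finset V))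
    rw [Finset.card_univ] at h2
    have := hT.hn
    rw [hLdef]
    omega
  by_cases hex : ∃ x ∈ L, T.Adj x h
  · obtain ⟨x₀, hx0, hxh⟩ := hex
    obtain ⟨n0, m0, l0⟩ := hL x₀ hx0
    have hL' : ∀ x ∈ L.erase x₀, x ∉ ({p, q, r} : Finset V) ∧ x ∉ C ∧ x ≠ h :=
      fun x hx => hL x (Finset.mem_of_mem_erase hx)
    have hc3 : 3 ≤ (L.erase x₀).card := by rw [Finset.card_erase_of_mem hx0]; omega
    have r1 := K.reach R hT hL' hc3 n0 m0 l0 (by simp) hxh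
    have e1 : ({q, r, p} : Finset V) = {p, q, r} := rot3 _ _ _
    have e2 : ({r, p, q} : Finset V) = {p, q, r} := rot3' _ _ _
    have r2 := K.rot.reach R hT (L := L.erase x₀) (by rw [e1]; exact hL') hc3 (by rw [e1]; exact n0) m0 l0 (by simp) hxh
    have r3 := K.rot.rot.reach R hT (L := L.erase x₀) (by rw [e2]; exact hL') hc3 (by rw [e2]; exact n0) m0 l0 (by simp) hxh
    obtain ⟨x, hx, y, hy, z, hz, hxy, hxz, hyz, ax, by', cz⟩ := sdr K.pq K.pr K.qr (R.lost (k := c s(x₀, h)))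
      (L.erase x₀) hc3 (fun y hy => (K.low y (hL' y hy).1 (hL' y hy).2.1 (hL' y hy).2.2).1)
      (fun h => (hL' _ h).1 (by simp)) (fun h => (hL' _ h).1 (by simp)) (fun h => (hL' _ h).1 (by simp))
      r2 r3 r1
    obtain ⟨u, hu, v, hv, huv, hGuv⟩ := K.tri.edge (R.lost (k := c s(x₀, h)))
    have lx := hL' x hx
    have ly := hL' y hy
    have lz := hL' z hz
    have := Finset.ne_of_mem_erase hx
    have := Finset.ne_of_mem_erase hy
    have := Finset.ne_of_mem_erase hz
    have := K.pC
    have := K.qC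
    have := K.rC
    have := K.hC
    have := K.pq
    have := K.pr
    have := K.qr
    have := K.ph.ne
    have := K.qh.ne
    have := K.rh.ne
    clear_value L
    simp only [Finset.mem_insert, Finset.mem_singleton, not_or] at lx ly lz n0
    refine R.no_1_4 hxh ax by' cz hGuv ?_
    apply nd10 <;> grind
  · push Not at hex
    have hC : ∀ x ∈ L, ∃ u ∈ C, T.Adj x u := fun x hx =>
      (K.attach R hT (hL x hx).1 (hL x hx).2.1 (hL x hx).2.2).resolve_left (hex x hx)
    have e1 : ({q, r, p} : Finset V) = {p, q, r} := rot3 _ _ _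
    have e2 : ({r, p, q} : Finset V) = {p, q, r} := rot3' _ _ _
    let f : V → Fin 3 := fun x => open Classical in if ¬ G.Adj x r then 0 else if ¬ G.Adj x p then 1 else 2
    obtain ⟨x, hx, y, hy, hne, hf⟩ := Finset.exists_ne_map_eq_of_card_lt_of_maps_to
      (s := L) (t := (Finset.univ : Finset (Fin 3))) (by simp; omega) (f := f) (fun _ _ => by simp)
    have lx := hL x hx
    have ly := hL y hy
    have fx := (low_facts R.le K.pq K.pr K.qr (K.low x lx.1 lx.2.1 lx.2.2).1 (K.low x lx.1 lx.2.1 lx.2.2).2).2.2.2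
    have fy := (low_facts R.le K.pq K.pr K.qr (K.low y ly.1 ly.2.1 ly.2.2).1 (K.low y ly.1 ly.2.1 ly.2.2).2).2.2.2
    have hcase : (¬ G.Adj x r ∧ ¬ G.Adj y r) ∨ (¬ G.Adj x p ∧ ¬ G.Adj y p) ∨ (¬ G.Adj x q ∧ ¬ G.Adj y q) := by
      simp only [f] at hf
      split_ifs at hf <;> simp_all
    rcases hcase with ⟨a, b⟩ | ⟨a, b⟩ | ⟨a, b⟩
    · exact K.same_C R hT hne lx.1 ly.1 lx.2.1 ly.2.1 lx.2.2 ly.2.2 a b (hC x hx) (hC y hy)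
    · exact K.rot.same_C R hT hne (by rw [e1]; exact lx.1) (by rw [e1]; exact ly.1) lx.2.1 ly.2.1 lx.2.2 ly.2.2 a b (hC x hx) (hC y hy)
    · exact K.rot.rot.same_C R hT hne (by rw [e2]; exact lx.1) (by rw [e2]; exact ly.1) lx.2.1 ly.2.1 lx.2.2 ly.2.2 a b (hC x hx) (hC y hy)
end
end

section
open Set
set_option linter.all false

section
variable {V : Type*} [Fintype V] [DecidableEq V] {T G : SimpleGraph V} {c : Sym2 V → ℕ}

lemma five_full {C : Finset V} (hC : IsTri G C) {a b : V} (hab : a ≠ b) (h5 : 5 ≤ cnt G {a, b} C)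
    {y : V} (hy : y ∈ C) : ∃ z ∈ C, z ≠ y ∧ G.Adj a z ∧ G.Adj b z := by
  obtain ⟨v, hv, w, hw, hvy, hwy, hvw, -, rfl⟩ := hC.other hy
  rw [cnt_insert_left (by simpa using hab), cnt_single_three _ hvy.symm hwy.symm hvw,
    cnt_single_three _ hvy.symm hwy.symm hvw] at h5
  have := ad_le (G := G) a y
  have := ad_le (G := G) b y
  have := ad_le (G := G) a v
  have := ad_le (G := G) b v
  have := ad_le (G := G) a w
  have := ad_le (G := G) b w
  by_cases h : ad G a v = 1 ∧ ad G b v = 1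
  · exact ⟨v, by simp, hvy, ad_one.1 h.1, ad_one.1 h.2⟩
  · exact ⟨w, by simp, hwy, ad_one.1 (by omega), ad_one.1 (by omega)⟩

lemma five_some {C : Finset V} (hC : IsTri G C) {a b : V} (hab : a ≠ b) (h5 : 5 ≤ cnt G {a, b} C)
    {y : V} (hy : y ∈ C) : G.Adj a y ∨ G.Adj b y := by
  obtain ⟨v, hv, w, hw, hvy, hwy, hvw, -, rfl⟩ := hC.other hy
  rw [cnt_insert_left (by simpa using hab), cnt_single_three _ hvy.symm hwy.symm hvw,
    cnt_single_three _ hvy.symm hwy.symm hvw] at h5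
  have := ad_le (G := G) a y
  have := ad_le (G := G) b y
  have := ad_le (G := G) a v
  have := ad_le (G := G) b v
  have := ad_le (G := G) a w
  have := ad_le (G := G) b w
  simp only [← ad_one]
  omega

/-- if `C` is a triangle and two of its vertices `y'`, `y''` -/
lemma IsTri.third {C : Finset V} (h : IsTri G C) {u v : V} (hu : u ∈ C) (hv : v ∈ C) (huv : u ≠ v) :
    ∃ w ∈ C, w ≠ u ∧ w ≠ v ∧ G.Adj v w ∧ G.Adj u w ∧ C = {u, v, w} := by
  obtain ⟨x, hx, w, hw, hxu, hwu, hxw, h1, h2⟩ := h.other hu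
  have : v = x ∨ v = w := by rw [h2] at hv; simp at hv; tauto
  rcases this with rfl | rfl
  · exact ⟨w, hw, hwu, hxw.symm, h1, h.adj u hu w hw hwu.symm, h2⟩
  · exact ⟨x, hx, hxu, hxw, h1.symm, h.adj u hu x hx hxu.symm, by rw [h2, Finset.pair_comm]⟩

/-- configuration 3.II -/
structure CfgII (T G : SimpleGraph V) (a b d p q : V) (C : Finset V) : Prop where
  ab : a ≠ b
  pq : p ≠ q
  ad' : G.Adj a d
  bd' : G.Adj b d
  ap : G.Adj a p
  bp : G.Adj b p
  dp : G.Adj d p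
  aq : G.Adj a q
  bq : G.Adj b q
  dq : G.Adj d q
  tri : IsTri G C
  aC : a ∉ C
  bC : b ∉ C
  dC : d ∉ C
  pC : p ∉ C
  qC : q ∉ C
  five : 5 ≤ cnt G {a, b} C
  cov : ∀ u v, G.Adj u v → u ∈ ({a, b, d} : Finset V) ∨ v ∈ ({a, b, d} : Finset V) ∨ (u ∈ C ∧ v ∈ C)
  low : ∀ x, x ∉ ({a, b, d} : Finset V) → x ∉ C → x ≠ p → x ≠ q →
    2 ≤ cnt G {x} {a, b, d} ∧ cnt T {x} {a, b, d} ≤ 2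

lemma CfgII.swapab {a b d p q : V} {C : Finset V} (K : CfgII T G a b d p q C) : CfgII T G b a d p q C := by
  have e : ({b, a, d} : Finset V) = {a, b, d} := Finset.insert_comm _ _ _
  have e' : ({b, a} : Finset V) = {a, b} := Finset.pair_comm _ _
  refine ⟨K.ab.symm, K.pq, K.bd', K.ad', K.bp, K.ap, K.dp, K.bq, K.aq, K.dq, K.tri, K.bC, K.aC, K.dC,
    K.pC, K.qC, ?_, ?_, ?_⟩
  · rw [e']; exact K.five
  · rw [e]; exact K.cov
  · rw [e]; exact K.low

lemma CfgII.swappq {a b d p q : V} {C : Finset V} (K : CfgII T G a b d p q C) : CfgII T G a b d q p C :=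
  ⟨K.ab, K.pq.symm, K.ad', K.bd', K.aq, K.bq, K.dq, K.ap, K.bp, K.dp, K.tri, K.aC, K.bC, K.dC,
    K.qC, K.pC, K.five, K.cov, fun x h1 h2 h3 h4 => K.low x h1 h2 h4 h3⟩

/-- the low vertices -/
def lowII (a b d p q : V) (C : Finset V) : Finset V := Finset.univ \ ({a, b, d} ∪ {p, q} ∪ C)

lemma mem_lowII {a b d p q x : V} {C : Finset V} : x ∈ lowII a b d p q C ↔
    x ≠ a ∧ x ≠ b ∧ x ≠ d ∧ x ≠ p ∧ x ≠ q ∧ x ∉ C := by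
  simp [lowII]; tauto

lemma CfgII.card_low {a b d p q : V} {C : Finset V} (K : CfgII T G a b d p q C) (hT : PT T) :
    3 ≤ (lowII a b d p q C).card := by
  have h1 : ({a, b, d} ∪ {p, q} ∪ C : Finset V).card ≤ 3 + 2 + 3 :=
    (Finset.card_union_le _ _).trans (add_le_add ((Finset.card_union_le _ _).trans
      (add_le_add Finset.card_le_three Finset.card_le_two)) K.tri.card.le)
  have h2 := Finset.card_sdiff_of_subset (Finset.subset_univ ({a, b, d} ∪ {p, q} ∪ C : Finset V))
  rw [Finset.card_univ] at h2
  have := hT.hn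
  unfold lowII
  omega

lemma CfgII.low' {a b d p q : V} {C : Finset V} (K : CfgII T G a b d p q C) {x : V}
    (hx : x ∈ lowII a b d p q C) : 2 ≤ cnt G {x} {a, b, d} ∧ cnt T {x} {a, b, d} ≤ 2 := by
  rw [mem_lowII] at hx
  exact K.low x (by simp; tauto) hx.2.2.2.2.2 hx.2.2.2.1 hx.2.2.2.2.1

lemma CfgII.two_p {a b d p q : V} {C : Finset V} (K : CfgII T G a b d p q C) :
    2 ≤ cnt G {p} {a, b, d} := by
  rw [cnt_single_three _ K.ab K.ad'.ne K.bd'.ne, ad_one.2 K.ap.symm, ad_one.2 K.bp.symm]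
  omega

lemma CfgII.attach {a b d p q : V} {C : Finset V} (K : CfgII T G a b d p q C) (R : CRep T G c) (hT : PT T) {x : V}
    (hx : x ∈ lowII a b d p q C) : T.Adj x p ∨ T.Adj x q ∨ ∃ u ∈ C, T.Adj x u := by
  have lx := K.low' hx
  obtain ⟨y, hy, hxy⟩ := hT.exists_nbr x {a, b, d} lx.2
  by_cases hyp : y = p
  · exact Or.inl (hyp ▸ hxy)
  by_cases hyq : y = q
  · exact Or.inr (Or.inl (hyq ▸ hxy))
  by_cases hyC : y ∈ C
  · exact Or.inr (Or.inr ⟨y, hyC, hxy⟩)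
  exfalso
  have ly := K.low y hy hyC hyp hyq
  rw [mem_lowII] at hx
  have hx' : x ∉ ({a, b, d} : Finset V) := by simp; tauto
  refine R.noLow hT (S := {a, b, d}) ?_ ?_ ((cnt_mono R.le _ _).trans lx.2)
    ((cnt_mono R.le _ _).trans ly.2) hy hxy
  · intro v hv
    have := K.cov x v hv
    tauto
  · intro v hv
    have := K.cov y v hv
    tauto

lemma CfgII.attC {a b d p q : V} {C : Finset V} (K : CfgII T G a b d p q C) (R : CRep T G c) (hT : PT T) {x y : V}
    (hx : x ∈ lowII a b d p q C) (hy : y ∈ C) (hxy : T.Adj x y) : G.Adj x a ∧ G.Adj x b := by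
  have lx := K.low' hx
  refine two_of K.ab K.ad'.ne K.bd'.ne lx.1 fun hd => ?_
  obtain ⟨z, hz, -, h1, h2⟩ := five_full K.tri K.ab K.five hy
  rw [mem_lowII] at hx
  have := K.aC
  have := K.bC
  have := K.dC
  have := K.pC
  have := K.qC
  exact hT.k33.two (a := a) (b := b) (x := p) (y := q) (C := {d}) (D := insert x (C : Set V)) K.ab K.pq
    (connSet_singleton _) ((K.tri.mono R.le).conn.insert hy hxy) (by
      simp; exact ⟨Ne.symm hx.2.2.1, K.dC⟩) (by simpa using K.ad'.ne)
    (by simpa using K.bd'.ne) (by simpa using K.dp.ne.symm) (by simpa using K.dq.ne.symm)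
    (by simp; exact ⟨Ne.symm hx.1, K.aC⟩) (by simp; exact ⟨Ne.symm hx.2.1, K.bC⟩)
    (by simp; exact ⟨Ne.symm hx.2.2.2.1, K.pC⟩) (by simp; exact ⟨Ne.symm hx.2.2.2.2.1, K.qC⟩)
    (R.le K.ap) (R.le K.aq) (R.le K.bp) (R.le K.bq)
    ⟨z, by simp [hz], R.le h1⟩ ⟨z, by simp [hz], R.le h2⟩ ⟨d, rfl, R.le K.dp.symm⟩ ⟨d, rfl, R.le K.dq.symm⟩
    ⟨d, rfl, x, by simp, R.le hd.symm⟩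

lemma CfgII.colC {a b d p q : V} {C : Finset V} (K : CfgII T G a b d p q C) (R : CRep T G c) (hT : PT T) {x y z w : V}
    (hx : x ∈ lowII a b d p q C) (hxy : T.Adj x y) (hC : C = {y, z, w}) (hyz : y ≠ z) (hyw : y ≠ w) (hzw : z ≠ w) :
    c s(z, w) = c s(x, y) := by
  by_contra hne
  have hzw' : G.Adj z w := K.tri.adj z (by simp [hC]) w (by simp [hC]) hzw
  set L := lowII a b d p q C with hL
  have hlow : ∀ v ∈ L, v ≠ a ∧ v ≠ b ∧ v ≠ d ∧ v ≠ p ∧ v ≠ q ∧ v ∉ C := fun v hv => mem_lowII.1 hv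
  have hLc := K.card_low hT
  rw [← hL] at hLc
  set Y : Finset V := {p, q} ∪ L.erase x with hY
  have hYm : ∀ v ∈ Y, (v = p ∨ v = q) ∨ (v ∈ L ∧ v ≠ x) := by
    intro v hv; simp [hY] at hv; tauto
  have hYc : 3 ≤ Y.card := by
    have : (L.erase x).card = L.card - 1 := Finset.card_erase_of_mem hx
    rw [hY, Finset.card_union_of_disjoint, Finset.card_pair K.pq]
    · omega
    · rw [Finset.disjoint_right]; intro v hv
      have := hlow v (Finset.mem_of_mem_erase hv)
      simp; tauto
  have hpq : ∀ v, G.Adj v p → G.Adj v q → ∃ y' ∈ Y, (Gd G c (c s(x, y))).Adj v y' := by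
    intro v h1 h2
    by_cases hc : c s(v, p) = c s(x, y)
    · refine ⟨q, by simp [hY], h2, ?_⟩
      rw [← hc, Sym2.eq_swap, Sym2.eq_swap (a := v)]
      exact R.col_ne h2.symm h1.symm K.pq.symm h2.ne.symm
    · exact ⟨p, by simp [hY], h1, hc⟩
  have n1 := K.ap.ne
  have n2 := K.bp.ne
  have n3 := K.dp.ne
  have n4 := K.aq.ne
  have n5 := K.bq.ne
  have n6 := K.dq.ne
  have hYn : ∀ v ∈ Y, v ≠ a ∧ v ≠ b ∧ v ≠ d ∧ v ∉ C ∧ v ≠ x := by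
    intro v hv
    have h1 := hlow x hx
    rcases hYm v hv with (rfl | rfl) | h
    · exact ⟨n1.symm, n2.symm, n3.symm, K.pC, Ne.symm h1.2.2.2.1⟩
    · exact ⟨n4.symm, n5.symm, n6.symm, K.qC, Ne.symm h1.2.2.2.2.1⟩
    · have := hlow v h.1
      tauto
  obtain ⟨x₁, hx1, x₂, hx2, x₃, hx3, h12, h13, h23, e1, e2, e3⟩ := sdr K.ab K.ad'.ne K.bd'.ne (R.lost (k := c s(x, y)))
    Y hYc (fun v hv => by
      rcases hYm v hv with (rfl | rfl) | h
      · exact K.two_p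
      · exact K.swappq.two_p
      · exact (K.low' h.1).1)
    (fun h => (hYn _ h).1 rfl) (fun h => (hYn _ h).2.1 rfl) (fun h => (hYn _ h).2.2.1 rfl)
    (hpq a K.ap K.aq) (hpq b K.bp K.bq) (hpq d K.dp K.dq)
  have l1 := hYn x₁ hx1
  have l2 := hYn x₂ hx2
  have l3 := hYn x₃ hx3
  have l0 := hlow x hx
  have := K.ab
  have := K.ad'.ne
  have := K.bd'.ne
  have := K.aC
  have := K.bC
  have := K.dC
  have yC : y ∈ C := by simp [hC]
  have zC : z ∈ C := by simp [hC]
  have wC : w ∈ C := by simp [hC]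
  refine R.no_1_4 hxy e1 e2 e3 (a₄ := z) (b₄ := w) ⟨hzw', hne⟩ ?_
  clear hC hYn hYm hlow
  clear_value Y L
  apply nd10 <;> grind

/-- low vertex attached to `p` -/
lemma CfgII.attP {a b d p q : V} {C : Finset V} (K : CfgII T G a b d p q C) (R : CRep T G c) (hT : PT T) {x : V}
    (hx : x ∈ lowII a b d p q C) (hxp : T.Adj x p) :
    c s(d, q) = c s(x, p) ∧ ∀ y ∈ lowII a b d p q C, y ≠ x → ¬ G.Adj y d := by
  set L := lowII a b d p q C with hL
  have hlow : ∀ v ∈ L, v ≠ a ∧ v ≠ b ∧ v ≠ d ∧ v ≠ p ∧ v ≠ q ∧ v ∉ C := fun v hv => mem_lowII.1 hv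
  have hLc := K.card_low hT
  rw [← hL] at hLc
  set Y : Finset V := insert q (L.erase x) with hY
  have hYm : ∀ v ∈ Y, v = q ∨ (v ∈ L ∧ v ≠ x) := by
    intro v hv; simp [hY] at hv; tauto
  have hLe : (L.erase x).card = L.card - 1 := Finset.card_erase_of_mem hx
  have hYc : 3 ≤ Y.card := by
    rw [hY, Finset.card_insert_of_notMem]
    · omega
    · intro h; exact (hlow q (Finset.mem_of_mem_erase h)).2.2.2.2.1 rfl
  have n1 := K.ap.ne
  have n2 := K.bp.ne
  have n3 := K.dp.ne
  have n4 := K.aq.ne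
  have n5 := K.bq.ne
  have n6 := K.dq.ne
  have n7 := K.ab
  have n8 := K.ad'.ne
  have n9 := K.bd'.ne
  have n10 := K.aC
  have n11 := K.bC
  have n12 := K.dC
  have n13 := K.pC
  have n14 := K.qC
  have n15 := K.pq
  have l0 := hlow x hx
  -- failure analysis
  have fail : ∀ v, G.Adj v q → (¬ ∃ y' ∈ Y, (Gd G c (c s(x, p))).Adj v y') →
      c s(v, q) = c s(x, p) ∧ ∀ y ∈ L, y ≠ x → ¬ G.Adj y v := by
    intro v hv hno
    have h1 : c s(v, q) = c s(x, p) := by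
      by_contra hne
      exact hno ⟨q, by simp [hY], hv, hne⟩
    refine ⟨h1, fun y hy hyx hyv => hno ⟨y, by simp [hY, hy, hyx], hyv.symm, ?_⟩⟩
    rw [← h1, Sym2.eq_swap, Sym2.eq_swap (a := v)]
    exact R.col_ne hyv hv.symm (hlow y hy).2.2.2.2.1 hyv.ne
  -- failure at a side vertex is impossible
  have side : ∀ a' b', ({a', b', d} : Finset V) = {a, b, d} → a' ≠ b' → a' ≠ d → b' ≠ d → a' ∉ C → b' ∉ C →
      (∃ z ∈ C, G.Adj a' z) → a' ≠ p → b' ≠ p → a' ≠ q → b' ≠ q → x ≠ a' → x ≠ b' → (∀ v ∈ L, v ≠ a' ∧ v ≠ b') →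
      c s(a', q) = c s(x, p) → G.Adj a' q →
      (∀ y ∈ L, y ≠ x → ¬ G.Adj y a') → False := by
    intro a' b' he m1 m2 m3 m4 m5 hz m6 m7 m8 m9 m10 m11 m12 hc haq hno
    obtain ⟨u, hu, hau⟩ := hz
    obtain ⟨v, hv, w, hw, hvu, hwu, hvw, hGvw, -⟩ := K.tri.other hu
    obtain ⟨x₁, hx1, x₂, hx2, h12⟩ := Finset.one_lt_card.1 (show 1 < (L.erase x).card by omega)
    rw [Finset.mem_erase] at hx1 hx2
    have t : ∀ y ∈ L, y ≠ x → G.Adj y b' ∧ G.Adj y d := by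
      intro y hy hyx
      refine two_of m3 m1.symm m2.symm (r := a') ?_ (hno y hy hyx)
      rw [rot3, he]
      exact (K.low' hy).1
    have t1 := (t x₁ hx1.2 hx1.1).1
    have t2 := (t x₂ hx2.2 hx2.1).2
    have l1 := hlow x₁ hx1.2
    have l2 := hlow x₂ hx2.2
    have k1 := m12 x₁ hx1.2
    have k2 := m12 x₂ hx2.2
    refine R.no_1_4 hxp (a₁ := a') (b₁ := u) (a₂ := v) (b₂ := w) (a₃ := b') (b₃ := x₁) (a₄ := d) (b₄ := x₂)
      ⟨hau, ?_⟩ ⟨hGvw, ?_⟩ ⟨t1.symm, ?_⟩ ⟨t2.symm, ?_⟩ ?_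
    · rw [← hc, Sym2.eq_swap, Sym2.eq_swap (a := a')]
      exact R.col_ne hau.symm haq.symm (by grind) hau.ne.symm
    · rw [← hc]; exact R.col_ne hGvw haq (by grind) (by grind)
    · rw [← hc]; exact R.col_ne t1.symm haq m1.symm m9
    · rw [← hc]; exact R.col_ne t2.symm haq m2.symm n6
    · clear hno t fail he m12 hlow hYm
      clear_value Y L
      apply nd10 <;> grind
  obtain ⟨y₀, hy₀⟩ : ∃ y, y ∈ C := Finset.card_pos.1 (by rw [K.tri.card]; omega)
  obtain ⟨z₀, hz₀, -, haz, hbz⟩ := five_full K.tri K.ab K.five hy₀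
  have okA : ∃ y' ∈ Y, (Gd G c (c s(x, p))).Adj a y' := by
    by_contra hno
    obtain ⟨f1, f2⟩ := fail a K.aq hno
    exact side a b rfl n7 n8 n9 n10 n11 ⟨z₀, hz₀, haz⟩ n1 n2 n4 n5 l0.1 l0.2.1
      (fun v hv => ⟨(hlow v hv).1, (hlow v hv).2.1⟩) f1 K.aq f2
  have okB : ∃ y' ∈ Y, (Gd G c (c s(x, p))).Adj b y' := by
    by_contra hno
    obtain ⟨f1, f2⟩ := fail b K.bq hno
    exact side b a (Finset.insert_comm _ _ _) n7.symm n9 n8 n11 n10 ⟨z₀, hz₀, hbz⟩ n2 n1 n5 n4 l0.2.1 l0.1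
      (fun v hv => ⟨(hlow v hv).2.1, (hlow v hv).1⟩) f1 K.bq f2
  by_cases okD : ∃ y' ∈ Y, (Gd G c (c s(x, p))).Adj d y'
  · exfalso
    have hYn : ∀ v ∈ Y, v ≠ a ∧ v ≠ b ∧ v ≠ d ∧ v ∉ C ∧ v ≠ x ∧ v ≠ p := by
      intro v hv
      rcases hYm v hv with rfl | h
      · exact ⟨n4.symm, n5.symm, n6.symm, K.qC, Ne.symm l0.2.2.2.2.1, n15.symm⟩
      · have := hlow v h.1
        tauto
    obtain ⟨x₁, hx1, x₂, hx2, x₃, hx3, h12, h13, h23, e1, e2, e3⟩ := sdr K.ab K.ad'.ne K.bd'.ne (R.lost (k := c s(x, p)))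
      Y hYc (fun v hv => by
        rcases hYm v hv with rfl | h
        · exact K.swappq.two_p
        · exact (K.low' h.1).1)
      (fun h => (hYn _ h).1 rfl) (fun h => (hYn _ h).2.1 rfl) (fun h => (hYn _ h).2.2.1 rfl)
      okA okB okD
    have l1 := hYn x₁ hx1
    have l2 := hYn x₂ hx2
    have l3 := hYn x₃ hx3
    obtain ⟨u, hu, v, hv, huv, hGuv⟩ := K.tri.edge (R.lost (k := c s(x, p)))
    refine R.no_1_4 hxp e1 e2 e3 hGuv ?_
    clear side fail hYn hYm hlow okA okB okD
    clear_value Y L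
    apply nd10 <;> grind
  · exact fail d K.dq okD

/-- core of case B: two low vertices attached to `p` resp. `p` or `q` -/
lemma CfgII.twoP {a b d p q : V} {C : Finset V} (K : CfgII T G a b d p q C) (R : CRep T G c) (hT : PT T) {x x' : V}
    (hx : x ∈ lowII a b d p q C) (hx' : x' ∈ lowII a b d p q C) (hne : x ≠ x')
    (hxp : T.Adj x p) (hx'p : T.Adj x' p) : False := by
  have h1 := (K.attP R hT hx hxp).2 x' hx' hne.symm
  have h2 := (K.attP R hT hx' hx'p).2 x hx hne
  have t1 := two_of K.ab K.ad'.ne K.bd'.ne (K.low' hx').1 h1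
  have t2 := two_of K.ab K.ad'.ne K.bd'.ne (K.low' hx).1 h2
  have l1 := mem_lowII.1 hx
  have l2 := mem_lowII.1 hx'
  exact hT.k33.points (a := a) (b := b) (c := p) (x := x) (y := x') (z := d) K.ab K.ap.ne K.bp.ne hne l1.2.2.1
    l2.2.2.1 (R.le t2.1.symm) (R.le t1.1.symm) (R.le K.ad') (R.le t2.2.symm) (R.le t1.2.symm) (R.le K.bd')
    hxp.symm hx'p.symm (R.le K.dp.symm)

lemma CfgII.twoPQ {a b d p q : V} {C : Finset V} (K : CfgII T G a b d p q C) (R : CRep T G c) (hT : PT T) {x x' : V}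
    (hx : x ∈ lowII a b d p q C) (hx' : x' ∈ lowII a b d p q C) (hne : x ≠ x')
    (hxp : T.Adj x p) (hx'q : T.Adj x' q) : False := by
  have el : lowII a b d q p C = lowII a b d p q C := by
    ext v; rw [mem_lowII, mem_lowII]; tauto
  have h1 := K.attP R hT hx hxp
  have h2 := K.swappq.attP R hT (by rw [el]; exact hx') hx'q
  rw [el] at h2
  have hLc := K.card_low hT
  have : ∃ x'' ∈ lowII a b d p q C, x'' ≠ x ∧ x'' ≠ x' := by
    by_contra hcon
    push Not at hcon
    have : lowII a b d p q C ⊆ {x, x'} := by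
      intro v hv
      by_cases hvx : v = x
      · simp [hvx]
      · simp [hcon v hv hvx]
    have := (Finset.card_le_card this).trans Finset.card_le_two
    omega
  obtain ⟨x'', hx'', n1, n2⟩ := this
  have t := (two_of K.ab K.ad'.ne K.bd'.ne (K.low' hx'').1 (h1.2 x'' hx'' n1)).1
  obtain ⟨u, hu, v, hv, huv, hGuv⟩ := K.tri.edge (H := G) ⟨s(a, a), fun u v h => Or.inl h⟩
  have l0 := mem_lowII.1 hx
  have l1 := mem_lowII.1 hx'
  have l2 := mem_lowII.1 hx''
  have n1 := K.ap.ne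
  have n2 := K.bp.ne
  have n3 := K.dp.ne
  have n4 := K.aq.ne
  have n5 := K.bq.ne
  have n6 := K.dq.ne
  have n7 := K.ab
  have n8 := K.ad'.ne
  have n9 := K.bd'.ne
  have n10 := K.aC
  have n11 := K.bC
  have n12 := K.dC
  have n13 := K.pC
  have n14 := K.qC
  have n15 := K.pq
  have c1 := h1.1
  have c2 := h2.1
  refine R.no_2_3 hxp hx'q ?_ (a₁ := a) (b₁ := x'') (a₂ := b) (b₂ := d) (a₃ := u) (b₃ := v)
    ⟨t.symm, ?_⟩ ⟨K.bd', ?_⟩ ⟨hGuv, ?_⟩ ?_ ?_ ?_ ?_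
  · rw [← c1, ← c2, Sym2.eq_swap, Sym2.eq_swap (a := d)]
    exact R.col_ne K.dq.symm K.dp.symm n15.symm n6.symm
  · rw [← c1]; exact R.col_ne t.symm K.dq n8 n4
  · rw [← c1]; exact R.col_ne K.bd' K.dq n9 n5
  · rw [← c1]; exact R.col_ne hGuv K.dq (by grind) (by grind)
  · rw [← c2]; exact R.col_ne t.symm K.dp n8 n1
  · rw [← c2]; exact R.col_ne K.bd' K.dp n9 n2
  · rw [← c2]; exact R.col_ne hGuv K.dp (by grind) (by grind)
  · clear h1 h2 el
    apply nd10 <;> grind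

set_option maxHeartbeats 2000000 in
/-- two low vertices attached to `C` (and a third one) -/
lemma CfgII.twoC {a b d p q : V} {C : Finset V} (K : CfgII T G a b d p q C) (R : CRep T G c) (hT : PT T) {x x' x'' y' y'' : V}
    (hx : x ∈ lowII a b d p q C) (hx' : x' ∈ lowII a b d p q C) (hx'' : x'' ∈ lowII a b d p q C)
    (h1 : x ≠ x') (h2 : x ≠ x'') (h3 : x' ≠ x'') (hy' : y' ∈ C) (hy'' : y'' ∈ C)
    (e' : T.Adj x' y') (e'' : T.Adj x'' y'') : False := by
  have l0 := mem_lowII.1 hx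
  have l1 := mem_lowII.1 hx'
  have l2 := mem_lowII.1 hx''
  have n1 := K.ap.ne
  have n2 := K.bp.ne
  have n3 := K.dp.ne
  have n4 := K.aq.ne
  have n5 := K.bq.ne
  have n6 := K.dq.ne
  have n7 := K.ab
  have n8 := K.ad'.ne
  have n9 := K.bd'.ne
  have n10 := K.aC
  have n11 := K.bC
  have n12 := K.dC
  have n13 := K.pC
  have n14 := K.qC
  have n15 := K.pq
  by_cases hyy : y' = y''
  · subst hyy
    obtain ⟨z, hz, hzy, haz, hbz⟩ := five_full K.tri K.ab K.five hy'
    have t1 := K.attC R hT hx' hy' e'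
    have t2 := K.attC R hT hx'' hy' e''
    exact hT.k33.points (a := a) (b := b) (c := y') (x := x') (y := x'') (z := z) K.ab (by grind) (by grind) h3
      (by grind) (by grind) (R.le t1.1.symm) (R.le t2.1.symm) (R.le haz) (R.le t1.2.symm) (R.le t2.2.symm) (R.le hbz)
      e'.symm e''.symm (R.le (K.tri.adj _ hy' _ hz hzy.symm))
  · obtain ⟨w, hw, hwy', hwy'', a1, a2, hC⟩ := K.tri.third hy' hy'' hyy
    have c1 := K.colC R hT hx' e' hC hyy hwy'.symm hwy''.symm
    have c2 := K.colC R hT hx'' e'' (z := y') (w := w) (by rw [hC]; exact Finset.insert_comm _ _ _) (Ne.symm hyy) hwy''.symm hwy'.symm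
    have hYn : ∀ v ∈ ({p, q, x} : Finset V), v ≠ a ∧ v ≠ b ∧ v ≠ d ∧ v ∉ C ∧ v ≠ x' ∧ v ≠ x'' := by
      intro v hv
      simp only [Finset.mem_insert, Finset.mem_singleton] at hv
      rcases hv with rfl | rfl | rfl <;> grind
    obtain ⟨x₁, hx1, x₂, hx2, x₃, hx3, h12, h13, h23, e1, e2, e3⟩ := sdr K.ab K.ad'.ne K.bd'.ne
      (H := G) (G := G) ⟨s(a, a), fun u v h => Or.inl h⟩
      ({p, q, x} : Finset V) (by rw [Finset.card_eq_three.2 ⟨p, q, x, n15, Ne.symm l0.2.2.2.1, Ne.symm l0.2.2.2.2.1, rfl⟩]) (fun v hv => by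
        simp only [Finset.mem_insert, Finset.mem_singleton] at hv
        rcases hv with rfl | rfl | rfl
        · exact K.two_p
        · exact K.swappq.two_p
        · exact (K.low' hx).1)
      (fun h => (hYn _ h).1 rfl) (fun h => (hYn _ h).2.1 rfl) (fun h => (hYn _ h).2.2.1 rfl)
      ⟨p, by simp, K.ap⟩ ⟨p, by simp, K.bp⟩ ⟨p, by simp, K.dp⟩
    have k1 := hYn x₁ hx1
    have k2 := hYn x₂ hx2
    have k3 := hYn x₃ hx3
    have m1 : a ≠ y' ∧ a ≠ y'' ∧ a ≠ w ∧ b ≠ y' ∧ b ≠ y'' ∧ b ≠ w ∧ d ≠ y' ∧ d ≠ y'' ∧ d ≠ w := by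
      clear hC; grind
    refine R.no_2_3 e' e'' ?_ (a₁ := a) (b₁ := x₁) (a₂ := b) (b₂ := x₂) (a₃ := d) (b₃ := x₃)
      ⟨e1, ?_⟩ ⟨e2, ?_⟩ ⟨e3, ?_⟩ ?_ ?_ ?_ ?_
    · rw [← c1, ← c2]; exact R.col_ne a1 a2 (Ne.symm hyy) hwy''.symm
    · rw [← c1]; exact R.col_ne e1 a1 (by tauto) (by tauto)
    · rw [← c1]; exact R.col_ne e2 a1 (by tauto) (by tauto)
    · rw [← c1]; exact R.col_ne e3 a1 (by tauto) (by tauto)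
    · rw [← c2]; exact R.col_ne e1 a2 (by tauto) (by tauto)
    · rw [← c2]; exact R.col_ne e2 a2 (by tauto) (by tauto)
    · rw [← c2]; exact R.col_ne e3 a2 (by tauto) (by tauto)
    · clear hYn hC hx1 hx2 hx3
      apply nd10 <;> grind

lemma CfgII.false {a b d p q : V} {C : Finset V} (K : CfgII T G a b d p q C) (R : CRep T G c) (hT : PT T) : False := by
  have el : lowII a b d q p C = lowII a b d p q C := by
    ext v; rw [mem_lowII, mem_lowII]; tauto
  have hLc := K.card_low hT
  obtain ⟨x, hx, y, hy, z, hz, hxy, hxz, hyz⟩ := Finset.two_lt_card.1 hLc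
  have ax := K.attach R hT hx
  have ay := K.attach R hT hy
  have az := K.attach R hT hz
  have P : ∀ u ∈ lowII a b d p q C, ∀ v ∈ lowII a b d p q C, u ≠ v → (T.Adj u p ∨ T.Adj u q) →
      (T.Adj v p ∨ T.Adj v q) → False := by
    intro u hu v hv huv h1 h2
    rcases h1 with h1 | h1 <;> rcases h2 with h2 | h2
    · exact K.twoP R hT hu hv huv h1 h2
    · exact K.twoPQ R hT hu hv huv h1 h2
    · exact K.twoPQ R hT hv hu huv.symm h2 h1
    · exact K.swappq.twoP R hT (by rw [el]; exact hu) (by rw [el]; exact hv) huv h1 h2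
  have Q : ∀ t ∈ lowII a b d p q C, ∀ u ∈ lowII a b d p q C, ∀ v ∈ lowII a b d p q C, t ≠ u → t ≠ v → u ≠ v →
      (∃ w ∈ C, T.Adj u w) → (∃ w ∈ C, T.Adj v w) → False := by
    rintro t ht u hu v hv h1 h2 h3 ⟨w, hw, e⟩ ⟨w', hw', e'⟩
    exact K.twoC R hT ht hu hv h1 h2 h3 hw hw' e e'
  rw [← or_assoc] at ax ay az
  rcases ax with ax | ax <;> rcases ay with ay | ay <;> rcases az with az | az
  · exact P x hx y hy hxy ax ay
  · exact P x hx y hy hxy ax ay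
  · exact P x hx z hz hxz ax az
  · exact Q x hx y hy z hz hxy hxz hyz ay az
  · exact P y hy z hz hyz ay az
  · exact Q y hy x hx z hz hxy.symm hyz hxz ax az
  · exact Q z hz x hx y hy hxz.symm hyz.symm hxy ax ay
  · exact Q z hz x hx y hy hxz.symm hyz.symm hxy ax ay

end
end

section
open Set
set_option linter.all false

variable {V : Type*} [Fintype V] [DecidableEq V] {T G : SimpleGraph V} {c : Sym2 V → ℕ}

/-- `G` has a vertex cover of size at most four. -/
def Cover4 (G : SimpleGraph V) : Prop :=
  ∃ S : Finset V, S.card ≤ 4 ∧ ∀ u v, G.Adj u v → u ∈ S ∨ v ∈ S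

lemma tight_triple (hle : G ≤ T) {a b d : V} (hab : a ≠ b) (had : a ≠ d) (hbd : b ≠ d) {W : Finset V}
    (h : 2 * W.card + (fullSet T a b d W).card ≤ cnt G {a, b, d} W) {x : V} (hx : x ∈ W) :
    (x ∈ fullSet T a b d W → cnt G {x} {a, b, d} = 3) ∧
    (x ∉ fullSet T a b d W → cnt G {x} {a, b, d} = 2 ∧ cnt T {x} {a, b, d} ≤ 2) := by
  classical
  have key : ∀ x ∈ W, cnt T {x} {a, b, d} ≤ 2 + (if x ∈ fullSet T a b d W then 1 else 0) := by
    intro x hx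
    have := cnt_triple_le (T := T) hab had hbd x
    refine this.trans (le_of_eq ?_)
    congr 1
    simp [mem_fullSet, hx]
  have key' : ∀ x ∈ W, cnt G {x} {a, b, d} ≤ 2 + (if x ∈ fullSet T a b d W then 1 else 0) :=
    fun x hx => (cnt_mono hle _ _).trans (key x hx)
  have e : ∑ x ∈ W, (2 + (if x ∈ fullSet T a b d W then 1 else 0)) =
      2 * W.card + (fullSet T a b d W).card := by
    rw [Finset.sum_add_distrib, ← Finset.card_filter, Finset.sum_const, smul_eq_mul, mul_comm]
    congr 2
    ext y; simp [mem_fullSet]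
  rw [cnt_right_sum', ← e] at h
  have := (Finset.sum_eq_sum_iff_of_le key').1 (le_antisymm (Finset.sum_le_sum key') h) x hx
  refine ⟨fun h => by rw [this, if_pos h], fun h => ⟨by rw [this, if_neg h], ?_⟩⟩
  have := key x hx
  rwa [if_neg h] at this

lemma cnt_eq_adj (hle : G ≤ T) {A B : Finset V} (h : cnt T A B ≤ cnt G A B) {u v : V} (hu : u ∈ A) (hv : v ∈ B)
    (huv : T.Adj u v) : G.Adj u v := by
  have h1 := (Finset.sum_eq_sum_iff_of_le (fun u (_ : u ∈ A) => Finset.sum_le_sum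
    fun v (_ : v ∈ B) => ad_mono hle u v)).1 (le_antisymm (cnt_mono hle A B) h) u hu
  have h2 := (Finset.sum_eq_sum_iff_of_le (fun v (_ : v ∈ B) => ad_mono hle u v)).1 h1 v hv
  rw [← ad_one, h2, ad_one]; exact huv

lemma triple_three {x a b d : V} (hab : a ≠ b) (had : a ≠ d) (hbd : b ≠ d)
    (h : cnt G {x} {a, b, d} = 3) : G.Adj a x ∧ G.Adj b x ∧ G.Adj d x := by
  rw [cnt_single_three x hab had hbd] at h
  have h1 := ad_le (G := G) x a
  have h2 := ad_le (G := G) x b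
  have h3 := ad_le (G := G) x d
  have e1 : ad G x a = 1 := by omega
  have e2 : ad G x b = 1 := by omega
  have e3 : ad G x d = 1 := by omega
  exact ⟨(ad_one.1 e1).symm, (ad_one.1 e2).symm, (ad_one.1 e3).symm⟩

lemma tri_or_cover {C S : Finset V} (hC : C.card = 3) (hS : S.card ≤ 3)
    (cov : ∀ u v, G.Adj u v → u ∈ S ∨ v ∈ S ∨ (u ∈ C ∧ v ∈ C)) : IsTri G C ∨ Cover4 G := by
  by_cases h : ∀ u ∈ C, ∀ v ∈ C, u ≠ v → G.Adj u v
  · exact Or.inl ⟨hC, h⟩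
  · right
    push Not at h
    obtain ⟨u, hu, v, hv, huv, hn⟩ := h
    have hcard : (C \ {u, v}).card ≤ 1 := by
      rw [Finset.card_sdiff_of_subset (by intro z; simp; rintro (rfl | rfl) <;> assumption), hC,
        Finset.card_pair huv]
    refine ⟨S ∪ (C \ {u, v}), (Finset.card_union_le _ _).trans (by omega), fun x y hxy => ?_⟩
    rcases cov x y hxy with h | h | ⟨h1, h2⟩
    · simp [h]
    · simp [h]
    · have := hxy.symm
      have := hxy.ne
      simp only [Finset.mem_union, Finset.mem_sdiff, Finset.mem_insert, Finset.mem_singleton]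
      grind

lemma x3_count {a b d : V} {C : Finset V} (hab : a ≠ b) (had : a ≠ d) (hbd : b ≠ d) (hC : C.card = 3)
    (hdis : Disjoint {a, b, d} C)
    (cov : ∀ u v, G.Adj u v → u ∈ ({a, b, d} : Finset V) ∨ v ∈ ({a, b, d} : Finset V) ∨ (u ∈ C ∧ v ∈ C)) :
    cnt G Finset.univ Finset.univ = cnt G ({a, b, d} ∪ C) ({a, b, d} ∪ C) +
      2 * cnt G {a, b, d} ({a, b, d} ∪ C)ᶜ ∧ (({a, b, d} ∪ C)ᶜ).card + 6 = Fintype.card V := by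
  constructor
  · rw [cnt_compl ({a, b, d} ∪ C), cnt_union_left (A := {a, b, d}) (B := C) (C := ({a, b, d} ∪ C)ᶜ) hdis]
    have e1 : cnt G C ({a, b, d} ∪ C)ᶜ = 0 := by
      rw [cnt_eq_zero]
      intro u hu v hv huv
      have h1 := Finset.disjoint_right.1 hdis hu
      rw [Finset.mem_compl, Finset.mem_union, not_or] at hv
      rcases cov u v huv with h | h | h
      · exact h1 h
      · exact hv.1 h
      · exact hv.2 h.2
    have e2 : cnt G ({a, b, d} ∪ C)ᶜ ({a, b, d} ∪ C)ᶜ = 0 := by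
      rw [cnt_eq_zero]
      intro u hu v hv huv
      rw [Finset.mem_compl, Finset.mem_union, not_or] at hv hu
      rcases cov u v huv with h | h | h
      · exact hu.1 h
      · exact hv.1 h
      · exact hv.2 h.2
    omega
  · have h1 : ({a, b, d} ∪ C).card = 6 := by
      rw [Finset.card_union_of_disjoint hdis, hC, Finset.card_eq_three.2 ⟨a, b, d, hab, had, hbd, rfl⟩]
    have := Finset.card_add_card_compl ({a, b, d} ∪ C)
    omega

lemma x3_far (R : CRep T G c) (hT : PT T) {a b d : V} {C : Finset V} (hab : a ≠ b) (had : a ≠ d) (hbd : b ≠ d)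
    (hC : IsTri G C) (hdis : Disjoint {a, b, d} C)
    (cov : ∀ u v, G.Adj u v → u ∈ ({a, b, d} : Finset V) ∨ v ∈ ({a, b, d} : Finset V) ∨ (u ∈ C ∧ v ∈ C))
    (hd : ∀ u ∈ C, ¬ T.Adj d u) : False := by
  classical
  obtain ⟨h1, h2⟩ := x3_count hab had hbd hC.card hdis cov
  have hfull := full_card_le hT.k33 hab had hbd ({a, b, d} ∪ C)ᶜ
  have hle := (cnt_mono R.le _ _).trans (cnt_triple_sum_le (T := T) hab had hbd ({a, b, d} ∪ C)ᶜ)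
  have hbig := R.big
  have aC : a ∉ C := Finset.disjoint_left.1 hdis (by simp)
  have bC : b ∉ C := Finset.disjoint_left.1 hdis (by simp)
  have dC : d ∉ C := Finset.disjoint_left.1 hdis (by simp)
  have eX : ({a, b, d} ∪ C : Finset V) = insert d ({a, b} ∪ C) := by
    ext x; simp; tauto
  have disab : Disjoint {a, b} C := by
    rw [Finset.disjoint_left]; intro x; simp; rintro (rfl | rfl) <;> assumption
  have dn : d ∉ ({a, b} ∪ C : Finset V) := by simp [had.symm, hbd.symm, dC]
  have e1 : cnt G ({a, b, d} ∪ C) ({a, b, d} ∪ C) =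
      2 * cnt G {d} {a, b} + cnt G ({a, b} ∪ C) ({a, b} ∪ C) := by
    rw [eX, cnt_insert_self dn, cnt_union_right disab]
    have : cnt G {d} C = 0 := by
      rw [cnt_eq_zero]; intro x hx v hv hxv
      rw [Finset.mem_singleton] at hx; subst hx
      exact hd v hv (R.le hxv)
    omega
  have e2 := mader (K5Free.mono R.le hT.k5) ({a, b} ∪ C) (by
    rw [Finset.card_union_of_disjoint disab, hC.card]; omega)
  rw [Finset.card_union_of_disjoint disab, hC.card, Finset.card_pair hab] at e2
  have e3 := cnt_single_two (G := G) d hab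
  have a1 := ad_le (G := G) d a
  have a2 := ad_le (G := G) d b
  have a3 := ad_le (G := G) a b
  have e4 := cnt_union_self (G := G) disab
  rw [cnt_self_two] at e4
  have e5 := cnt_self_le (G := G) C
  rw [hC.card] at e5
  have f1 : ad G d a = 1 := by omega
  have f2 : ad G d b = 1 := by omega
  have five : 5 ≤ cnt G {a, b} C := by omega
  have full2 : (fullSet T a b d ({a, b, d} ∪ C)ᶜ).card = 2 := by omega
  have tight := fun x hx => tight_triple (x := x) R.le hab had hbd (W := ({a, b, d} ∪ C)ᶜ) (by omega) hx
  obtain ⟨p, q, hpq, hpqe⟩ := Finset.card_eq_two.1 full2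
  have hp : p ∈ fullSet T a b d ({a, b, d} ∪ C)ᶜ := by rw [hpqe]; simp
  have hq : q ∈ fullSet T a b d ({a, b, d} ∪ C)ᶜ := by rw [hpqe]; simp
  have hp' := (mem_fullSet.1 hp).1
  have hq' := (mem_fullSet.1 hq).1
  obtain ⟨p1, p2, p3⟩ := triple_three hab had hbd ((tight p hp').1 hp)
  obtain ⟨q1, q2, q3⟩ := triple_three hab had hbd ((tight q hq').1 hq)
  simp only [Finset.mem_compl, Finset.mem_union, not_or] at hp' hq'
  refine CfgII.false (a := a) (b := b) (d := d) (p := p) (q := q) (C := C) ?_ R hT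
  refine ⟨hab, hpq, (ad_one.1 f1).symm, (ad_one.1 f2).symm, p1, p2, p3, q1, q2, q3, hC, aC, bC, dC,
    hp'.2, hq'.2, five, cov, fun x x1 x2 x3 x4 => ?_⟩
  have := (tight x (by simp only [Finset.mem_compl, Finset.mem_union, not_or]; exact ⟨x1, x2⟩)).2
    (by rw [hpqe]; simp [x3, x4])
  exact ⟨this.1.ge, this.2⟩

lemma x3 (R : CRep T G c) (hT : PT T) {S C : Finset V} (hS : S.card = 3)
    (hC : C.card = 3) (hdis : Disjoint S C)
    (cov : ∀ u v, G.Adj u v → u ∈ S ∨ v ∈ S ∨ (u ∈ C ∧ v ∈ C)) : Cover4 G := by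
  classical
  rcases tri_or_cover hC hS.le cov with htri | h
  swap
  · exact h
  exfalso
  obtain ⟨a, b, d, hab, had, hbd, rfl⟩ := Finset.card_eq_three.1 hS
  by_cases hd : ∀ u ∈ C, ¬ T.Adj d u
  · exact x3_far R hT hab had hbd htri hdis cov hd
  by_cases ha : ∀ u ∈ C, ¬ T.Adj a u
  · rw [← rot3] at hdis cov
    exact x3_far R hT hbd hab.symm had.symm htri hdis cov ha
  by_cases hb : ∀ u ∈ C, ¬ T.Adj b u
  · rw [← rot3'] at hdis cov
    exact x3_far R hT had.symm hbd.symm hab htri hdis cov hb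
  push Not at ha hb hd
  obtain ⟨h1, h2⟩ := x3_count hab had hbd hC hdis cov
  have hbig := R.big
  have aC : a ∉ C := Finset.disjoint_left.1 hdis (by simp)
  have bC : b ∉ C := Finset.disjoint_left.1 hdis (by simp)
  have dC : d ∉ C := Finset.disjoint_left.1 hdis (by simp)
  have hle := (cnt_mono R.le _ _).trans (cnt_triple_sum_le (T := T) hab had hbd ({a, b, d} ∪ C)ᶜ)
  have hm := mader (K5Free.mono R.le hT.k5) ({a, b, d} ∪ C) (by
    rw [Finset.card_union_of_disjoint hdis, hC]; omega)
  rw [Finset.card_union_of_disjoint hdis, hC, hS] at hm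
  have hf1 : (fullSet T a b d ({a, b, d} ∪ C)ᶜ).card ≤ 1 := by
    by_contra hcon
    push Not at hcon
    obtain ⟨p, hp, q, hq, hpq⟩ := Finset.one_lt_card.1 hcon
    rw [mem_fullSet] at hp hq
    obtain ⟨hp0, p1, p2, p3⟩ := hp
    obtain ⟨hq0, q1, q2, q3⟩ := hq
    simp only [Finset.mem_compl, Finset.mem_union, not_or] at hp0 hq0
    obtain ⟨u, hu, hdu⟩ := hd
    refine hT.k33.two (a := a) (b := b) (x := p) (y := q) (C := {d}) (D := C) hab hpq (connSet_singleton _)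
      (htri.mono R.le).conn (by simpa using dC) (by simpa using had) (by simpa using hbd)
      (by simpa using p3.ne.symm) (by simpa using q3.ne.symm) (by simpa using aC) (by simpa using bC)
      (by simpa using hp0.2) (by simpa using hq0.2) p1 q1 p2 q2 ha hb ⟨d, rfl, p3.symm⟩ ⟨d, rfl, q3.symm⟩
      ⟨d, rfl, u, hu, hdu⟩
  have full1 : (fullSet T a b d ({a, b, d} ∪ C)ᶜ).card = 1 := by omega
  have tight := fun x hx => tight_triple (x := x) R.le hab had hbd (W := ({a, b, d} ∪ C)ᶜ) (by omega) hx
  obtain ⟨h, hhe⟩ := Finset.card_eq_one.1 full1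
  have hh : h ∈ fullSet T a b d ({a, b, d} ∪ C)ᶜ := by rw [hhe]; simp
  have hh' := (mem_fullSet.1 hh).1
  obtain ⟨p1, p2, p3⟩ := triple_three hab had hbd ((tight h hh').1 hh)
  simp only [Finset.mem_compl, Finset.mem_union, not_or] at hh'
  refine CfgI.false (p := a) (q := b) (r := d) (h := h) (C := C) ?_ R hT
  have hm' := mader hT.k5 ({a, b, d} ∪ C) (by
    rw [Finset.card_union_of_disjoint hdis, hC]; omega)
  rw [Finset.card_union_of_disjoint hdis, hC, hS] at hm'
  have up : ∀ z ∈ ({a, b, d} : Finset V), (∃ u ∈ C, T.Adj z u) → ∃ u ∈ C, G.Adj z u := by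
    rintro z hz ⟨u, hu, hzu⟩
    exact ⟨u, hu, cnt_eq_adj R.le (A := {a, b, d} ∪ C) (B := {a, b, d} ∪ C) (by omega)
      (Finset.mem_union_left _ hz) (Finset.mem_union_right _ hu) hzu⟩
  refine ⟨hab, had, hbd, p1, p2, p3, htri, aC, bC, dC, hh'.2, up a (by simp) ha, up b (by simp) hb,
    up d (by simp) hd, cov, fun x x1 x2 x3 => ?_⟩
  have := (tight x (by simp only [Finset.mem_compl, Finset.mem_union, not_or]; exact ⟨x1, x2⟩)).2
    (by rw [hhe]; simp [x3])
  exact ⟨this.1.ge, this.2⟩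
end

section
open Set
set_option linter.all false

variable {V : Type*} [Fintype V] [DecidableEq V] {T G : SimpleGraph V} {c : Sym2 V → ℕ}

lemma cover_count {S C : Finset V} (hdis : Disjoint S C)
    (cov : ∀ u v, G.Adj u v → u ∈ S ∨ v ∈ S ∨ (u ∈ C ∧ v ∈ C)) :
    cnt G Finset.univ Finset.univ = cnt G (S ∪ C) (S ∪ C) +
      2 * cnt G S (S ∪ C)ᶜ ∧ ((S ∪ C)ᶜ).card + (S.card + C.card) = Fintype.card V := by
  constructor
  · rw [cnt_compl (S ∪ C), cnt_union_left (A := S) (B := C) (C := (S ∪ C)ᶜ) hdis]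
    have e1 : cnt G C (S ∪ C)ᶜ = 0 := by
      rw [cnt_eq_zero]
      intro u hu v hv huv
      have h1 := Finset.disjoint_right.1 hdis hu
      rw [Finset.mem_compl, Finset.mem_union, not_or] at hv
      rcases cov u v huv with h | h | h
      · exact h1 h
      · exact hv.1 h
      · exact hv.2 h.2
    have e2 : cnt G (S ∪ C)ᶜ (S ∪ C)ᶜ = 0 := by
      rw [cnt_eq_zero]
      intro u hu v hv huv
      rw [Finset.mem_compl, Finset.mem_union, not_or] at hv hu
      rcases cov u v huv with h | h | h
      · exact hu.1 h
      · exact hv.1 h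
      · exact hv.2 h.2
    omega
  · have h1 : (S ∪ C).card = S.card + C.card := Finset.card_union_of_disjoint hdis
    have := Finset.card_add_card_compl (S ∪ C)
    omega

lemma tight_pair {a b : V} (hab : a ≠ b) {W : Finset V} (h : 2 * W.card ≤ cnt G {a, b} W) {x : V} (hx : x ∈ W) :
    G.Adj a x ∧ G.Adj b x := by
  have key : ∀ x ∈ W, cnt G {x} {a, b} ≤ 2 := fun x _ =>
    (cnt_single_le _ _).trans (Finset.card_le_two)
  have e : ∑ x ∈ W, 2 = 2 * W.card := by rw [Finset.sum_const, smul_eq_mul, mul_comm]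
  rw [cnt_right_sum', ← e] at h
  have := (Finset.sum_eq_sum_iff_of_le key).1 (le_antisymm (Finset.sum_le_sum key) h) x hx
  rw [cnt_single_two x hab] at this
  have h1 := ad_le (G := G) x a
  have h2 := ad_le (G := G) x b
  have e1 : ad G x a = 1 := by omega
  have e2 : ad G x b = 1 := by omega
  exact ⟨(ad_one.1 e1).symm, (ad_one.1 e2).symm⟩

/-- two vertices complete to the rest, and two triangles -/
structure CfgIII (T G : SimpleGraph V) (a b : V) (C D : Finset V) : Prop where
  ab : a ≠ b
  tC : IsTri G C
  tD : IsTri G D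
  dCD : Disjoint C D
  aC : a ∉ C
  bC : b ∉ C
  aD : a ∉ D
  bD : b ∉ D
  fC : 5 ≤ cnt G {a, b} C
  fD : 5 ≤ cnt G {a, b} D
  cov : ∀ u v, G.Adj u v → u ∈ ({a, b} : Finset V) ∨ v ∈ ({a, b} : Finset V) ∨ (u ∈ C ∧ v ∈ C) ∨ (u ∈ D ∧ v ∈ D)
  low : ∀ x, x ∉ ({a, b} : Finset V) → x ∉ C → x ∉ D → G.Adj a x ∧ G.Adj b x

lemma CfgIII.swap {a b : V} {C D : Finset V} (K : CfgIII T G a b C D) : CfgIII T G a b D C :=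
  ⟨K.ab, K.tD, K.tC, K.dCD.symm, K.aD, K.bD, K.aC, K.bC, K.fD, K.fC,
    fun u v h => by have := K.cov u v h; tauto, fun x h1 h2 h3 => K.low x h1 h3 h2⟩

lemma CfgIII.attach {a b : V} {C D : Finset V} (K : CfgIII T G a b C D) (R : CRep T G c) (hT : PT T)
    {x : V} (h1 : x ∉ ({a, b} : Finset V)) (h2 : x ∉ C) (h3 : x ∉ D) :
    (∃ y ∈ C, T.Adj x y) ∨ ∃ y ∈ D, T.Adj x y := by
  have two : ∀ z, cnt G {z} {a, b} ≤ 2 := fun z => (cnt_single_le _ _).trans Finset.card_le_two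
  obtain ⟨y, hy, hxy⟩ := hT.exists_nbr x {a, b} ((cnt_single_le _ _).trans Finset.card_le_two)
  by_cases hyC : y ∈ C
  · exact Or.inl ⟨y, hyC, hxy⟩
  by_cases hyD : y ∈ D
  · exact Or.inr ⟨y, hyD, hxy⟩
  exfalso
  refine R.noLow hT (S := {a, b}) (x := x) (y := y) ?_ ?_ (two _) (two _) hy hxy
  · intro v hv; have := K.cov x v hv; tauto
  · intro v hv; have := K.cov y v hv; tauto

lemma CfgIII.colC {a b : V} {C D : Finset V} (K : CfgIII T G a b C D) (R : CRep T G c) (hT : PT T)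
    {x y z w x₁ x₂ : V} (h1 : x ∉ ({a, b} : Finset V)) (h2 : x ∉ C) (h3 : x ∉ D)
    (h1' : x₁ ∉ ({a, b} : Finset V)) (h2' : x₁ ∉ C) (h3' : x₁ ∉ D)
    (h1'' : x₂ ∉ ({a, b} : Finset V)) (h2'' : x₂ ∉ C) (h3'' : x₂ ∉ D) (hx1 : x ≠ x₁) (hx2 : x ≠ x₂) (h12 : x₁ ≠ x₂)
    (hy : y ∈ C) (hz : z ∈ C) (hw : w ∈ C) (hyz : y ≠ z) (hyw : y ≠ w) (hzw : z ≠ w)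
    (hxy : T.Adj x y) : c s(z, w) = c s(x, y) := by
  by_contra hcon
  have H1 : (Gd G c (c s(x, y))).Adj z w := ⟨K.tC.adj z hz w hw hzw, hcon⟩
  obtain ⟨u, hu, v, hv, huv, H2⟩ := K.tD.edge (R.lost (k := c s(x, y)))
  obtain ⟨e₀, hl⟩ := R.lost (k := c s(x, y))
  obtain ⟨a1, b1⟩ := K.low x₁ h1' h2' h3'
  obtain ⟨a2, b2⟩ := K.low x₂ h1'' h2'' h3''
  have aC := K.aC
  have bC := K.bC
  have aD := K.aD
  have bD := K.bD
  have ab := K.ab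
  have dis := Finset.disjoint_left.1 K.dCD
  have du : u ∉ C := fun h => dis h hu
  have dv : v ∉ C := fun h => dis h hv
  have dy : y ∉ D := fun h => dis hy h
  simp only [Finset.mem_insert, Finset.mem_singleton, not_or] at h1 h1' h1''
  clear dis
  by_cases hh : (Gd G c (c s(x, y))).Adj a x₁ ∧ (Gd G c (c s(x, y))).Adj b x₂
  · refine R.no_1_4 hxy H1 H2 hh.1 hh.2 ?_
    clear H1 H2 hcon hl a1 b1 a2 b2 hh
    apply nd10 <;> grind
  · have hh' : (Gd G c (c s(x, y))).Adj a x₂ ∧ (Gd G c (c s(x, y))).Adj b x₁ := by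
      have l1 := hl _ _ a1
      have l2 := hl _ _ a2
      have l3 := hl _ _ b1
      have l4 := hl _ _ b2
      have n1 : s(a, x₁) ≠ s(a, x₂) := by simp [Sym2.eq_iff]; grind
      have n2 : s(a, x₁) ≠ s(b, x₁) := by simp [Sym2.eq_iff]; grind
      have n3 : s(b, x₂) ≠ s(a, x₂) := by simp [Sym2.eq_iff]; grind
      have n4 : s(b, x₂) ≠ s(b, x₁) := by simp [Sym2.eq_iff]; grind
      grind
    refine R.no_1_4 hxy H1 H2 hh'.1 hh'.2 ?_
    clear H1 H2 hcon hl a1 b1 a2 b2 hh hh'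
    apply nd10 <;> grind

lemma CfgIII.two {a b : V} {C D : Finset V} (K : CfgIII T G a b C D) (R : CRep T G c) (hT : PT T)
    {x x₁ x₂ : V} (h1 : x ∉ ({a, b} : Finset V)) (h2 : x ∉ C) (h3 : x ∉ D)
    (h1' : x₁ ∉ ({a, b} : Finset V)) (h2' : x₁ ∉ C) (h3' : x₁ ∉ D)
    (h1'' : x₂ ∉ ({a, b} : Finset V)) (h2'' : x₂ ∉ C) (h3'' : x₂ ∉ D) (hx1 : x ≠ x₁) (hx2 : x ≠ x₂) (h12 : x₁ ≠ x₂)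
    (hy : ∃ y ∈ C, T.Adj x₁ y) (hy' : ∃ y ∈ C, T.Adj x₂ y) : False := by
  obtain ⟨y₁, hy1, e1⟩ := hy
  obtain ⟨y₂, hy2, e2⟩ := hy'
  obtain ⟨a0, b0⟩ := K.low x h1 h2 h3
  obtain ⟨a1, b1⟩ := K.low x₁ h1' h2' h3'
  obtain ⟨a2, b2⟩ := K.low x₂ h1'' h2'' h3''
  by_cases hyy : y₁ = y₂
  · subst hyy
    obtain ⟨z, hz, hzy, az, bz⟩ := five_full K.tC K.ab K.fC hy1
    have := K.aC
    have := K.bC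
    exact hT.k33.points (a := a) (b := b) (c := y₁) (x := x₁) (y := x₂) (z := z) K.ab (by grind) (by grind) h12 (by grind) (by grind)
      (R.le a1) (R.le a2) (R.le az) (R.le b1) (R.le b2) (R.le bz) e1.symm e2.symm
      (R.le (K.tC.adj _ hy1 _ hz hzy.symm))
  · obtain ⟨y₃, hy3, n1, n2, g1, g2, -⟩ := K.tC.third hy1 hy2 hyy
    have c1 := K.colC R hT h1' h2' h3' h1 h2 h3 h1'' h2'' h3'' hx1.symm h12 hx2 hy1 hy2 hy3 hyy n1.symm n2.symm e1
    have c2 := K.colC R hT h1'' h2'' h3'' h1 h2 h3 h1' h2' h3' hx2.symm h12.symm hx1 hy2 hy1 hy3 (Ne.symm hyy) n2.symm n1.symm e2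
    obtain ⟨u, hu, v, hv, huv, H2⟩ := K.tD.edge (R.lost (k := c s(x₁, y₁)))
    have aC := K.aC
    have bC := K.bC
    have aD := K.aD
    have bD := K.bD
    have ab := K.ab
    have dis := Finset.disjoint_left.1 K.dCD
    have du : u ∉ C := fun h => dis h hu
    have dv : v ∉ C := fun h => dis h hv
    clear dis
    simp only [Finset.mem_insert, Finset.mem_singleton, not_or] at h1 h1' h1''
    have key : ∀ p q : V, p ≠ q → p ∉ C → q ∉ C → p ∉ D → q ∉ D → x ≠ p → x ≠ q → x₁ ≠ p → x₁ ≠ q →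
        x₂ ≠ p → x₂ ≠ q → G.Adj p y₃ → G.Adj q x → False := by
      intro p q pq pC qC pD qD xp xq x1p x1q x2p x2q py qx
      refine R.no_2_3 (a₁ := u) (b₁ := v) (a₂ := p) (b₂ := y₃) (a₃ := q) (b₃ := x) e1 e2 ?_ H2 ⟨py, ?_⟩ ⟨qx, ?_⟩ ?_ ?_ ?_ ?_
      · rw [← c1, ← c2]; exact (R.col_ne g2 g1 hyy n1.symm).symm
      · rw [← c1]; exact R.col_ne py g1 (by grind) (by grind)
      · rw [← c1]; exact R.col_ne qx g1 (by grind) (by grind)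
      · rw [← c2]; exact R.col_ne H2.1 g2 (by grind) (by grind)
      · rw [← c2]; exact R.col_ne py g2 (by grind) (by grind)
      · rw [← c2]; exact R.col_ne qx g2 (by grind) (by grind)
      · clear H2 e1 e2 a0 b0 a1 b1 a2 b2 c1 c2 g1 g2 py qx K R hT
        apply nd10 <;> grind
    rcases five_some K.tC K.ab K.fC hy3 with h | h
    · exact key a b ab aC bC aD bD h1.1 h1.2 h1'.1 h1'.2 h1''.1 h1''.2 h b0
    · exact key b a ab.symm bC aC bD aD h1.2 h1.1 h1'.2 h1'.1 h1''.2 h1''.1 h a0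

lemma CfgIII.false {a b : V} {C D : Finset V} (K : CfgIII T G a b C D) (R : CRep T G c) (hT : PT T) : False := by
  have hc : 3 ≤ (({a, b} ∪ C ∪ D)ᶜ : Finset V).card := by
    have h1 : ({a, b} ∪ C ∪ D : Finset V).card ≤ 2 + 3 + 3 :=
      (Finset.card_union_le _ _).trans (add_le_add ((Finset.card_union_le _ _).trans
        (add_le_add Finset.card_le_two K.tC.card.le)) K.tD.card.le)
    have h2 := Finset.card_add_card_compl ({a, b} ∪ C ∪ D : Finset V)
    have := hT.hn
    omega
  obtain ⟨x, hx, y, hy, z, hz, hxy, hxz, hyz⟩ := Finset.two_lt_card.1 hc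
  simp only [Finset.mem_compl, Finset.mem_union, not_or] at hx hy hz
  obtain ⟨⟨x1, x2⟩, x3⟩ := hx
  obtain ⟨⟨y1, y2⟩, y3⟩ := hy
  obtain ⟨⟨z1, z2⟩, z3⟩ := hz
  have ax := K.attach R hT x1 x2 x3
  have ay := K.attach R hT y1 y2 y3
  have az := K.attach R hT z1 z2 z3
  have k1 := K.two R hT x1 x2 x3 y1 y2 y3 z1 z2 z3 hxy hxz hyz
  have k2 := K.two R hT y1 y2 y3 x1 x2 x3 z1 z2 z3 hxy.symm hyz hxz
  have k3 := K.two R hT z1 z2 z3 x1 x2 x3 y1 y2 y3 hxz.symm hyz.symm hxy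
  have k1' := K.swap.two R hT x1 x3 x2 y1 y3 y2 z1 z3 z2 hxy hxz hyz
  have k2' := K.swap.two R hT y1 y3 y2 x1 x3 x2 z1 z3 z2 hxy.symm hyz hxz
  have k3' := K.swap.two R hT z1 z3 z2 x1 x3 x2 y1 y3 y2 hxz.symm hyz.symm hxy
  rcases ax with ax | ax <;> rcases ay with ay | ay
  · exact k3 ax ay
  · rcases az with az | az
    · exact k2 ax az
    · exact k1' ay az
  · rcases az with az | az
    · exact k1 ay az
    · exact k2' ax az
  · exact k3' ax ay

lemma le5 (hT : PT T) (hle : G ≤ T) {a b x : V} (hab : a ≠ b) {C : Finset V} (hC : IsTri G C) (aC : a ∉ C) (bC : b ∉ C)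
    (xC : x ∉ C) (ax : T.Adj a x) (bx : T.Adj b x) : cnt G {a, b} C ≤ 5 := by
  by_contra hcon
  have h6 := cnt_le_mul (G := G) {a, b} C
  rw [hC.card, Finset.card_pair hab] at h6
  have := fun y hy => tight_pair (G := G) hab (W := C) (by rw [hC.card]; omega) (x := y) hy
  obtain ⟨u, v, w, huv, huw, hvw, rfl⟩ := Finset.card_eq_three.1 hC.card
  have hu := this u (by simp)
  have hv := this v (by simp)
  have hw := this w (by simp)
  have n1 := hC.adj u (by simp) v (by simp) huv
  have n2 := hC.adj u (by simp) w (by simp) huw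
  have n3 := hC.adj v (by simp) w (by simp) hvw
  simp only [Finset.mem_insert, Finset.mem_singleton, not_or] at aC bC xC
  refine hT.k5.elim {a, x} {b} {u} {v} {w} (connSet_pair ax) (connSet_singleton _) (connSet_singleton _)
    (connSet_singleton _) (connSet_singleton _) ?_ ?_ ?_ ?_ ?_ ?_ ?_ ?_ ?_ ?_
    ⟨x, by simp, b, by simp, bx.symm⟩ ⟨a, by simp, _, rfl, hle hu.1⟩ ⟨a, by simp, _, rfl, hle hv.1⟩
    ⟨a, by simp, _, rfl, hle hw.1⟩ ⟨_, rfl, _, rfl, hle hu.2⟩ ⟨_, rfl, _, rfl, hle hv.2⟩ ⟨_, rfl, _, rfl, hle hw.2⟩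
    ⟨_, rfl, _, rfl, hle n1⟩ ⟨_, rfl, _, rfl, hle n2⟩ ⟨_, rfl, _, rfl, hle n3⟩
  all_goals have := bx.ne
  all_goals simp
  all_goals grind

lemma x33_aux (R : CRep T G c) (hT : PT T) {S C D : Finset V} (hS : S.card = 2) (hC : C.card = 3) (hD : D.card = 3)
    (dSC : Disjoint S C) (dSD : Disjoint S D) (dCD : Disjoint C D)
    (cov : ∀ u v, G.Adj u v → u ∈ S ∨ v ∈ S ∨ (u ∈ C ∧ v ∈ C) ∨ (u ∈ D ∧ v ∈ D)) : IsTri G C ∨ Cover4 G := by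
  by_cases h : ∀ u ∈ C, ∀ v ∈ C, u ≠ v → G.Adj u v
  · exact Or.inl ⟨hC, h⟩
  right
  push Not at h
  obtain ⟨u, hu, v, hv, huv, hn⟩ := h
  have hcard : (C \ {u, v}).card = 1 := by
    rw [Finset.card_sdiff_of_subset (by intro z; simp; rintro (rfl | rfl) <;> assumption), hC,
      Finset.card_pair huv]
  refine x3 R hT (S := S ∪ (C \ {u, v})) (C := D) ?_ hD ?_ ?_
  · rw [Finset.card_union_of_disjoint (dSC.mono_right Finset.sdiff_subset)]; omega
  · rw [Finset.disjoint_union_left]; exact ⟨dSD, dCD.mono_left Finset.sdiff_subset⟩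
  · intro x y hxy
    have h1 := hxy.symm
    have h2 := hxy.ne
    have := cov x y hxy
    simp only [Finset.mem_union, Finset.mem_sdiff, Finset.mem_insert, Finset.mem_singleton]
    grind

lemma x33 (R : CRep T G c) (hT : PT T) {S C D : Finset V} (hS : S.card = 2) (hC : C.card = 3) (hD : D.card = 3)
    (dSC : Disjoint S C) (dSD : Disjoint S D) (dCD : Disjoint C D)
    (cov : ∀ u v, G.Adj u v → u ∈ S ∨ v ∈ S ∨ (u ∈ C ∧ v ∈ C) ∨ (u ∈ D ∧ v ∈ D)) : Cover4 G := by
  rcases x33_aux R hT hS hC hD dSC dSD dCD cov with tC | h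
  swap
  · exact h
  rcases x33_aux R hT hS hD hC dSD dSC dCD.symm (fun u v h => by have := cov u v h; tauto) with tD | h
  swap
  · exact h
  exfalso
  obtain ⟨a, b, hab, rfl⟩ := Finset.card_eq_two.1 hS
  have dSX : Disjoint {a, b} (C ∪ D) := by rw [Finset.disjoint_union_right]; exact ⟨dSC, dSD⟩
  obtain ⟨h1, h2⟩ := cover_count (G := G) dSX (fun u v h => by
    have := cov u v h; simp only [Finset.mem_union]; tauto)
  rw [hS, Finset.card_union_of_disjoint dCD, hC, hD] at h2
  have e1 := cnt_union_self (G := G) dSX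
  rw [cnt_self_two, cnt_union_right dCD, cnt_union_self dCD] at e1
  have e2 : cnt G C D = 0 := by
    rw [cnt_eq_zero]
    intro u hu v hv huv
    have a1 := Finset.disjoint_right.1 dSC hu
    have a2 := Finset.disjoint_right.1 dSD hv
    have a3 := Finset.disjoint_right.1 dCD hv
    have a4 := Finset.disjoint_left.1 dCD hu
    have := cov u v huv
    tauto
  have e3 := cnt_self_le (G := G) C
  have e4 := cnt_self_le (G := G) D
  rw [hC] at e3
  rw [hD] at e4
  have e5 := ad_le (G := G) a b
  have e6 := cnt_le_mul (G := G) {a, b} C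
  have e7 := cnt_le_mul (G := G) {a, b} D
  have e8 := cnt_le_mul (G := G) {a, b} ({a, b} ∪ (C ∪ D))ᶜ
  rw [hS] at e6 e7 e8
  have hbig := R.big
  have hn := hT.hn
  have aC : a ∉ C := Finset.disjoint_left.1 dSC (by simp)
  have bC : b ∉ C := Finset.disjoint_left.1 dSC (by simp)
  have aD : a ∉ D := Finset.disjoint_left.1 dSD (by simp)
  have bD : b ∉ D := Finset.disjoint_left.1 dSD (by simp)
  have hx : ∃ x ∈ ({a, b} ∪ (C ∪ D))ᶜ, G.Adj a x ∧ G.Adj b x := by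
    by_contra hcon
    push Not at hcon
    have : cnt G {a, b} ({a, b} ∪ (C ∪ D))ᶜ ≤ ∑ x ∈ ({a, b} ∪ (C ∪ D))ᶜ, 1 := by
      rw [cnt_right_sum']
      refine Finset.sum_le_sum fun x hx => ?_
      rw [cnt_single_two x hab]
      have l1 := ad_le (G := G) x a
      have l2 := ad_le (G := G) x b
      by_contra hlt
      have f1 : ad G x a = 1 := by omega
      have f2 : ad G x b = 1 := by omega
      exact hcon x hx (ad_one.1 f1).symm (ad_one.1 f2).symm
    rw [Finset.sum_const, smul_eq_mul, mul_one] at this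
    rw [hC] at e6
    rw [hD] at e7
    omega
  obtain ⟨x, hxm, ax, bx⟩ := hx
  simp only [Finset.mem_compl, Finset.mem_union, not_or] at hxm
  have k1 := le5 hT R.le hab tC aC bC hxm.2.1 (R.le ax) (R.le bx)
  have k2 := le5 hT R.le hab tD aD bD hxm.2.2 (R.le ax) (R.le bx)
  have hl := fun x hx => tight_pair (G := G) hab (W := ({a, b} ∪ (C ∪ D))ᶜ) (by omega) (x := x) hx
  refine CfgIII.false (a := a) (b := b) (C := C) (D := D) ?_ R hT
  refine ⟨hab, tC, tD, dCD, aC, bC, aD, bD, by omega, by omega, cov, fun x x1 x2 x3 => hl x ?_⟩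
  simp only [Finset.mem_compl, Finset.mem_union, not_or]
  exact ⟨x1, x2, x3⟩

lemma x5_split (R : CRep T G c) (hT : PT T) {S C A : Finset V} (hS : S.card = 2) (hC : C.card = 5)
    (dSC : Disjoint S C) (hA : A ⊆ C) (hA0 : A.Nonempty) (hA2 : A.card ≤ 2)
    (hno : ∀ u ∈ A, ∀ v ∈ C, v ∉ A → ¬ G.Adj u v)
    (cov : ∀ u v, G.Adj u v → u ∈ S ∨ v ∈ S ∨ (u ∈ C ∧ v ∈ C)) : Cover4 G := by
  have hc := Finset.card_sdiff_of_subset hA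
  rcases Nat.lt_or_ge A.card 2 with h | h
  · have h1 : A.card = 1 := by have := Finset.card_pos.2 hA0; omega
    obtain ⟨z, rfl⟩ := Finset.card_eq_one.1 h1
    have : (C \ {z}).Nonempty := Finset.card_pos.1 (by omega)
    obtain ⟨v, hv⟩ := this
    simp only [Finset.mem_sdiff, Finset.mem_singleton] at hv
    refine x3 R hT (S := insert v S) (C := (C \ {z}).erase v) ?_ ?_ ?_ ?_
    · rw [Finset.card_insert_of_notMem (Finset.disjoint_right.1 dSC hv.1), hS]
    · rw [Finset.card_erase_of_mem (by simp [hv])]; omega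
    · rw [Finset.disjoint_insert_left]
      exact ⟨by simp, dSC.mono_right ((Finset.erase_subset _ _).trans Finset.sdiff_subset)⟩
    · intro x y hxy
      have := cov x y hxy
      have n1 := hxy.symm
      have n2 := hxy.ne
      have k1 := hno x
      have k2 := hno y
      simp only [Finset.mem_insert, Finset.mem_erase, Finset.mem_sdiff, Finset.mem_singleton] at *
      grind
  · obtain ⟨u, w, huw, rfl⟩ := Finset.card_eq_two.1 (le_antisymm hA2 h)
    have hu : u ∈ C := hA (by simp)
    refine x3 R hT (S := insert u S) (C := C \ {u, w}) ?_ ?_ ?_ ?_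
    · rw [Finset.card_insert_of_notMem (Finset.disjoint_right.1 dSC hu), hS]
    · rw [Finset.card_pair huw] at hc; omega
    · rw [Finset.disjoint_insert_left]
      exact ⟨by simp, dSC.mono_right Finset.sdiff_subset⟩
    · intro x y hxy
      have := cov x y hxy
      have n1 := hxy.symm
      have n2 := hxy.ne
      have k1 := hno x
      have k2 := hno y
      simp only [Finset.mem_insert, Finset.mem_sdiff, Finset.mem_singleton] at *
      grind

lemma x5 (R : CRep T G c) (hT : PT T) {S C : Finset V} (hS : S.card = 2) (hC : C.card = 5)
    (dSC : Disjoint S C)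
    (cov : ∀ u v, G.Adj u v → u ∈ S ∨ v ∈ S ∨ (u ∈ C ∧ v ∈ C)) : Cover4 G := by
  classical
  by_cases hconn : ConnSet T (C : Set V)
  · exfalso
    obtain ⟨a, b, hab, rfl⟩ := Finset.card_eq_two.1 hS
    obtain ⟨h1, h2⟩ := cover_count (G := G) dSC cov
    have e1 := mader (K5Free.mono R.le hT.k5) ({a, b} ∪ C) (by
      rw [Finset.card_union_of_disjoint dSC, hC]; omega)
    rw [Finset.card_union_of_disjoint dSC, hC, hS] at e1
    rw [hC, hS] at h2
    have hbig := R.big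
    have hn := hT.hn
    have hl := fun x hx => tight_pair (G := G) hab (W := ({a, b} ∪ C)ᶜ) (by omega) (x := x) hx
    have att : ∀ x ∈ ({a, b} ∪ C)ᶜ, ∃ y ∈ (C : Set V), T.Adj x y := by
      intro x hx
      have two : ∀ z, cnt G {z} {a, b} ≤ 2 := fun z => (cnt_single_le _ _).trans Finset.card_le_two
      obtain ⟨y, hy, hxy⟩ := hT.exists_nbr x {a, b} ((cnt_single_le _ _).trans Finset.card_le_two)
      by_cases hyC : y ∈ C
      · exact ⟨y, hyC, hxy⟩
      exfalso
      simp only [Finset.mem_compl, Finset.mem_union, not_or] at hx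
      refine R.noLow hT (S := {a, b}) (x := x) (y := y) ?_ ?_ (two _) (two _) hy hxy
      · intro v hv; have := cov x v hv; tauto
      · intro v hv; have := cov y v hv; tauto
    obtain ⟨x, hx, y, hy, z, hz, hxy, hxz, hyz⟩ := Finset.two_lt_card.1 (show 2 < (({a, b} ∪ C)ᶜ).card by omega)
    have aC : a ∉ C := Finset.disjoint_left.1 dSC (by simp)
    have bC : b ∉ C := Finset.disjoint_left.1 dSC (by simp)
    obtain ⟨u, hu, hzu⟩ := att z hz
    have lx := hl x hx
    have ly := hl y hy
    have lz := hl z hz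
    have ax := att x hx
    have ay := att y hy
    simp only [Finset.mem_compl, Finset.mem_union, not_or] at hx hy hz
    exact hT.k33.two (a := a) (b := b) (x := x) (y := y) (C := C) (D := {z}) hab hxy hconn (connSet_singleton _)
      (by simpa using hz.2) aC bC hx.2 hy.2 (by simpa using lz.1.ne) (by simpa using lz.2.ne)
      (by simpa using hxz) (by simpa using hyz) (R.le lx.1) (R.le ly.1) (R.le lx.2) (R.le ly.2)
      ⟨z, rfl, R.le lz.1⟩ ⟨z, rfl, R.le lz.2⟩ ax ay ⟨u, hu, z, rfl, hzu.symm⟩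
  · have hne : (C : Set V).Nonempty := by
      have : C.Nonempty := Finset.card_pos.1 (by omega)
      exact this
    have : ∃ A : Set V, A ⊆ C ∧ A.Nonempty ∧ A ≠ C ∧ ∀ u ∈ A, ∀ v ∈ (C : Set V) \ A, ¬ T.Adj u v := by
      by_contra hcon
      push Not at hcon
      exact hconn ⟨hne, hcon⟩
    obtain ⟨A, hAC, hA0, hA1, hA2⟩ := this
    obtain ⟨B, rfl⟩ : ∃ B : Finset V, (B : Set V) = A := ⟨A.toFinset, by simp⟩
    have hBC : B ⊆ C := by exact_mod_cast hAC
    have hc := Finset.card_sdiff_of_subset hBC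
    rcases Nat.lt_or_ge 2 B.card with h | h
    · refine x5_split R hT hS hC dSC (A := C \ B) Finset.sdiff_subset ?_ (by omega) ?_ cov
      · rw [Finset.sdiff_nonempty]
        intro h; exact hA1 (by rw [Finset.Subset.antisymm hBC h])
      · intro u hu v hv hvA huv
        simp only [Finset.mem_sdiff, not_and, not_not] at hu hvA
        exact hA2 v (hvA hv) u (by simp [hu]) (R.le huv.symm)
    · refine x5_split R hT hS hC dSC (A := B) hBC (by exact_mod_cast hA0) h ?_ cov
      intro u hu v hv hvA huv
      exact hA2 u hu v (by simp [hv, hvA]) (R.le huv)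
end

section
open Set
set_option linter.all false

variable {V : Type*} [Fintype V] [DecidableEq V] {T G : SimpleGraph V} {c : Sym2 V → ℕ}

lemma CRep.noM (R : CRep T G c) : ¬ ∃ M : Finset (Sym2 V), IsMatchingOfSize G M 5 := by
  rintro ⟨M, h1, h2, h3⟩
  refine R.no ⟨M, ⟨h1, h2.trans (SimpleGraph.edgeSet_mono R.le), h3⟩, R.inj.mono h2⟩

theorem CRep.cover4 (R : CRep T G c) (hT : PT T) : Cover4 G := by
  classical
  have hn := hT.hn
  have hbig := R.big
  obtain ⟨S, Pt, hTB⟩ := tutte_berge G 4 (by omega) R.noM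
  obtain ⟨h1, h2, h3, h4⟩ := id hTB
  have h5 := hTB.card_parts
  have hk5 := K5Free.mono R.le hT.k5
  have empt : Pt.card = 0 → ∀ u v, G.Adj u v → u ∈ S ∨ v ∈ S := by
    intro h0 u v huv
    rw [Finset.card_eq_zero] at h0
    have := h3 u v huv
    simpa [h0] using this
  have easy : Pt.card = 0 → Cover4 G := fun h => ⟨S, by omega, empt h⟩
  have one : Pt.card = 1 → ∃ P : Finset V, 3 ≤ P.card ∧ Odd P.card ∧ Disjoint S P ∧ S.card + P.card / 2 ≤ 4 ∧
      ∀ u v, G.Adj u v → u ∈ S ∨ v ∈ S ∨ (u ∈ P ∧ v ∈ P) := by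
    intro h
    obtain ⟨P, rfl⟩ := Finset.card_eq_one.1 h
    obtain ⟨a1, a2, a3⟩ := h1 P (by simp)
    refine ⟨P, a1, a2, a3, by simpa using h4, fun u v huv => ?_⟩
    simpa using h3 u v huv
  rcases Nat.lt_or_ge Pt.card 1 with h | h
  · exact easy (by omega)
  have hs : S.card ≤ 3 := by omega
  have hsplit := cnt_compl (G := G) S
  have hrest := hTB.rest_le Sᶜ disjoint_compl_left
  have hparts := hTB.parts_le hT.k5 R.le Sᶜ
  have hSS := cnt_self_le (G := G) S
  have hSc := cnt_le_mul (G := G) S Sᶜ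
  have hcc := Finset.card_add_card_compl S
  obtain hs3 | hs2 | hs1 | hs0 : S.card = 3 ∨ S.card = 2 ∨ S.card = 1 ∨ S.card = 0 := by omega
  · obtain ⟨P, p1, p2, p3, p4, p5⟩ := one (by omega)
    exact x3 R hT hs3 (by omega) p3 p5
  · rcases Nat.lt_or_ge Pt.card 2 with h' | h'
    · obtain ⟨P, p1, p2, p3, p4, p5⟩ := one (by omega)
      obtain ⟨k, hk⟩ := p2
      by_cases hP : P.card = 5
      · exact x5 R hT hs2 hP p3 p5
      · have hP3 : P.card = 3 := by omega
        obtain ⟨x, y, z, hxy, hxz, hyz, rfl⟩ := Finset.card_eq_three.1 hP3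
        refine ⟨S ∪ {x, y}, (Finset.card_union_le _ _).trans (by rw [Finset.card_pair hxy]; omega), ?_⟩
        intro u v huv
        have := p5 u v huv
        have := huv.ne
        simp only [Finset.mem_union, Finset.mem_insert, Finset.mem_singleton] at *
        grind
    · obtain ⟨P, Q, hPQ, rfl⟩ := Finset.card_eq_two.1 (show Pt.card = 2 by omega)
      rw [Finset.sum_pair hPQ] at h4
      obtain ⟨a1, a2, a3⟩ := h1 P (by simp)
      obtain ⟨b1, b2, b3⟩ := h1 Q (by simp)
      refine x33 R hT hs2 (C := P) (D := Q) ?_ ?_ a3 b3 (h2 P (by simp) Q (by simp) hPQ) ?_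
      · omega
      · omega
      · intro u v huv; simpa using h3 u v huv
  · exfalso
    rw [hs1] at hSS hSc hcc
    rcases Nat.lt_or_ge Pt.card 2 with h' | h'
    · obtain ⟨P, p1, p2, p3, p4, p5⟩ := one (by omega)
      obtain ⟨e1, e2⟩ := cover_count p3 p5
      have e3 := mader hk5 (S ∪ P) (by rw [Finset.card_union_of_disjoint p3]; omega)
      rw [Finset.card_union_of_disjoint p3] at e3
      have e4 := cnt_le_mul (G := G) S (S ∪ P)ᶜ
      rw [hs1] at e4
      omega
    · omega
  · exfalso
    rw [hs0] at hSS hSc hcc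
    omega
end

section
open Set
set_option linter.all false

section
variable {V : Type*} [Fintype V] [DecidableEq V] {T G : SimpleGraph V} {c : Sym2 V → ℕ}

lemma ConnSet.split {Z : Set V} (hZ : ConnSet T Z) {p q : V} (hp : p ∈ Z) (hq : q ∈ Z) (hpq : p ≠ q) :
    ∃ B : Set V, B ⊆ Z ∧ p ∉ B ∧ q ∈ B ∧ ConnSet T B ∧ ∃ v ∈ B, T.Adj p v := by
  have hfin : {B : Set V | B ⊆ Z ∧ p ∉ B ∧ q ∈ B ∧ ConnSet T B}.Finite := Set.toFinite _
  obtain ⟨B, hB⟩ := hfin.exists_maximal ⟨{q}, by simpa using hq, by simpa using hpq, rfl, connSet_singleton _⟩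
  obtain ⟨⟨h1, h2, h3, h4⟩, hmax⟩ := hB
  refine ⟨B, h1, h2, h3, h4, ?_⟩
  obtain ⟨u, hu, v, hv, huv⟩ := hZ.2 B h1 ⟨q, h3⟩ (fun h => h2 (h ▸ hp))
  by_cases hvp : v = p
  · exact ⟨u, hu, hvp ▸ huv.symm⟩
  · exfalso
    have : Insert.insert v B ⊆ B := hmax ⟨?_, ?_, ?_, ?_⟩ (Set.subset_insert _ _)
    · exact hv.2 (this (Set.mem_insert _ _))
    · exact Set.insert_subset hv.1 h1
    · simp only [Set.mem_insert_iff, not_or]; exact ⟨fun h => hvp h.symm, h2⟩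
    · exact Set.mem_insert_of_mem _ h3
    · exact h4.insert hu huv.symm

/-- an extremal triple of vertices -/
structure ExtT (T : SimpleGraph V) (I : Finset V) (p q : V) : Prop where
  card : I.card = 3
  adj : ∀ u ∈ I, ∀ v ∈ I, u ≠ v → T.Adj u v
  pI : p ∉ I
  qI : q ∉ I
  pq : p ≠ q
  pf : ∀ u ∈ I, T.Adj p u
  qf : ∀ u ∈ I, T.Adj q u
  low : ∀ w, w ∉ I → w ≠ p → w ≠ q → ∃ m ∈ I, ¬ T.Adj w m ∧ ∀ u ∈ I, u ≠ m → T.Adj w u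
  rest : cnt T Iᶜ Iᶜ + 10 = 2 * Fintype.card V

namespace ExtT
variable {I : Finset V} {p q : V}

lemma symm (E : ExtT T I p q) : ExtT T I q p :=
  ⟨E.card, E.adj, E.qI, E.pI, E.pq.symm, E.qf, E.pf, fun w h1 h2 h3 => E.low w h1 h3 h2, E.rest⟩

lemma other (E : ExtT T I p q) {m : V} (hm : m ∈ I) : ∃ u ∈ I, ∃ v ∈ I, u ≠ m ∧ v ≠ m ∧ u ≠ v ∧ T.Adj u v ∧ I = {m, u, v} :=
  IsTri.other ⟨E.card, E.adj⟩ hm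

lemma s1 (E : ExtT T I p q) (hT : PT T) {Z : Set V} (hZ : ConnSet T Z) (hI : ∀ z ∈ Z, z ∉ I)
    (hp : p ∈ Z) (hq : q ∈ Z) : False := by
  obtain ⟨B, h1, h2, h3, h4, v, hv, hpv⟩ := hZ.split hp hq E.pq
  obtain ⟨a, b, d, hab, had, hbd, rfl⟩ := Finset.card_eq_three.1 E.card
  have E1 := E.adj
  refine hT.k5.two (x := a) (y := b) (z := d) (C := {p}) (D := B) (connSet_singleton _) h4 (by simpa using h2)
    ?_ ?_ ?_ ?_ ?_ ?_ (E1 _ (by simp) _ (by simp) hab) (E1 _ (by simp) _ (by simp) had) (E1 _ (by simp) _ (by simp) hbd)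
    ⟨p, rfl, (E.pf _ (by simp)).symm⟩ ⟨p, rfl, (E.pf _ (by simp)).symm⟩ ⟨p, rfl, (E.pf _ (by simp)).symm⟩
    ⟨q, h3, (E.qf _ (by simp)).symm⟩ ⟨q, h3, (E.qf _ (by simp)).symm⟩ ⟨q, h3, (E.qf _ (by simp)).symm⟩ ⟨p, rfl, v, hv, hpv⟩
  · have := E.pI; simp at this ⊢; tauto
  · have := E.pI; simp at this ⊢; tauto
  · have := E.pI; simp at this ⊢; tauto
  · intro h; exact hI _ (h1 h) (by simp)
  · intro h; exact hI _ (h1 h) (by simp)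
  · intro h; exact hI _ (h1 h) (by simp)

lemma s1' (E : ExtT T I p q) (hT : PT T) {Z : Set V} (hZ : ConnSet T Z) (hI : ∀ z ∈ Z, z ∉ I) {x y : V} (hxy : x ≠ y)
    (hx : x ∈ Z) (hy : y ∈ Z) (hx' : x = p ∨ x = q) (hy' : y = p ∨ y = q) : False := by
  rcases hx' with rfl | rfl <;> rcases hy' with rfl | rfl
  · exact hxy rfl
  · exact E.s1 hT hZ hI hx hy
  · exact E.s1 hT hZ hI hy hx
  · exact hxy rfl

/-- two adjacent vertices outside are not both full -/
lemma s1_edge (E : ExtT T I p q) (hT : PT T) {x y : V} (hx : x ∉ I) (hy : y ∉ I) (h : T.Adj x y)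
    (hx' : x = p ∨ x = q) : y ≠ p ∧ y ≠ q := by
  by_contra hcon
  refine E.s1' hT (connSet_pair h) ?_ h.ne (by simp) (by simp) hx' (by tauto)
  simp; exact ⟨hx, hy⟩

lemma adj_type (E : ExtT T I p q) (hT : PT T) {w w' m : V} (hw : w ∉ I) (hw' : w' ∉ I) (h : T.Adj w w')
    (hm : m ∈ I) (hwm : ¬ T.Adj w m) : ∀ u ∈ I, u ≠ m → T.Adj w' u := by
  have wp : w ≠ p := by rintro rfl; exact hwm (E.pf _ hm)
  have wq : w ≠ q := by rintro rfl; exact hwm (E.qf _ hm)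
  by_cases h1 : w' = p
  · subst h1; exact fun u hu _ => E.pf u hu
  by_cases h2 : w' = q
  · subst h2; exact fun u hu _ => E.qf u hu
  obtain ⟨m', hm', k1, k2⟩ := E.low w' hw' h1 h2
  by_cases hmm : m' = m
  · subst hmm; exact k2
  exfalso
  obtain ⟨m0, hm0, l1, l2⟩ := E.low w hw wp wq
  have : m = m0 := by by_contra hne; exact hwm (l2 m hm hne)
  subst this
  have hx : ∀ u ∈ I, ∃ v ∈ ({w, w'} : Set V), T.Adj u v := by
    intro u hu
    by_cases hum : u = m
    · exact ⟨w', by simp, (k2 u hu (fun h => hmm (h.symm.trans hum))).symm⟩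
    · exact ⟨w, by simp, (l2 u hu hum).symm⟩
  obtain ⟨a, b, d, hab, had, hbd, rfl⟩ := Finset.card_eq_three.1 E.card
  have pI := E.pI
  have qI := E.qI
  simp only [Finset.mem_insert, Finset.mem_singleton, not_or] at hw hw' pI qI
  obtain ⟨v, hv, hdv⟩ := hx d (by simp)
  refine hT.k33.two (a := a) (b := b) (x := p) (y := q) (C := {d}) (D := {w, w'}) hab E.pq (connSet_singleton _) (connSet_pair h)
    ?_ ?_ ?_ ?_ ?_ ?_ ?_ ?_ ?_ (E.pf _ (by simp)).symm (E.qf _ (by simp)).symm (E.pf _ (by simp)).symm (E.qf _ (by simp)).symm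
    (hx a (by simp)) (hx b (by simp)) ⟨d, rfl, E.pf _ (by simp)⟩ ⟨d, rfl, E.qf _ (by simp)⟩ ⟨d, rfl, v, hv, hdv⟩
  all_goals simp only [Set.mem_insert_iff, Set.mem_singleton_iff, Set.disjoint_singleton_left]
  all_goals grind

lemma deg_low (E : ExtT T I p q) (hT : PT T) {w : V} (hw : w ∉ I) (wp : w ≠ p) (wq : w ≠ q) :
    cnt T {w} Iᶜ ≤ 2 := by
  classical
  by_contra hcon
  rw [cnt_single_card] at hcon
  obtain ⟨x, hx, y, hy, z, hz, hxy, hxz, hyz⟩ := Finset.two_lt_card.1 (not_le.1 hcon)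
  simp only [Finset.mem_filter, Finset.mem_compl] at hx hy hz
  obtain ⟨m, hm, k1, k2⟩ := E.low w hw wp wq
  obtain ⟨u, hu, v, hv, hum, hvm, huv, -, -⟩ := E.other hm
  have tx := E.adj_type hT hw hx.1 hx.2 hm k1
  have ty := E.adj_type hT hw hy.1 hy.2 hm k1
  have tz := E.adj_type hT hw hz.1 hz.2 hm k1
  exact hT.k33.points (a := u) (b := v) (c := w) huv (by grind) (by grind) hxy hxz hyz (tx u hu hum).symm (ty u hu hum).symm
    (tz u hu hum).symm (tx v hv hvm).symm (ty v hv hvm).symm (tz v hv hvm).symm hx.2 hy.2 hz.2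

lemma deg_p (E : ExtT T I p q) (hT : PT T) : cnt T {p} Iᶜ ≤ 3 := by
  classical
  rw [cnt_single_card, ← E.card]
  have key : ∀ x ∈ Iᶜ.filter (fun b => T.Adj p b), ∃ m ∈ I, ¬ T.Adj x m ∧ ∀ u ∈ I, u ≠ m → T.Adj x u := by
    intro x hx
    simp only [Finset.mem_filter, Finset.mem_compl] at hx
    exact E.low x hx.1 hx.2.ne.symm (E.s1_edge hT E.pI hx.1 hx.2 (Or.inl rfl)).2
  choose! f hf using key
  refine Finset.card_le_card_of_injOn f (fun x hx => (hf x hx).1) ?_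
  intro x hx y hy hxy
  by_contra hne
  have fx := hf x hx
  have fy := hf y hy
  rw [← hxy] at fy
  simp only [Finset.coe_filter, Finset.mem_compl, Set.mem_setOf_eq] at hx hy
  obtain ⟨u, hu, v, hv, hum, hvm, huv, -, -⟩ := E.other fx.1
  have pI := E.pI
  exact hT.k33.points (a := u) (b := v) (c := p) (x := x) (y := y) (z := f x) huv (by grind) (by grind) hne (by grind) (by grind)
    (fx.2.2 u hu hum).symm (fy.2.2 u hu hum).symm (E.adj _ hu _ fx.1 hum)
    (fx.2.2 v hv hvm).symm (fy.2.2 v hv hvm).symm (E.adj _ hv _ fx.1 hvm) hx.2 hy.2 (E.pf _ fx.1)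

lemma deg_le (E : ExtT T I p q) (hT : PT T) {w : V} (hw : w ∉ I) : cnt T {w} Iᶜ ≤ 3 := by
  by_cases h1 : w = p
  · subst h1; exact E.deg_p hT
  by_cases h2 : w = q
  · subst h2; exact E.symm.deg_p hT
  have := E.deg_low hT hw h1 h2
  omega

lemma no_K5 (E : ExtT T I p q) (hT : PT T) {m x y : V} {Z : Set V} (hZ : ConnSet T Z) (hm : m ∈ I)
    (hx : x ∉ I) (hy : y ∉ I) (hI : ∀ z ∈ Z, z ∉ I) (xZ : x ∉ Z) (yZ : y ∉ Z) (hxy : T.Adj x y)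
    (tx : ∀ u ∈ I, u ≠ m → T.Adj x u) (ty : ∀ u ∈ I, u ≠ m → T.Adj y u)
    (tz : ∃ z ∈ Z, ∀ u ∈ I, u ≠ m → T.Adj z u) (hxz : ∃ z ∈ Z, T.Adj x z) (hyz : ∃ z ∈ Z, T.Adj y z) : False := by
  obtain ⟨u, hu, v, hv, hum, hvm, huv, huv', -⟩ := E.other hm
  obtain ⟨z, hz, tz⟩ := tz
  obtain ⟨z', hz', hyz'⟩ := hyz
  refine hT.k5.two (x := u) (y := v) (z := x) (C := {y}) (D := Z) (connSet_singleton _) hZ (by simpa using yZ)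
    (by simp; grind) (by simp; grind) (by simpa using hxy.ne) (fun h => hI _ h hu) (fun h => hI _ h hv) xZ
    huv' (tx u hu hum).symm (tx v hv hvm).symm ⟨y, rfl, (ty u hu hum).symm⟩ ⟨y, rfl, (ty v hv hvm).symm⟩ ⟨y, rfl, hxy⟩
    ⟨z, hz, (tz u hu hum).symm⟩ ⟨z, hz, (tz v hv hvm).symm⟩ hxz ⟨y, rfl, z', hz', hyz'⟩

lemma no_tri (E : ExtT T I p q) (hT : PT T) {x y z : V} (hx : x ∉ I) (hy : y ∉ I) (hz : z ∉ I)
    (xy : T.Adj x y) (xz : T.Adj x z) (yz : T.Adj y z) : False := by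
  have key : ∀ x y z, x ∉ I → y ∉ I → z ∉ I → T.Adj x y → T.Adj x z → T.Adj y z → x ≠ p → x ≠ q → False := by
    intro x y z hx hy hz xy xz yz xp xq
    obtain ⟨m, hm, k1, k2⟩ := E.low x hx xp xq
    exact E.no_K5 hT (connSet_singleton z) hm hx hy (by simpa using hz) (by simpa using xz.ne) (by simpa using yz.ne) xy
      k2 (E.adj_type hT hx hy xy hm k1) ⟨z, rfl, E.adj_type hT hx hz xz hm k1⟩ ⟨z, rfl, xz⟩ ⟨z, rfl, yz⟩
  by_cases h : x = p ∨ x = q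
  · have := E.s1_edge hT hx hy xy h
    exact key y x z hy hx hz xy.symm yz xz this.1 this.2
  · exact key x y z hx hy hz xy xz yz (by tauto) (by tauto)

lemma no_four (E : ExtT T I p q) (hT : PT T) {x y z w : V} (hx : x ∉ I) (hy : y ∉ I) (hz : z ∉ I) (hw : w ∉ I)
    (xy : T.Adj x y) (yz : T.Adj y z) (zw : T.Adj z w) (wx : T.Adj w x) (hxz : x ≠ z) (hyw : y ≠ w) : False := by
  -- x nonfull and y nonfull
  have key : ∀ x y z w, x ∉ I → y ∉ I → z ∉ I → w ∉ I → T.Adj x y → T.Adj y z → T.Adj z w → T.Adj w x → x ≠ z → y ≠ w →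
      x ≠ p → x ≠ q → y ≠ p → y ≠ q → False := by
    intro x y z w hx hy hz hw xy yz zw wx hxz hyw xp xq yp yq
    obtain ⟨m, hm, k1, k2⟩ := E.low x hx xp xq
    have ty := E.adj_type hT hx hy xy hm k1
    have tw := E.adj_type hT hx hw wx.symm hm k1
    obtain ⟨m', hm', l1, l2⟩ := E.low y hy yp yq
    have : m' = m := by by_contra hne; exact l1 (ty _ hm' hne)
    subst this
    have tz := E.adj_type hT hy hz yz hm l1
    exact E.no_K5 hT (connSet_pair xy) hm hz hw (by simp [hx, hy]) (by simp [hxz.symm, yz.ne.symm]) (by simp [wx.ne, hyw.symm])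
      zw tz tw ⟨x, by simp, k2⟩ ⟨y, by simp, yz.symm⟩ ⟨x, by simp, wx⟩
  by_cases h1 : x = p ∨ x = q
  · have hy' := E.s1_edge hT hx hy xy h1
    have hz' : z ≠ p ∧ z ≠ q := by
      by_contra hcon
      refine E.s1' hT ((connSet_pair xy).insert (u := z) (v := y) (by simp) yz.symm) (x := x) (y := z) ?_ hxz
        (by simp) (by simp) h1 (by tauto)
      simp [hx, hy, hz]
    exact key y z w x hy hz hw hx yz zw wx xy hyw hxz.symm hy'.1 hy'.2 hz'.1 hz'.2
  · by_cases h2 : y = p ∨ y = q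
    · have hw' : w ≠ p ∧ w ≠ q := by
        by_contra hcon
        refine E.s1' hT ((connSet_pair xy).insert (u := w) (v := x) (by simp) wx) (x := y) (y := w) ?_ hyw
          (by simp) (by simp) h2 (by tauto)
        simp [hx, hy, hw]
      exact key w x y z hw hx hy hz wx xy yz zw hyw.symm hxz hw'.1 hw'.2 (by tauto) (by tauto)
    · exact key x y z w hx hy hz hw xy yz zw wx hxz hyw (by tauto) (by tauto) (by tauto) (by tauto)

end ExtT
end
end

section
open Set
set_option linter.all false

section
variable {V : Type*} [Fintype V] [DecidableEq V] {T G : SimpleGraph V} {c : Sym2 V → ℕ}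

lemma Cover4.exact (h : Cover4 G) (hn : 4 ≤ Fintype.card V) :
    ∃ S : Finset V, S.card = 4 ∧ ∀ u v, G.Adj u v → u ∈ S ∨ v ∈ S := by
  obtain ⟨S, hS, hc⟩ := h
  obtain ⟨S', h1, h2⟩ := Finset.exists_superset_card_eq (n := 4) hS hn
  exact ⟨S', h2, fun u v huv => (hc u v huv).imp (fun h => h1 h) (fun h => h1 h)⟩

/-- exchanging the representative of a colour -/
lemma CRep.swap (R : CRep T G c) (hT : PT T) {x y : V} (hxy : T.Adj x y) (hG : ¬ G.Adj x y) :
    ∃ S : Finset V, S.card = 4 ∧ (x ∈ S ∨ y ∈ S) ∧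
      ∀ u v, (Gd G c (c s(x, y))).Adj u v → u ∈ S ∨ v ∈ S := by
  set k := c s(x, y) with hk
  let H : SimpleGraph V := Gd G c k ⊔ SimpleGraph.fromEdgeSet {s(x, y)}
  have hH : H.edgeSet = Insert.insert s(x, y) (Gd G c k).edgeSet := by
    simp only [H, SimpleGraph.edgeSet_sup, SimpleGraph.edgeSet_fromEdgeSet]
    ext e
    simp only [Set.mem_union, Set.mem_diff, Set.mem_insert_iff, Set.mem_singleton_iff]
    constructor
    · tauto
    · rintro (rfl | h)
      · right; refine ⟨rfl, ?_⟩
        simpa using hxy.ne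
      · exact Or.inl h
  have hHa : ∀ u v, H.Adj u v ↔ s(u, v) = s(x, y) ∨ (Gd G c k).Adj u v := by
    intro u v
    rw [← SimpleGraph.mem_edgeSet, hH]; rfl
  have hcol : ∀ e ∈ (Gd G c k).edgeSet, e ∈ G.edgeSet ∧ c e ≠ k := by
    intro e he
    induction e using Sym2.ind with
    | _ u v => exact he
  have RH : CRep T H c := by
    refine ⟨?_, ?_, ?_, ?_, R.no⟩
    · intro u v huv
      rcases (hHa u v).1 huv with h | h
      · rw [← SimpleGraph.mem_edgeSet, h]; exact hxy
      · exact R.le h.1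
    · rw [hH]
      intro e he e' he' hee
      rcases he with rfl | he <;> rcases he' with rfl | he'
      · rfl
      · exact absurd hee.symm (hcol _ he').2
      · exact absurd hee (hcol _ he).2
      · exact R.inj (hcol _ he).1 (hcol _ he').1 hee
    · intro u v huv
      by_cases h : c s(u, v) = k
      · exact ⟨x, y, (hHa x y).2 (Or.inl rfl), h.symm⟩
      · obtain ⟨a, b, h1, h2⟩ := R.surj u v huv
        exact ⟨a, b, (hHa a b).2 (Or.inr ⟨h1, by rwa [h2]⟩), h2⟩
    · have h1 := R.cnt_Gd k
      have h2 := R.big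
      rw [← two_mul_edges] at h1 h2 ⊢
      rw [← two_mul_edges] at h1
      rw [hH, Set.ncard_insert_of_notMem]
      · omega
      · intro h; exact hG (hcol _ h).1
  obtain ⟨S, h1, h2⟩ := (RH.cover4 hT).exact (by have := hT.hn; omega)
  exact ⟨S, h1, h2 x y ((hHa x y).2 (Or.inl rfl)), fun u v h => h2 u v ((hHa u v).2 (Or.inr h))⟩

lemma cnt_bip {A B W : Finset V} (h : ∀ u ∈ W, ∀ v ∈ W, G.Adj u v → (u ∈ A ∧ v ∈ B) ∨ (u ∈ B ∧ v ∈ A)) :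
    cnt G W W ≤ 2 * cnt G A B := by
  have e1 : cnt G W W ≤ ∑ u ∈ Finset.univ, ∑ v ∈ Finset.univ,
      ((if u ∈ A ∧ v ∈ B then ad G u v else 0) + (if u ∈ B ∧ v ∈ A then ad G u v else 0)) := by
    refine le_trans (Finset.sum_le_sum (fun u hu => ?_)) (Finset.sum_le_sum_of_subset (Finset.subset_univ W))
    refine le_trans (Finset.sum_le_sum (fun v hv => ?_)) (Finset.sum_le_sum_of_subset (Finset.subset_univ W))
    by_cases huv : G.Adj u v
    · rcases h u hu v hv huv with h | h
      · simp [h]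
      · simp [h]
    · rw [ad_zero.2 huv]; omega
  have e2 : ∀ A B : Finset V, (∑ u ∈ Finset.univ, ∑ v ∈ Finset.univ, (if u ∈ A ∧ v ∈ B then ad G u v else 0)) = cnt G A B := by
    intro A B
    simp only [ite_and, cnt]
    rw [← Finset.sum_filter_add_sum_filter_not Finset.univ (fun u => u ∈ A)]
    rw [Finset.sum_eq_zero (s := Finset.filter (fun u => ¬ u ∈ A) Finset.univ)]
    · simp only [Finset.filter_univ_mem, add_zero]
      refine Finset.sum_congr rfl (fun u hu => ?_)
      simp [hu]
    · intro u hu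
      simp only [Finset.mem_filter] at hu
      simp [hu.2]
  simp only [Finset.sum_add_distrib] at e1
  rw [e2, e2, cnt_comm B A] at e1
  omega

/-- record for a cross edge, first type -/
structure Alpha (T G : SimpleGraph V) (c : Sym2 V → ℕ) (S : Finset V) (x y d t z : V) : Prop where
  dS : d ∈ S
  tS : t ∉ S
  zS : z ∉ S
  tz : t ≠ z
  te : t = x ∨ t = y
  dt : G.Adj d t
  dz : G.Adj d z
  col : c s(x, y) = c s(d, z)
  only : ∀ v, v ∉ S → G.Adj d v → v = t ∨ v = z
  ext : ∃ p q, ExtT T (S.erase d) p q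
  full : ∀ u ∈ S.erase d, ∀ v, T.Adj u v → G.Adj u v
  tot : cnt G Finset.univ Finset.univ = 4 * Fintype.card V + 2

/-- record for a cross edge, second type -/
structure Beta (G : SimpleGraph V) (S : Finset V) (x y a b d e t r : V) : Prop where
  Sd : S = {a, b, d, e}
  ab : a ≠ b
  de : d ≠ e
  da : d ≠ a
  db : d ≠ b
  ea : e ≠ a
  eb : e ≠ b
  tS : t ∉ S
  rS : r ∉ S
  tr : t ≠ r
  fa : ∀ v, v ≠ a → G.Adj a v
  fb : ∀ v, v ≠ b → G.Adj b v
  dt : G.Adj d t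
  et : G.Adj e t
  dr : G.Adj d r
  touch : x = t ∨ x = r ∨ y = t ∨ y = r

lemma cnt_six {I : Finset V} (hI : I.card = 3) (h : 6 ≤ cnt T I I) : ∀ u ∈ I, ∀ v ∈ I, u ≠ v → T.Adj u v := by
  obtain ⟨a, b, d, hab, had, hbd, rfl⟩ := Finset.card_eq_three.1 hI
  rw [cnt_self_three hab had hbd] at h
  have h1 := ad_le (G := T) a b
  have h2 := ad_le (G := T) a d
  have h3 := ad_le (G := T) b d
  have k1 : T.Adj a b := by by_contra hc; have := ad_zero.2 hc; omega
  have k2 : T.Adj a d := by by_contra hc; have := ad_zero.2 hc; omega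
  have k3 : T.Adj b d := by by_contra hc; have := ad_zero.2 hc; omega
  intro u hu v hv huv
  simp only [Finset.mem_insert, Finset.mem_singleton] at hu hv
  rcases hu with rfl | rfl | rfl <;> rcases hv with rfl | rfl | rfl <;>
    first | (exact absurd rfl huv) | assumption | (apply SimpleGraph.Adj.symm; assumption)

lemma alpha_of (R : CRep T G c) (hT : PT T) {S S' : Finset V} {x y : V} (hS : S.card = 4) (hS' : S'.card = 4)
    (cov : ∀ u v, G.Adj u v → u ∈ S ∨ v ∈ S) (cov' : ∀ u v, (Gd G c (c s(x, y))).Adj u v → u ∈ S' ∨ v ∈ S')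
    (hx : x ∉ S) (hy : y ∉ S) (hxy : T.Adj x y) (hm : x ∈ S' ∨ y ∈ S') (hI : (S ∩ S').card = 3) :
    ∃ d t z, Alpha T G c S x y d t z := by
  classical
  set k := c s(x, y) with hk
  set I := S ∩ S' with hId
  have c1 : (S \ S').card = 1 := by have := Finset.card_sdiff_add_card_inter S S'; rw [← hId] at this; omega
  have c2 : (S' \ S).card = 1 := by
    have := Finset.card_sdiff_add_card_inter S' S; rw [Finset.inter_comm, ← hId] at this; omega
  obtain ⟨d, hd⟩ := Finset.card_eq_one.1 c1
  obtain ⟨t, ht⟩ := Finset.card_eq_one.1 c2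
  have mS : ∀ u, u ∈ S ↔ u ∈ I ∨ u = d := by
    intro u
    have := Finset.ext_iff.1 hd u
    simp only [Finset.mem_sdiff, Finset.mem_singleton] at this
    simp only [hId, Finset.mem_inter]; tauto
  have mS' : ∀ u, u ∈ S' ↔ u ∈ I ∨ u = t := by
    intro u
    have := Finset.ext_iff.1 ht u
    simp only [Finset.mem_sdiff, Finset.mem_singleton] at this
    simp only [hId, Finset.mem_inter]; tauto
  have dS : d ∈ S ∧ d ∉ S' := by have : d ∈ S \ S' := by simp [hd]
                                 simpa using this
  have tS : t ∈ S' ∧ t ∉ S := by have : t ∈ S' \ S := by simp [ht]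
                                 simpa using this
  have hle : Gd G c k ≤ T := (Gd_le k).trans R.le
  have sub : cnt (Gd G c k) Iᶜ Iᶜ ≤ 2 * cnt (Gd G c k) {d} {t} := by
    apply cnt_bip
    intro u hu v hv huv
    have h1 := cov u v huv.1
    have h2 := cov' u v huv
    rw [mS, mS] at h1; rw [mS', mS'] at h2
    simp only [Finset.mem_compl] at hu hv
    simp only [Finset.mem_singleton]
    have hne := huv.ne
    grind
  rw [cnt_singleton] at sub
  have sub' := ad_le (G := Gd G c k) d t
  obtain ⟨a, b, e, hab, hae, hbe, hIe⟩ := Finset.card_eq_three.1 hI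
  have g1 := cnt_self_le (G := Gd G c k) I
  have t1 := cnt_self_le (G := T) I
  have m1 := cnt_mono hle I I
  have t2 := cnt_triple_sum_le (T := T) hab hae hbe Iᶜ
  have t3 := full_card_le hT.k33 hab hae hbe Iᶜ
  rw [← hIe] at t2
  have m2 := cnt_mono hle I Iᶜ
  have ci := Finset.card_add_card_compl I
  have g2 := R.cnt_Gd k
  have g3 := R.big
  have g4 := cnt_compl (G := Gd G c k) I
  have t4 := cnt_compl (G := T) I
  have t5 := hT.edges
  have hn := hT.hn
  rw [hI] at g1 t1 ci
  have adt : (Gd G c k).Adj d t := by by_contra hc; have := ad_zero.2 hc; omega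
  have hfullc : (fullSet T a b e Iᶜ).card = 2 := by omega
  have fullH : ∀ u ∈ I, ∀ v, T.Adj u v → (Gd G c k).Adj u v := by
    intro u hu v huv
    by_cases hv : v ∈ I
    · exact cnt_eq_adj hle (A := I) (B := I) (by omega) hu hv huv
    · exact cnt_eq_adj hle (A := I) (B := Iᶜ) (by omega) hu (by simpa using hv) huv
  have hIer : S.erase d = I := by
    ext u; rw [Finset.mem_erase, mS]
    have : d ∉ I := by rw [hId, Finset.mem_inter]; tauto
    constructor
    · tauto
    · intro h; exact ⟨fun h' => this (h' ▸ h), Or.inl h⟩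
  obtain ⟨z, hz1, hz2⟩ : ∃ z, G.Adj d z ∧ c s(d, z) = k := by
    obtain ⟨u, v, h1, h2⟩ := R.surj x y hxy
    rw [← hk] at h2
    have hu : u ∉ I := fun h => (fullH u h v (R.le h1)).2 h2
    have hv : v ∉ I := fun h => (fullH v h u (R.le h1.symm)).2 (by rw [Sym2.eq_swap]; exact h2)
    have := cov u v h1
    rw [mS, mS] at this
    rcases this with (h | rfl) | (h | rfl)
    · exact absurd h hu
    · exact ⟨v, h1, h2⟩
    · exact absurd h hv
    · exact ⟨u, h1.symm, by rw [Sym2.eq_swap]; exact h2⟩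
  have zS : z ∉ S := by
    rw [mS]; rintro (h | rfl)
    · exact (fullH z h d (R.le hz1.symm)).2 (by rw [Sym2.eq_swap]; exact hz2)
    · exact hz1.ne rfl
  obtain ⟨p, q, hpq, hfs⟩ := Finset.card_eq_two.1 hfullc
  refine ⟨d, t, z, dS.1, tS.2, zS, ?_, ?_, adt.1, hz1, hz2.symm, ?_, ⟨p, q, ?_⟩, ?_, by omega⟩
  · rintro rfl; exact adt.2 hz2
  · rcases hm with h | h
    · rw [mS'] at h; rcases h with h | h
      · exact absurd ((mS x).2 (Or.inl h)) hx
      · exact Or.inl h.symm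
    · rw [mS'] at h; rcases h with h | h
      · exact absurd ((mS y).2 (Or.inl h)) hy
      · exact Or.inr h.symm
  · intro v hv hdv
    by_cases hc : c s(d, v) = k
    · right
      have := R.inj hdv hz1 (hc.trans hz2.symm)
      have hne := hz1.ne
      simp only [Sym2.eq_iff] at this
      rcases this with h | h
      · exact h.2
      · exact absurd h.1 hne
    · left
      have := cov' d v ⟨hdv, hc⟩
      rw [mS' v] at this
      rcases this with h | (h | h)
      · exact absurd h dS.2
      · exact absurd ((mS v).2 (Or.inl h)) hv
      · exact h
  · rw [hIer]
    have hp : p ∈ fullSet T a b e Iᶜ := by rw [hfs]; simp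
    have hq : q ∈ fullSet T a b e Iᶜ := by rw [hfs]; simp
    rw [mem_fullSet] at hp hq
    refine ⟨hI, cnt_six hI (by omega), by simpa using hp.1, by simpa using hq.1, hpq, ?_, ?_, ?_, by omega⟩
    · intro u hu; rw [hIe] at hu; simp only [Finset.mem_insert, Finset.mem_singleton] at hu
      rcases hu with rfl | rfl | rfl
      · exact hp.2.1.symm
      · exact hp.2.2.1.symm
      · exact hp.2.2.2.symm
    · intro u hu; rw [hIe] at hu; simp only [Finset.mem_insert, Finset.mem_singleton] at hu
      rcases hu with rfl | rfl | rfl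
      · exact hq.2.1.symm
      · exact hq.2.2.1.symm
      · exact hq.2.2.2.symm
    · intro w hw wp wq
      have tt := (tight_triple hle hab hae hbe (W := Iᶜ) (by rw [← hIe]; omega) (x := w) (by simpa using hw)).2
        (by rw [hfs]; simp [wp, wq])
      have tt2 := cnt_mono hle {w} {a, b, e}
      rw [cnt_single_three w hab hae hbe] at tt tt2
      rw [cnt_single_three w hab hae hbe] at tt tt2
      have h1 := ad_le (G := T) w a
      have h2 := ad_le (G := T) w b
      have h3 := ad_le (G := T) w e
      have ea := fun h : ¬ T.Adj w a => ad_zero.2 h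
      have eb := fun h : ¬ T.Adj w b => ad_zero.2 h
      have ee := fun h : ¬ T.Adj w e => ad_zero.2 h
      have ea' := fun h : T.Adj w a => ad_one.2 h
      have eb' := fun h : T.Adj w b => ad_one.2 h
      have ee' := fun h : T.Adj w e => ad_one.2 h
      rw [hIe]
      simp only [Finset.mem_insert, Finset.mem_singleton, exists_eq_or_imp, exists_eq_left, forall_eq_or_imp, forall_eq]
      by_cases k1 : T.Adj w a <;> by_cases k2 : T.Adj w b <;> by_cases k3 : T.Adj w e <;>
        simp only [k1, k2, k3, not_true, not_false_iff, true_and, false_and, implies_true, forall_true_left, false_or, or_false, true_or, or_true] at * <;> first | omega | simp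
  · rw [hIer]; intro u hu v huv; exact (fullH u hu v huv).1


lemma beta_K33 (hT : PT T) {a b d e t r o : V} (ab : a ≠ b) (de : d ≠ e) (tr : t ≠ r) (da : d ≠ a) (ea : e ≠ a) (ta : t ≠ a) (ra : r ≠ a)
    (db : d ≠ b) (eb : e ≠ b) (tb : t ≠ b) (rb : r ≠ b) (od : o ≠ d) (oe : o ≠ e) (ot : o ≠ t) (or' : o ≠ r)
    (dt : T.Adj d t) (et : T.Adj e t) (dr : T.Adj d r) (er : T.Adj e r)
    (hab : T.Adj a b ∨ (T.Adj a o ∧ T.Adj o b)) (at' : T.Adj a t) (ar : T.Adj a r) (bd : T.Adj b d) (be : T.Adj b e) : False := by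
  by_cases h : T.Adj a b
  · exact hT.k33.points de da ea tr tb rb dt dr bd.symm et er be.symm at' ar h
  · obtain ⟨h1, h2⟩ := hab.resolve_left h
    refine hT.k33.two (a := d) (b := e) (x := t) (y := r) (C := {a, o}) (D := {b}) de tr (connSet_pair h1) (connSet_singleton _) ?_
      ?_ ?_ ?_ ?_ ?_ ?_ ?_ ?_ dt dr et er ⟨b, rfl, bd.symm⟩ ⟨b, rfl, be.symm⟩ ⟨a, by simp, at'.symm⟩ ⟨a, by simp, ar.symm⟩
      ⟨o, by simp, b, rfl, h2⟩
    · simp; exact ⟨ab.symm, fun h => h2.ne h.symm⟩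
    all_goals simp
    all_goals grind

set_option maxHeartbeats 800000 in
lemma beta_of (R : CRep T G c) (hT : PT T) {S S' : Finset V} {x y : V} (hS : S.card = 4) (hS' : S'.card = 4)
    (cov : ∀ u v, G.Adj u v → u ∈ S ∨ v ∈ S) (cov' : ∀ u v, (Gd G c (c s(x, y))).Adj u v → u ∈ S' ∨ v ∈ S')
    (hx : x ∉ S) (hy : y ∉ S) (hxy : T.Adj x y) (hm : x ∈ S' ∨ y ∈ S') (hI : (S ∩ S').card = 2) :
    ∃ a b d e t r, Beta G S x y a b d e t r := by
  classical
  set k := c s(x, y) with hk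
  set I := S ∩ S' with hId
  have c1 : (S \ S').card = 2 := by have := Finset.card_sdiff_add_card_inter S S'; rw [← hId] at this; omega
  have c2 : (S' \ S).card = 2 := by
    have := Finset.card_sdiff_add_card_inter S' S; rw [Finset.inter_comm, ← hId] at this; omega
  obtain ⟨d, e, hde, hd⟩ := Finset.card_eq_two.1 c1
  obtain ⟨t, r, htr, ht⟩ := Finset.card_eq_two.1 c2
  obtain ⟨a, b, hab, hIe⟩ := Finset.card_eq_two.1 hI
  have mI : ∀ u, u ∈ S ∧ u ∈ S' ↔ u = a ∨ u = b := by
    intro u; rw [← Finset.mem_inter, ← hId, hIe]; simp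
  have md : ∀ u, u ∈ S ∧ u ∉ S' ↔ u = d ∨ u = e := by
    intro u; rw [← Finset.mem_sdiff, hd]; simp
  have mt : ∀ u, u ∈ S' ∧ u ∉ S ↔ u = t ∨ u = r := by
    intro u; rw [← Finset.mem_sdiff, ht]; simp
  have ma := (mI a).2 (Or.inl rfl)
  have mb := (mI b).2 (Or.inr rfl)
  have mdd := (md d).2 (Or.inl rfl)
  have mee := (md e).2 (Or.inr rfl)
  have mtt := (mt t).2 (Or.inl rfl)
  have mrr := (mt r).2 (Or.inr rfl)
  have hle : Gd G c k ≤ T := (Gd_le k).trans R.le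
  have sub : cnt (Gd G c k) Iᶜ Iᶜ ≤ 2 * cnt (Gd G c k) {d, e} {t, r} := by
    apply cnt_bip
    intro u hu v hv huv
    have h1 := cov u v huv.1
    have h2 := cov' u v huv
    simp only [Finset.mem_compl, hId, Finset.mem_inter] at hu hv
    simp only [Finset.mem_singleton, Finset.mem_insert]
    rw [← md, ← md, ← mt, ← mt]
    tauto
  have m2 : cnt (Gd G c k) {d, e} {t, r} = ad (Gd G c k) d t + ad (Gd G c k) d r + (ad (Gd G c k) e t + ad (Gd G c k) e r) := by
    rw [cnt_insert_left (by simpa using hde), cnt_single_two _ htr, cnt_single_two _ htr]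
  have i2 : cnt (Gd G c k) I I = 2 * ad (Gd G c k) a b := by rw [hIe, cnt_self_two]
  have l1 := ad_le (G := Gd G c k) a b
  have l2 := ad_le (G := Gd G c k) d t
  have l3 := ad_le (G := Gd G c k) d r
  have l4 := ad_le (G := Gd G c k) e t
  have l5 := ad_le (G := Gd G c k) e r
  have l6 := cnt_le_mul (G := Gd G c k) I Iᶜ
  have ci := Finset.card_add_card_compl I
  have g2 := R.cnt_Gd k
  have g3 := R.big
  have g4 := cnt_compl (G := Gd G c k) I
  have hn := hT.hn
  rw [hI] at ci l6
  by_cases hall : (Gd G c k).Adj d t ∧ (Gd G c k).Adj d r ∧ (Gd G c k).Adj e t ∧ (Gd G c k).Adj e r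
  · exfalso
    obtain ⟨dt, dr, et, er⟩ := hall
    -- a vertex outside
    obtain ⟨o, ho⟩ : ∃ o, o ∉ ({a, b, d, e, t, r} : Finset V) := by
      by_contra hcon
      push Not at hcon
      have : (Finset.univ : Finset V).card ≤ 6 := by
        refine le_trans (Finset.card_le_card (fun o _ => hcon o)) ?_
        exact Finset.card_le_six
      rw [Finset.card_univ] at this; omega
    simp only [Finset.mem_insert, Finset.mem_singleton, not_or] at ho
    obtain ⟨oa, ob, od, oe, ot, or'⟩ := ho
    -- missing pairs
    have miss : ∀ u ∈ I, ∀ v, v ∉ I → ¬ (Gd G c k).Adj u v → (Gd G c k).Adj a b ∧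
        ∀ u' ∈ I, ∀ v', v' ∉ I → (u' ≠ u ∨ v' ≠ v) → (Gd G c k).Adj u' v' := by
      intro u hu v hv huv
      have hv' : v ∈ Iᶜ := by simpa using hv
      have e1 : cnt (Gd G c k) I Iᶜ = cnt (Gd G c k) (I.erase u) Iᶜ + cnt (Gd G c k) {u} (Iᶜ.erase v) := by
        rw [cnt_left_sum, ← Finset.add_sum_erase _ _ hu, ← cnt_left_sum, cnt_single_eq, ← Finset.add_sum_erase _ _ hv',
          ad_zero.2 huv, ← cnt_single_eq]; omega
      have e2 := cnt_le_mul (G := Gd G c k) (I.erase u) Iᶜ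
      have e3 := cnt_le_mul (G := Gd G c k) {u} (Iᶜ.erase v)
      rw [Finset.card_erase_of_mem hu, hI] at e2
      rw [Finset.card_erase_of_mem hv', Finset.card_singleton] at e3
      refine ⟨by by_contra hc; have := ad_zero.2 hc; omega, ?_⟩
      intro u' hu' v' hv' hne
      by_cases huu : u' = u
      · subst huu
        by_contra hc
        have : v' ∈ Iᶜ.erase v := by simp; exact ⟨by tauto, hv'⟩
        have e4 : cnt (Gd G c k) {u'} (Iᶜ.erase v) ≤ ((Iᶜ.erase v).erase v').card := by
          rw [cnt_single_eq, ← Finset.add_sum_erase _ _ this, ad_zero.2 hc, zero_add, ← cnt_single_eq]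
          exact cnt_single_le _ _
        rw [Finset.card_erase_of_mem this, Finset.card_erase_of_mem (by simpa using hv)] at e4
        omega
      · by_contra hc
        have e5 : cnt (Gd G c k) (I.erase u) Iᶜ ≤ (Iᶜ.erase v').card := by
          have h1 : I.erase u = {u'} := by
            have h3 : (I.erase u).card = 1 := by rw [Finset.card_erase_of_mem hu, hI]
            obtain ⟨w, hw⟩ := Finset.card_eq_one.1 h3
            have : u' ∈ I.erase u := by simp [huu, hu']
            rw [hw] at this ⊢; simp at this; rw [this]
          rw [h1, cnt_single_eq, ← Finset.add_sum_erase _ _ (by simpa using hv' : v' ∈ Iᶜ), ad_zero.2 hc, zero_add, ← cnt_single_eq]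
          exact cnt_single_le _ _
        rw [Finset.card_erase_of_mem (by simpa using hv')] at e5
        omega
    have aI : a ∈ I := by simp [hIe]
    have bI : b ∈ I := by simp [hIe]
    have nI : ∀ u, u ∉ I ↔ u ≠ a ∧ u ≠ b := by intro u; simp [hIe]
    have da : d ≠ a := by rintro rfl; exact mdd.2 ma.2
    have db : d ≠ b := by rintro rfl; exact mdd.2 mb.2
    have ea : e ≠ a := by rintro rfl; exact mee.2 ma.2
    have eb : e ≠ b := by rintro rfl; exact mee.2 mb.2
    have ta : t ≠ a := by rintro rfl; exact mtt.2 ma.1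
    have tb : t ≠ b := by rintro rfl; exact mtt.2 mb.1
    have ra : r ≠ a := by rintro rfl; exact mrr.2 ma.1
    have rb : r ≠ b := by rintro rfl; exact mrr.2 mb.1
    have dI := (nI d).2 ⟨da, db⟩
    have eI := (nI e).2 ⟨ea, eb⟩
    have tI := (nI t).2 ⟨ta, tb⟩
    have rI := (nI r).2 ⟨ra, rb⟩
    have oI := (nI o).2 ⟨oa, ob⟩
    have hdt : d ≠ t := by rintro rfl; exact mtt.2 mdd.1
    have hdr : d ≠ r := by rintro rfl; exact mrr.2 mdd.1
    have het : e ≠ t := by rintro rfl; exact mtt.2 mee.1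
    have her : e ≠ r := by rintro rfl; exact mrr.2 mee.1
    by_cases hex : ∃ u ∈ I, ∃ v, v ∉ I ∧ ¬ (Gd G c k).Adj u v
    · obtain ⟨u, hu, v, hv, huv⟩ := hex
      obtain ⟨hab', hx'⟩ := miss u hu v hv huv
      have P : ∀ u' ∈ I, ∀ v', v' ∉ I → (u' ≠ u ∨ v' ≠ v) → T.Adj u' v' := fun u' h1 v' h2 h3 => hle (hx' u' h1 v' h2 h3)
      by_cases hcase : (u = a ∧ (v = t ∨ v = r)) ∨ (u = b ∧ (v = d ∨ v = e))
      · exact beta_K33 hT (a := b) (b := a) (d := d) (e := e) (t := t) (r := r) (o := o) hab.symm hde htr db eb tb rb da ea ta ra od oe ot or'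
          (hle dt) (hle et) (hle dr) (hle er) (Or.inl (hle hab').symm) (P b bI t tI (by grind)) (P b bI r rI (by grind))
          (P a aI d dI (by grind)) (P a aI e eI (by grind))
      · exact beta_K33 hT (a := a) (b := b) (d := d) (e := e) (t := t) (r := r) (o := o) hab hde htr da ea ta ra db eb tb rb od oe ot or'
          (hle dt) (hle et) (hle dr) (hle er) (Or.inl (hle hab')) (P a aI t tI (by grind)) (P a aI r rI (by grind))
          (P b bI d dI (by grind)) (P b bI e eI (by grind))
    · push Not at hex
      have P : ∀ u' ∈ I, ∀ v', v' ∉ I → T.Adj u' v' := fun u' h1 v' h2 => hle (hex u' h1 v' h2)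
      exact beta_K33 hT (a := a) (b := b) (d := d) (e := e) (t := t) (r := r) (o := o) hab hde htr da ea ta ra db eb tb rb od oe ot or'
          (hle dt) (hle et) (hle dr) (hle er) (Or.inr ⟨P a aI o oI, (P b bI o oI).symm⟩) (P a aI t tI) (P a aI r rI)
          (P b bI d dI) (P b bI e eI)
  · -- three edges
    have z0 : ∀ u v, ¬ (Gd G c k).Adj u v → ad (Gd G c k) u v = 0 := fun u v h => ad_zero.2 h
    have hsum : ad (Gd G c k) d t + ad (Gd G c k) d r + (ad (Gd G c k) e t + ad (Gd G c k) e r) ≤ 3 := by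
      by_contra hc
      apply hall
      refine ⟨?_, ?_, ?_, ?_⟩ <;> (by_contra hc'; have := ad_zero.2 hc'; omega)
    have hab' : (Gd G c k).Adj a b := by by_contra hc; have := ad_zero.2 hc; omega
    have tp : ∀ w ∈ Iᶜ, (Gd G c k).Adj a w ∧ (Gd G c k).Adj b w := by
      intro w hw
      exact tight_pair hab (W := Iᶜ) (by rw [← hIe]; omega) hw
    have fa : ∀ v, v ≠ a → G.Adj a v := by
      intro v hv
      by_cases h : v = b
      · subst h; exact hab'.1
      · exact (tp v (by simp [hIe, hv, h])).1.1
    have fb : ∀ v, v ≠ b → G.Adj b v := by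
      intro v hv
      by_cases h : v = a
      · subst h; exact hab'.1.symm
      · exact (tp v (by simp [hIe, hv, h])).2.1
    have Sd : S = {a, b, d, e} := by
      ext u; simp only [Finset.mem_insert, Finset.mem_singleton]
      rw [← md, ← or_assoc, ← mI]
      by_cases h : u ∈ S' <;> simp only [h, true_and, and_true, not_true, not_false_iff, and_false, or_false, false_or]
    have Sd' : S = {a, b, e, d} := by rw [Sd, Finset.pair_comm d e]
    have da : d ≠ a := by rintro rfl; exact mdd.2 ma.2
    have db : d ≠ b := by rintro rfl; exact mdd.2 mb.2
    have ea : e ≠ a := by rintro rfl; exact mee.2 ma.2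
    have eb : e ≠ b := by rintro rfl; exact mee.2 mb.2
    have touch : x = t ∨ x = r ∨ y = t ∨ y = r := by
      rcases hm with h | h
      · rcases (mt x).1 ⟨h, hx⟩ with h | h <;> simp only [h, true_or, or_true]
      · rcases (mt y).1 ⟨h, hy⟩ with h | h <;> simp only [h, true_or, or_true]
    have touch' : x = r ∨ x = t ∨ y = r ∨ y = t := by rcases touch with h | h | h | h <;> simp only [h, true_or, or_true]
    by_cases k1 : (Gd G c k).Adj d t
    · by_cases k2 : (Gd G c k).Adj d r
      · by_cases k3 : (Gd G c k).Adj e t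
        · exact ⟨a, b, d, e, t, r, Sd, hab, hde, da, db, ea, eb, mtt.2, mrr.2, htr, fa, fb, k1.1, k3.1, k2.1, touch⟩
        · have k4 : (Gd G c k).Adj e r := by by_contra hc; have := ad_zero.2 hc; have := ad_zero.2 k3; omega
          exact ⟨a, b, d, e, r, t, Sd, hab, hde, da, db, ea, eb, mrr.2, mtt.2, htr.symm, fa, fb, k2.1, k4.1, k1.1, touch'⟩
      · have k3 : (Gd G c k).Adj e t := by by_contra hc; have := ad_zero.2 hc; have := ad_zero.2 k2; omega
        have k4 : (Gd G c k).Adj e r := by by_contra hc; have := ad_zero.2 hc; have := ad_zero.2 k2; omega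
        exact ⟨a, b, e, d, t, r, Sd', hab, hde.symm, ea, eb, da, db, mtt.2, mrr.2, htr, fa, fb, k3.1, k1.1, k4.1, touch⟩
    · have k2 : (Gd G c k).Adj d r := by by_contra hc; have := ad_zero.2 hc; have := ad_zero.2 k1; omega
      have k3 : (Gd G c k).Adj e t := by by_contra hc; have := ad_zero.2 hc; have := ad_zero.2 k1; omega
      have k4 : (Gd G c k).Adj e r := by by_contra hc; have := ad_zero.2 hc; have := ad_zero.2 k1; omega
      exact ⟨a, b, e, d, r, t, Sd', hab, hde.symm, ea, eb, da, db, mrr.2, mtt.2, htr.symm, fa, fb, k4.1, k2.1, k3.1, touch'⟩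

lemma dich (R : CRep T G c) (hT : PT T) {S : Finset V} {x y : V} (hS : S.card = 4)
    (cov : ∀ u v, G.Adj u v → u ∈ S ∨ v ∈ S) (hx : x ∉ S) (hy : y ∉ S) (hxy : T.Adj x y) :
    (∃ d t z, Alpha T G c S x y d t z) ∨ ∃ a b d e t r, Beta G S x y a b d e t r := by
  classical
  have hG : ¬ G.Adj x y := fun h => by have := cov x y h; tauto
  obtain ⟨S', hS', hm, cov'⟩ := R.swap hT hxy hG
  have hle4 : (S ∩ S').card ≤ 4 := hS ▸ Finset.card_le_card Finset.inter_subset_left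
  have ne4 : (S ∩ S').card ≠ 4 := by
    intro h4
    have h1 : S ∩ S' = S := Finset.eq_of_subset_of_card_le Finset.inter_subset_left (by omega)
    have h2 : S ∩ S' = S' := Finset.eq_of_subset_of_card_le Finset.inter_subset_right (by omega)
    rw [h1] at h2; rw [← h2] at hm; tauto
  by_cases h3 : (S ∩ S').card = 3
  · exact Or.inl (alpha_of R hT hS hS' cov cov' hx hy hxy hm h3)
  by_cases h2 : (S ∩ S').card = 2
  · exact Or.inr (beta_of R hT hS hS' cov cov' hx hy hxy hm h2)
  exfalso
  set k := c s(x, y) with hk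
  have sub : cnt (Gd G c k) (S ∩ S')ᶜ (S ∩ S')ᶜ ≤ 2 * cnt (Gd G c k) (S \ S') (S' \ S) := by
    apply cnt_bip
    intro u hu v hv huv
    have h1 := cov u v huv.1
    have h2 := cov' u v huv
    simp only [Finset.mem_compl, Finset.mem_inter] at hu hv
    simp only [Finset.mem_sdiff]
    tauto
  have l1 := cnt_le_mul (G := Gd G c k) (S \ S') (S' \ S)
  have c1 := Finset.card_sdiff_add_card_inter S S'
  have c2 := Finset.card_sdiff_add_card_inter S' S
  rw [Finset.inter_comm] at c2
  have l6 := cnt_le_mul (G := Gd G c k) (S ∩ S') (S ∩ S')ᶜ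
  have l7 := cnt_self_le (G := Gd G c k) (S ∩ S')
  have ci := Finset.card_add_card_compl (S ∩ S')
  have g2 := R.cnt_Gd k
  have g3 := R.big
  have g4 := cnt_compl (G := Gd G c k) (S ∩ S')
  have hn := hT.hn
  have : (S ∩ S').card = 0 ∨ (S ∩ S').card = 1 := by omega
  rcases this with h | h
  · have e1 : (S \ S').card = 4 := by omega
    have e2 : (S' \ S).card = 4 := by omega
    rw [e1, e2] at l1; rw [h] at l6 l7
    omega
  · have e1 : (S \ S').card = 3 := by omega
    have e2 : (S' \ S).card = 3 := by omega
    rw [e1, e2] at l1; rw [h] at l6 l7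
    omega

end
end

section
open Set
set_option linter.all false

section
variable {V : Type*} [Fintype V] [DecidableEq V] {T G : SimpleGraph V} {c : Sym2 V → ℕ}

lemma prop_four {A B E D : Prop} (k1 : A ∨ B) (k2 : A ∨ E) (k3 : B ∨ E) (k4 : D ∨ A) (k5 : D ∨ B) (k6 : D ∨ E) :
    (A ∧ B ∧ E) ∨ (D ∧ A ∧ B) ∨ (D ∧ B ∧ E) ∨ (D ∧ A ∧ E) := by
  by_cases hA : A <;> by_cases hB : B <;> by_cases hE : E <;> by_cases hD : D <;> simp_all

lemma cross_aux (hT : PT T) {a b e d : V} (hab : a ≠ b) (hae : a ≠ e) (hbe : b ≠ e) (hda : d ≠ a) (hdb : d ≠ b) (hde : d ≠ e)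
    {W : Finset V} (hW : 7 ≤ W.card) (aW : a ∉ W) (bW : b ∉ W) (eW : e ∉ W) (dW : d ∉ W)
    (key : ∀ w ∈ W, ∀ u ∈ ({a, b, e, d} : Finset V), ∀ v ∈ ({a, b, e, d} : Finset V), u ≠ v → T.Adj w u ∨ T.Adj w v)
    (hF : 2 ≤ (fullSet T a b e W).card) : False := by
  classical
  have hF2 := full_card_le hT.k33 hab hae hbe W
  have hsub : W \ fullSet T a b e W ⊆ fullSet T d a b (W \ fullSet T a b e W) ∪ (fullSet T d b e (W \ fullSet T a b e W)
      ∪ fullSet T d a e (W \ fullSet T a b e W)) := by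
    intro w hw
    have hw' := hw
    simp only [Finset.mem_union, mem_fullSet, Finset.mem_sdiff] at hw ⊢
    have k1 := key w hw.1 a (by simp) b (by simp) hab
    have k2 := key w hw.1 a (by simp) e (by simp) hae
    have k3 := key w hw.1 b (by simp) e (by simp) hbe
    have k4 := key w hw.1 d (by simp) a (by simp) hda
    have k5 := key w hw.1 d (by simp) b (by simp) hdb
    have k6 := key w hw.1 d (by simp) e (by simp) hde
    rw [T.adj_comm w a, T.adj_comm w b] at k1
    rw [T.adj_comm w a, T.adj_comm w e] at k2
    rw [T.adj_comm w b, T.adj_comm w e] at k3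
    rw [T.adj_comm w a, T.adj_comm w d] at k4
    rw [T.adj_comm w b, T.adj_comm w d] at k5
    rw [T.adj_comm w e, T.adj_comm w d] at k6
    rcases prop_four k1 k2 k3 k4 k5 k6 with h | h | h | h
    · exact absurd ⟨hw.1, h⟩ hw.2
    · exact Or.inl ⟨hw, h⟩
    · exact Or.inr (Or.inl ⟨hw, h⟩)
    · exact Or.inr (Or.inr ⟨hw, h⟩)
  have h1 := Finset.card_le_card hsub
  have h2 := Finset.card_union_le (fullSet T d a b (W \ fullSet T a b e W)) (fullSet T d b e (W \ fullSet T a b e W)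
      ∪ fullSet T d a e (W \ fullSet T a b e W))
  have h3 := Finset.card_union_le (fullSet T d b e (W \ fullSet T a b e W)) (fullSet T d a e (W \ fullSet T a b e W))
  have h4 := full_card_le hT.k33 hda hdb hab (W \ fullSet T a b e W)
  have h5 := full_card_le hT.k33 hdb hde hbe (W \ fullSet T a b e W)
  have h6 := full_card_le hT.k33 hda hde hae (W \ fullSet T a b e W)
  have h7 : (W \ fullSet T a b e W).card + (fullSet T a b e W).card = W.card :=
    Finset.card_sdiff_add_card_eq_card (fun w hw => (mem_fullSet.1 hw).1)
  obtain ⟨r3, hr3⟩ := Finset.card_pos.1 (show 0 < (fullSet T d a b (W \ fullSet T a b e W)).card by omega)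
  obtain ⟨r4, hr4⟩ := Finset.card_pos.1 (show 0 < (fullSet T d b e (W \ fullSet T a b e W)).card by omega)
  obtain ⟨r1, hr1, r2, hr2, h12⟩ := Finset.one_lt_card.1 (show 1 < (fullSet T a b e W).card by omega)
  rw [mem_fullSet, Finset.mem_sdiff] at hr3 hr4
  have n13 : r1 ≠ r3 := fun h => hr3.1.2 (h ▸ hr1)
  have n23 : r2 ≠ r3 := fun h => hr3.1.2 (h ▸ hr2)
  have n14 : r1 ≠ r4 := fun h => hr4.1.2 (h ▸ hr1)
  have n24 : r2 ≠ r4 := fun h => hr4.1.2 (h ▸ hr2)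
  rw [mem_fullSet] at hr1 hr2
  have ne : ∀ {u w : V}, u ∉ W → w ∈ W → u ≠ w := fun h1 h2 h => h1 (h ▸ h2)
  have d1 := ne dW hr1.1
  have d2 := ne dW hr2.1
  have a3 := ne aW hr3.1.1
  have a4 := ne aW hr4.1.1
  have b3 := ne bW hr3.1.1
  have b4 := ne bW hr4.1.1
  have e3 := ne eW hr3.1.1
  have e4 := ne eW hr4.1.1
  have e1 := ne eW hr1.1
  have e2 := ne eW hr2.1
  refine hT.k33.two (a := a) (b := b) (x := r1) (y := r2) (C := {e}) (D := {r4, d, r3}) hab h12 (connSet_singleton _)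
    ((connSet_pair hr3.2.1).insert (by simp) hr4.2.1.symm) ?_ ?_ ?_ ?_ ?_ ?_ ?_ ?_ ?_ hr1.2.1 hr2.2.1 hr1.2.2.1 hr2.2.2.1
    ⟨r3, by simp, hr3.2.2.1⟩ ⟨r3, by simp, hr3.2.2.2⟩ ⟨e, rfl, hr1.2.2.2.symm⟩ ⟨e, rfl, hr2.2.2.2.symm⟩
    ⟨e, rfl, r4, by simp, hr4.2.2.2⟩
  all_goals simp only [Set.mem_insert_iff, Set.mem_singleton_iff, Set.disjoint_singleton_left, not_or]
  · exact ⟨e4, hde.symm, e3⟩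
  · exact hae
  · exact hbe
  · exact e1.symm
  · exact e2.symm
  · exact ⟨a4, hda.symm, a3⟩
  · exact ⟨b4, hdb.symm, b3⟩
  · exact ⟨n14, d1.symm, n13⟩
  · exact ⟨n24, d2.symm, n23⟩

lemma four_elems {S : Finset V} (hS : S.card = 4) : ∃ a b e d, a ≠ b ∧ a ≠ e ∧ b ≠ e ∧ d ≠ a ∧ d ≠ b ∧ d ≠ e ∧ S = {a, b, e, d} := by
  obtain ⟨d, T', hd, rfl, h3⟩ := Finset.card_eq_succ.1 hS
  obtain ⟨a, b, e, hab, hae, hbe, rfl⟩ := Finset.card_eq_three.1 h3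
  simp only [Finset.mem_insert, Finset.mem_singleton, not_or] at hd
  refine ⟨a, b, e, d, hab, hae, hbe, hd.1, hd.2.1, hd.2.2, ?_⟩
  ext u; simp only [Finset.mem_insert, Finset.mem_singleton]; tauto

lemma cross_exists (hT : PT T) {S : Finset V} (hS : S.card = 4) : ∃ x y, x ∉ S ∧ y ∉ S ∧ T.Adj x y := by
  classical
  by_contra hcon
  push Not at hcon
  obtain ⟨a, b, e, d, hab, hae, hbe, hda, hdb, hde, hSd⟩ := four_elems hS
  have hW : 7 ≤ Sᶜ.card := by have := Finset.card_add_card_compl S; have := hT.hn; omega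
  have key : ∀ w ∈ Sᶜ, ∀ u ∈ S, ∀ v ∈ S, u ≠ v → T.Adj w u ∨ T.Adj w v := by
    intro w hw u hu v hv huv
    rw [Finset.mem_compl] at hw
    by_contra hc
    push Not at hc
    obtain ⟨y, hy, hwy⟩ := hT.exists_nbr w S (by
      rw [cnt_single_eq, ← Finset.add_sum_erase _ _ hu, ad_zero.2 hc.1,
        ← Finset.add_sum_erase _ _ (show v ∈ S.erase u by simp [huv.symm, hv]), ad_zero.2 hc.2, zero_add, zero_add, ← cnt_single_eq]
      refine le_trans (cnt_single_le _ _) ?_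
      rw [Finset.card_erase_of_mem (by simp [huv.symm, hv]), Finset.card_erase_of_mem hu]; omega)
    exact hcon w y hw hy hwy
  have aS : a ∉ Sᶜ := by simp [hSd]
  have bS : b ∉ Sᶜ := by simp [hSd]
  have eS : e ∉ Sᶜ := by simp [hSd]
  have dS : d ∉ Sᶜ := by simp [hSd]
  have perm : ∀ a' b' e' d' : V, ({a', b', e', d'} : Finset V) ⊆ S →
      ∀ w ∈ Sᶜ, ∀ u ∈ ({a', b', e', d'} : Finset V), ∀ v ∈ ({a', b', e', d'} : Finset V), u ≠ v → T.Adj w u ∨ T.Adj w v :=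
    fun a' b' e' d' h w hw u hu v hv huv => key w hw u (h hu) v (h hv) huv
  have f1 := cross_aux hT hab hae hbe hda hdb hde hW aS bS eS dS (perm a b e d (by rw [hSd]))
  have f2 := cross_aux hT hda hdb hab hde.symm hae.symm hbe.symm hW dS aS bS eS
    (perm d a b e (by rw [hSd]; intro u; simp only [Finset.mem_insert, Finset.mem_singleton]; tauto))
  have f3 := cross_aux hT hdb hde hbe hda.symm hab hae hW dS bS eS aS
    (perm d b e a (by rw [hSd]; intro u; simp only [Finset.mem_insert, Finset.mem_singleton]; tauto))
  have f4 := cross_aux hT hda hde hae hdb.symm hab.symm hbe hW dS aS eS bS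
    (perm d a e b (by rw [hSd]; intro u; simp only [Finset.mem_insert, Finset.mem_singleton]; tauto))
  have hsub : Sᶜ ⊆ fullSet T a b e Sᶜ ∪ (fullSet T d a b Sᶜ ∪ (fullSet T d b e Sᶜ ∪ fullSet T d a e Sᶜ)) := by
    intro w hw
    have k1 := key w hw a (by simp [hSd]) b (by simp [hSd]) hab
    have k2 := key w hw a (by simp [hSd]) e (by simp [hSd]) hae
    have k3 := key w hw b (by simp [hSd]) e (by simp [hSd]) hbe
    have k4 := key w hw d (by simp [hSd]) a (by simp [hSd]) hda
    have k5 := key w hw d (by simp [hSd]) b (by simp [hSd]) hdb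
    have k6 := key w hw d (by simp [hSd]) e (by simp [hSd]) hde
    simp only [Finset.mem_union, mem_fullSet, hw, true_and]
    rw [T.adj_comm w a, T.adj_comm w b] at k1
    rw [T.adj_comm w a, T.adj_comm w e] at k2
    rw [T.adj_comm w b, T.adj_comm w e] at k3
    rw [T.adj_comm w a, T.adj_comm w d] at k4
    rw [T.adj_comm w b, T.adj_comm w d] at k5
    rw [T.adj_comm w e, T.adj_comm w d] at k6
    exact prop_four k1 k2 k3 k4 k5 k6
  have h1 := Finset.card_le_card hsub
  have h2 := Finset.card_union_le (fullSet T a b e Sᶜ) (fullSet T d a b Sᶜ ∪ (fullSet T d b e Sᶜ ∪ fullSet T d a e Sᶜ))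
  have h3 := Finset.card_union_le (fullSet T d a b Sᶜ) (fullSet T d b e Sᶜ ∪ fullSet T d a e Sᶜ)
  have h4 := Finset.card_union_le (fullSet T d b e Sᶜ) (fullSet T d a e Sᶜ)
  have g1 : (fullSet T a b e Sᶜ).card < 2 := not_le.1 f1
  have g2 := not_le.1 f2
  have g3 := not_le.1 f3
  have g4 := not_le.1 f4
  omega

lemma cnt_touch {Z W : Finset V} (hZ : Z ⊆ W) (h : ∀ u ∈ W, ∀ v ∈ W, T.Adj u v → u ∈ Z ∨ v ∈ Z) :
    cnt T W W + cnt T Z Z = 2 * cnt T Z W := by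
  have h1 := cnt_split (G := T) W Z hZ
  have h2 : cnt T (W \ Z) (W \ Z) = 0 := by
    rw [cnt_eq_zero]
    intro u hu v hv huv
    rw [Finset.mem_sdiff] at hu hv
    rcases h u hu.1 v hv.1 huv with h | h
    · exact hu.2 h
    · exact hv.2 h
  have h3 : cnt T Z W = cnt T Z Z + cnt T Z (W \ Z) := by
    rw [← cnt_union_right Finset.disjoint_sdiff, Finset.union_sdiff_of_subset hZ]
  omega

lemma cnt_le_of_adj_subset {u : V} {A B : Finset V} (h : ∀ v ∈ A, T.Adj u v → v ∈ B) : cnt T {u} A ≤ B.card := by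
  classical
  rw [cnt_single_card]
  exact Finset.card_le_card (fun v hv => by rw [Finset.mem_filter] at hv; exact h v hv.1 hv.2)

lemma beta_false (R : CRep T G c) (hT : PT T) {S : Finset V} {x y a b d e t r : V} (hS : S.card = 4)
    (cov : ∀ u v, G.Adj u v → u ∈ S ∨ v ∈ S) (B : Beta G S x y a b d e t r) : False := by
  classical
  set W : Finset V := ({a, b} : Finset V)ᶜ with hW
  have mW : ∀ u, u ∈ W ↔ u ≠ a ∧ u ≠ b := by intro u; simp [hW]
  have mS : ∀ u, u ∈ S ↔ u = a ∨ u = b ∨ u = d ∨ u = e := by intro u; rw [B.Sd]; simp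
  have hn := hT.hn
  have deg : ∀ v ∈ W, cnt T {v} W ≤ 2 := by
    intro v hv
    by_contra hc
    rw [cnt_single_card] at hc
    obtain ⟨x, hx, y, hy, z, hz, hxy, hxz, hyz⟩ := Finset.two_lt_card.1 (not_le.1 hc)
    simp only [Finset.mem_filter, mW] at hx hy hz hv
    exact hT.k33.points (a := a) (b := b) (c := v) B.ab hv.1.symm hv.2.symm hxy hxz hyz (R.le (B.fa x hx.1.1)) (R.le (B.fa y hy.1.1))
      (R.le (B.fa z hz.1.1)) (R.le (B.fb x hx.1.2)) (R.le (B.fb y hy.1.2)) (R.le (B.fb z hz.1.2)) hx.2 hy.2 hz.2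
  have ci := Finset.card_add_card_compl ({a, b} : Finset V)
  rw [Finset.card_pair B.ab] at ci
  have tot : cnt T W W + 6 = 2 * Fintype.card V := by
    have h1 := cnt_compl (G := T) {a, b}
    have h2 : cnt T {a, b} {a, b} = 2 := by rw [cnt_self_two, ad_one.2 (R.le (B.fa b B.ab.symm))]
    have h3 : cnt T {a, b} ({a, b} : Finset V)ᶜ = 2 * (({a, b} : Finset V)ᶜ).card := by
      rw [cnt_right_sum']
      rw [Finset.sum_const_nat (m := 2)]
      · omega
      · intro v hv
        have := (mW v).1 hv
        rw [cnt_single_two _ B.ab, ad_one.2 (R.le (B.fa v this.1)).symm, ad_one.2 (R.le (B.fb v this.2)).symm]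
    have h4 := hT.edges
    rw [← hW] at h1 h3
    rw [← hW] at ci
    omega
  have dW := (mW d).2 ⟨B.da, B.db⟩
  have eW := (mW e).2 ⟨B.ea, B.eb⟩
  have tS := B.tS
  have rS := B.rS
  rw [mS] at tS rS
  push Not at tS rS
  have tW := (mW t).2 ⟨tS.1, tS.2.1⟩
  have rW := (mW r).2 ⟨rS.1, rS.2.1⟩
  -- a far cross edge
  obtain ⟨x2, y2, hx2, hy2, h2, nd1, nd2, ne1, ne2⟩ : ∃ x2 y2, x2 ∈ W ∧ y2 ∈ W ∧ T.Adj x2 y2 ∧ ¬ T.Adj d x2 ∧ ¬ T.Adj d y2 ∧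
      ¬ T.Adj e x2 ∧ ¬ T.Adj e y2 := by
    by_contra hcon
    push Not at hcon
    set N := W.filter (fun v => T.Adj d v ∨ T.Adj e v) with hN
    have h1 := cnt_touch (T := T) (Z := N) (W := W) (Finset.filter_subset _ _) (by
      intro u hu v hv huv
      simp only [hN, Finset.mem_filter, hu, hv, true_and]
      have := hcon u v hu hv huv
      tauto)
    have h2 : N.card ≤ 3 := by
      have e1 : N ⊆ W.filter (fun v => T.Adj d v) ∪ (W.filter (fun v => T.Adj e v)).erase t := by
        intro v hv
        simp only [hN, Finset.mem_filter, Finset.mem_union, Finset.mem_erase] at hv ⊢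
        by_cases hvt : v = t
        · subst hvt; exact Or.inl ⟨tW, R.le B.dt⟩
        · tauto
      have e2 := deg d dW
      have e3 := deg e eW
      rw [cnt_single_card] at e2 e3
      have e4 := Finset.card_le_card e1
      have e5 := Finset.card_union_le (W.filter (fun v => T.Adj d v)) ((W.filter (fun v => T.Adj e v)).erase t)
      rw [Finset.card_erase_of_mem (by simp [tW, R.le B.et])] at e5
      omega
    have h3 : cnt T N W ≤ N.card * 2 := by
      rw [cnt_left_sum]
      exact Finset.sum_le_card_nsmul _ _ _ (fun v hv => deg v (Finset.mem_filter.1 hv).1)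
    omega
  have hx2' := (mW x2).1 hx2
  have hy2' := (mW y2).1 hy2
  have xS : x2 ∉ S := by
    rw [mS]; rintro (h | h | h | h)
    · exact hx2'.1 h
    · exact hx2'.2 h
    · subst h; exact nd2 h2
    · subst h; exact ne2 h2
  have yS : y2 ∉ S := by
    rw [mS]; rintro (h | h | h | h)
    · exact hy2'.1 h
    · exact hy2'.2 h
    · subst h; exact nd1 h2.symm
    · subst h; exact ne1 h2.symm
  rcases dich R hT hS cov xS yS h2 with ⟨d2, t2, z2, A⟩ | ⟨a2, b2, d2, e2, t2, r2, B2⟩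
  · have hd2 := (mS d2).1 A.dS
    have hbig : ∀ u : V, (∀ v, v ∉ S → G.Adj u v → v = t2 ∨ v = z2) → (∀ v, v ∉ S → G.Adj u v) → False := by
      intro u h1 h2
      have e1 : Sᶜ ⊆ {t2, z2} := by
        intro v hv; rw [Finset.mem_compl] at hv
        have := h1 v hv (h2 v hv); simpa using this
      have e2 := Finset.card_le_card e1
      have e3 := Finset.card_le_two (a := t2) (b := z2)
      have e4 := Finset.card_add_card_compl S
      omega
    rcases hd2 with h | h | h | h
    · exact hbig d2 A.only (fun v hv => by rw [h]; exact B.fa v (fun h' => hv ((mS v).2 (by tauto))))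
    · exact hbig d2 A.only (fun v hv => by rw [h]; exact B.fb v (fun h' => hv ((mS v).2 (by tauto))))
    · have := R.le A.dt; rw [h] at this
      rcases A.te with h' | h' <;> rw [h'] at this <;> contradiction
    · have := R.le A.dt; rw [h] at this
      rcases A.te with h' | h' <;> rw [h'] at this <;> contradiction
  · -- a2, b2 are a, b
    have mS2 : ∀ u, u ∈ S ↔ u = a2 ∨ u = b2 ∨ u = d2 ∨ u = e2 := by intro u; rw [B2.Sd]; simp
    have xd : x2 ≠ d := by rintro rfl; exact xS ((mS _).2 (by simp))
    have xe : x2 ≠ e := by rintro rfl; exact xS ((mS _).2 (by simp))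
    have k1 : a2 ≠ d := by rintro rfl; exact nd1 (R.le (B2.fa x2 xd))
    have k2 : a2 ≠ e := by rintro rfl; exact ne1 (R.le (B2.fa x2 xe))
    have k3 : b2 ≠ d := by rintro rfl; exact nd1 (R.le (B2.fb x2 xd))
    have k4 : b2 ≠ e := by rintro rfl; exact ne1 (R.le (B2.fb x2 xe))
    have hd2 : d2 = d ∨ d2 = e := by
      have h1 := (mS a2).1 ((mS2 a2).2 (by simp))
      have h2 := (mS b2).1 ((mS2 b2).2 (by simp))
      have h3 := (mS d2).1 ((mS2 d2).2 (by simp))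
      have := B2.ab
      have := B2.da
      have := B2.db
      grind
    have q1 := R.le B2.dt
    have q2 := R.le B2.dr
    rcases B2.touch with h | h | h | h <;> rcases hd2 with h' | h' <;> rw [h'] at q1 q2 <;>
      (first | rw [← h] at q1 | rw [← h] at q2) <;> contradiction

end
end

section
open Set
set_option linter.all false

section
variable {V : Type*} [Fintype V] [DecidableEq V] {T G : SimpleGraph V} {c : Sym2 V → ℕ}

lemma ExtT.two_nbrs {I : Finset V} {p q : V} (E : ExtT T I p q) {y : V} (hy : y ∉ I) :
    ∃ u ∈ I, ∃ v ∈ I, u ≠ v ∧ T.Adj y u ∧ T.Adj y v := by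
  obtain ⟨a, b, d, hab, had, hbd, hI⟩ := Finset.card_eq_three.1 E.card
  have aI : a ∈ I := by simp [hI]
  have bI : b ∈ I := by simp [hI]
  by_cases hp : y = p
  · subst hp; exact ⟨a, aI, b, bI, hab, E.pf _ aI, E.pf _ bI⟩
  by_cases hq : y = q
  · subst hq; exact ⟨a, aI, b, bI, hab, E.qf _ aI, E.qf _ bI⟩
  obtain ⟨m, hm, -, h⟩ := E.low y hy hp hq
  obtain ⟨u, hu, v, hv, hum, hvm, huv, -, -⟩ := E.other hm
  exact ⟨u, hu, v, hv, huv, h u hu hum, h v hv hvm⟩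

lemma ExtT.deg3 {I : Finset V} {p q : V} (E : ExtT T I p q) (hT : PT T) {w : V} (hw : w ∉ I)
    (h : 3 ≤ cnt T {w} Iᶜ) : w = p ∨ w = q := by
  by_contra hc
  push Not at hc
  have := E.deg_low hT hw hc.1 hc.2
  omega

lemma Alpha.other {S : Finset V} {x y d t z : V} (A : Alpha T G c S x y d t z) (hx : x ∉ S) (hy : y ∉ S)
    (hxy : T.Adj x y) : ∃ o, o ∉ S ∧ T.Adj t o ∧ c s(t, o) = c s(d, z) := by
  rcases A.te with rfl | rfl
  · exact ⟨y, hy, hxy, A.col⟩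
  · exact ⟨x, hx, hxy.symm, by rw [Sym2.eq_swap]; exact A.col⟩

lemma alpha_of_all (R : CRep T G c) (hT : PT T) {S : Finset V} {x y : V} (hS : S.card = 4)
    (cov : ∀ u v, G.Adj u v → u ∈ S ∨ v ∈ S) (hx : x ∉ S) (hy : y ∉ S) (hxy : T.Adj x y) :
    ∃ d t z, Alpha T G c S x y d t z := by
  rcases dich R hT hS cov hx hy hxy with h | ⟨a, b, d, e, t, r, h⟩
  · exact h
  · exact (beta_false R hT hS cov h).elim

lemma no_extra (R : CRep T G c) (hT : PT T) {S : Finset V} (hS : S.card = 4)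
    (cov : ∀ u v, G.Adj u v → u ∈ S ∨ v ∈ S) {u v : V} (hu : u ∈ S) (huv : T.Adj u v) : G.Adj u v := by
  classical
  by_contra hG
  have key : ∀ x y, x ∉ S → y ∉ S → T.Adj x y → ∃ t z, Alpha T G c S x y u t z := by
    intro x y hx hy hxy
    obtain ⟨d, t, z, A⟩ := alpha_of_all R hT hS cov hx hy hxy
    have : u = d := by
      by_contra hud
      exact hG (A.full u (Finset.mem_erase.2 ⟨hud, hu⟩) v huv)
    subst this
    exact ⟨t, z, A⟩
  obtain ⟨x, y, hx, hy, hxy⟩ := cross_exists hT hS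
  obtain ⟨t, z, A⟩ := key x y hx hy hxy
  obtain ⟨p, q, E⟩ := A.ext
  have hv : v ∉ S := by
    intro hv
    exact hG (A.full v (Finset.mem_erase.2 ⟨huv.ne.symm, hv⟩) u huv.symm).symm
  have hvt : v ≠ t := by rintro rfl; exact hG A.dt
  have hvz : v ≠ z := by rintro rfl; exact hG A.dz
  have mI : ∀ w, w ∉ S → w ∉ S.erase u := fun w h h' => h (Finset.mem_of_mem_erase h')
  have uI : u ∉ S.erase u := by simp
  set W := (S.erase u)ᶜ with hW
  have tW : t ∈ W := by rw [hW, Finset.mem_compl]; exact mI t A.tS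
  have zW : z ∈ W := by rw [hW, Finset.mem_compl]; exact mI z A.zS
  have vW : v ∈ W := by rw [hW, Finset.mem_compl]; exact mI v hv
  have uW : u ∈ W := by rw [hW, Finset.mem_compl]; exact uI
  have hut : u ≠ t := by rintro rfl; exact A.tS hu
  have huz : u ≠ z := by rintro rfl; exact A.zS hu
  have d3 : 3 ≤ cnt T {u} W := by
    have h1 : cnt T {u} {v, t, z} ≤ cnt T {u} W := by
      apply cnt_mono_sets (Finset.Subset.refl _)
      intro w hw
      simp only [Finset.mem_insert, Finset.mem_singleton] at hw
      rcases hw with rfl | rfl | rfl <;> assumption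
    rw [cnt_single_three _ hvt hvz A.tz, ad_one.2 huv, ad_one.2 (R.le A.dt), ad_one.2 (R.le A.dz)] at h1
    omega
  have hpq := E.deg3 hT uI d3
  have t1 := E.s1_edge hT uI (mI t A.tS) (R.le A.dt) hpq
  have z1 := E.s1_edge hT uI (mI z A.zS) (R.le A.dz) hpq
  have e1 := E.deg_low hT (mI t A.tS) t1.1 t1.2
  have e2 := E.deg_low hT (mI z A.zS) z1.1 z1.2
  have e3 := E.deg_le hT uI
  have hc := cnt_touch (T := T) (Z := {u, t, z}) (W := W) (by
      intro w hw
      simp only [Finset.mem_insert, Finset.mem_singleton] at hw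
      rcases hw with rfl | rfl | rfl <;> assumption) (by
      intro a ha b hb hab
      simp only [Finset.mem_insert, Finset.mem_singleton]
      by_cases hau : a = u
      · simp [hau]
      by_cases hbu : b = u
      · simp [hbu]
      have aS : a ∉ S := by
        intro h; rw [hW, Finset.mem_compl] at ha; exact ha (Finset.mem_erase.2 ⟨hau, h⟩)
      have bS : b ∉ S := by
        intro h; rw [hW, Finset.mem_compl] at hb; exact hb (Finset.mem_erase.2 ⟨hbu, h⟩)
      obtain ⟨t', z', A'⟩ := key a b aS bS hab
      have h1 := A.only t' A'.tS A'.dt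
      rcases A'.te with h | h
      · rw [h] at h1; exact Or.inl (Or.inr h1)
      · rw [h] at h1; exact Or.inr (Or.inr h1))
  have h4 : cnt T {u, t, z} W = cnt T {u} W + (cnt T {t} W + cnt T {z} W) := by
    rw [cnt_insert_left (by simp [hut, huz]), cnt_insert_left (by simp [A.tz])]
  rw [cnt_self_three hut huz A.tz, ad_one.2 (R.le A.dt), ad_one.2 (R.le A.dz)] at hc
  have h5 := E.rest
  have h6 := hT.hn
  rw [← hW] at h5 e1 e2 e3
  omega

lemma t_const (R : CRep T G c) (hT : PT T) {S : Finset V} (hS : S.card = 4) {x y x' y' d t z t' z' : V}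
    (hx : x ∉ S) (hy : y ∉ S) (hxy : T.Adj x y) (hx' : x' ∉ S) (hy' : y' ∉ S) (hxy' : T.Adj x' y')
    (A : Alpha T G c S x y d t z) (A' : Alpha T G c S x' y' d t' z') : t = t' := by
  classical
  by_contra htt
  obtain rfl : t' = z := by
    rcases A.only t' A'.tS A'.dt with h | h
    · exact absurd h.symm htt
    · exact h
  obtain rfl : t = z' := by
    rcases A'.only t A.tS A.dt with h | h
    · exact absurd h htt
    · exact h
  obtain ⟨o, oS, ho, co⟩ := A.other hx hy hxy
  obtain ⟨o', oS', ho', co'⟩ := A'.other hx' hy' hxy'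
  obtain ⟨p, q, E⟩ := A.ext
  have mI : ∀ w, w ∉ S → w ∉ S.erase d := fun w h h' => h (Finset.mem_of_mem_erase h')
  have dI : d ∉ S.erase d := by simp
  have tI := mI t A.tS
  have tI' := mI t' A'.tS
  have oI := mI o oS
  have oI' := mI o' oS'
  have nS : ∀ w, w ∉ S → w ≠ d := by rintro w h rfl; exact h A.dS
  have dt := nS t A.tS
  have dt' := nS t' A'.tS
  have od := nS o oS
  have od' := nS o' oS'
  have Adt := R.le A.dt
  have Adt' := R.le A'.dt
  have h1 : o ≠ t' := by
    rintro rfl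
    exact E.no_tri hT dI tI tI' Adt Adt' ho
  have h2 : o' ≠ t := by
    rintro rfl
    exact E.no_tri hT dI tI tI' Adt Adt' ho'.symm
  have h3 : o ≠ o' := by
    rintro rfl
    exact E.no_four hT dI tI oI tI' Adt ho ho'.symm Adt'.symm od.symm htt
  obtain ⟨a, b, e, hab, hae, hbe, hI⟩ := Finset.card_eq_three.1 E.card
  set I := S.erase d with hId
  have aI : a ∈ I := by simp [hI]
  have bI : b ∈ I := by simp [hI]
  have eI : e ∈ I := by simp [hI]
  set Z : Finset V := {o, o', t, t', d} with hZ
  set Y : Finset V := (I ∪ Z)ᶜ with hY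
  have mY : ∀ w, w ∈ Y ↔ w ∉ I ∧ w ≠ o ∧ w ≠ o' ∧ w ≠ t ∧ w ≠ t' ∧ w ≠ d := by
    intro w; rw [hY, Finset.mem_compl, Finset.mem_union, not_or]; simp [hZ]
  have cY : 3 ≤ Y.card := by
    have c1 := Finset.card_add_card_compl (I ∪ Z)
    have c2 := Finset.card_union_le I Z
    have c3 : Z.card ≤ 5 := Finset.card_le_five
    have c4 := hT.hn
    rw [E.card] at c2
    rw [← hY] at c1
    omega
  have conn : ConnSet T ((Z : Finset V) : Set V) := by
    have k1 := (connSet_singleton (G := T) d).insert (u := t') (v := d) (by simp) Adt'.symm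
    have k2 := k1.insert (u := t) (v := d) (by simp) Adt.symm
    have k3 := k2.insert (u := o') (v := t') (by simp) ho'.symm
    have k4 := k3.insert (u := o) (v := t) (by simp) ho.symm
    convert k4 using 1
    simp [hZ]
  have nb : ∀ m ∈ I, ∃ w ∈ Y, G.Adj m w := by
    intro m hm
    by_cases hp : p ∈ Y
    · exact ⟨p, hp, A.full m hm p (E.pf m hm).symm⟩
    by_cases hq : q ∈ Y
    · exact ⟨q, hq, A.full m hm q (E.qf m hm).symm⟩
    exfalso
    have g : ∀ w, w ∉ I → w ∉ Y → w ∈ Z := by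
      intro w h h'
      by_contra hc
      apply h'
      simp [hY, h, hc]
    refine E.s1 hT conn ?_ (by exact_mod_cast g p E.pI hp) (by exact_mod_cast g q E.qI hq)
    intro w hw
    have hw : w ∈ Z := by exact_mod_cast hw
    simp only [hZ, Finset.mem_insert, Finset.mem_singleton] at hw
    rcases hw with rfl | rfl | rfl | rfl | rfl <;> assumption
  obtain ⟨u, hu, v, hv, w, hw, huv, huw, hvw, au, bv, ew⟩ := sdr (H := G) (G := G) hab hae hbe ⟨s(a, a), fun u v h => Or.inl h⟩ Y cY (by
      intro y hy
      obtain ⟨u, hu, v, hv, huv, h1, h2⟩ := E.two_nbrs ((mY y).1 hy).1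
      have k : cnt G {y} {u, v} ≤ cnt G {y} {a, b, e} := by
        apply cnt_mono_sets (Finset.Subset.refl _)
        rw [← hI]
        intro w hw
        simp only [Finset.mem_insert, Finset.mem_singleton] at hw
        rcases hw with rfl | rfl <;> assumption
      rw [cnt_single_two _ huv, ad_one.2 (A.full u hu y h1.symm).symm, ad_one.2 (A.full v hv y h2.symm).symm] at k
      exact k) (fun h => ((mY a).1 h).1 aI) (fun h => ((mY b).1 h).1 bI) (fun h => ((mY e).1 h).1 eI)
      (nb a aI) (nb b bI) (nb e eI)
  rw [mY] at hu hv hw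
  have ne : ∀ m ∈ I, ∀ w, w ∉ I → m ≠ w := by rintro m hm w hw rfl; exact hw hm
  have cc : ∀ m ∈ I, ∀ w, G.Adj m w → c s(m, w) ≠ c s(d, t') ∧ c s(m, w) ≠ c s(d, t) := by
    intro m hm w h
    exact ⟨R.col_ne h A'.dt (ne m hm d dI) (ne m hm t' tI'), R.col_ne h A.dt (ne m hm d dI) (ne m hm t tI)⟩
  have nn : ∀ m ∈ I, m ≠ o ∧ m ≠ o' ∧ m ≠ t ∧ m ≠ t' ∧ m ≠ u ∧ m ≠ v ∧ m ≠ w :=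
    fun m hm => ⟨ne m hm o oI, ne m hm o' oI', ne m hm t tI, ne m hm t' tI', ne m hm u hu.1, ne m hm v hv.1, ne m hm w hw.1⟩
  have na := nn a aI
  have nb' := nn b bI
  have ne' := nn e eI
  refine R.no_2_3 (x := t) (y := o) (z := t') (w := o') (a₁ := a) (b₁ := u) (a₂ := b) (b₂ := v) (a₃ := e) (b₃ := w) ho ho' ?_
    (Gd_adj.2 ⟨au, ?_⟩) (Gd_adj.2 ⟨bv, ?_⟩) (Gd_adj.2 ⟨ew, ?_⟩) ?_ ?_ ?_ ?_
  · rw [co, co', Sym2.eq_swap, Sym2.eq_swap (a := d)]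
    exact R.col_ne A'.dt.symm A.dt.symm (Ne.symm htt) dt'
  · rw [co]; exact (cc a aI u au).1
  · rw [co]; exact (cc b bI v bv).1
  · rw [co]; exact (cc e eI w ew).1
  · rw [co']; exact (cc a aI u au).2
  · rw [co']; exact (cc b bI v bv).2
  · rw [co']; exact (cc e eI w ew).2
  · have := ho.ne
    have := ho'.ne
    simp only [List.nodup_cons, List.mem_cons, List.not_mem_nil, or_false, not_or, not_false_eq_true, List.nodup_nil, and_true]
    grind

lemma Alpha.only_le {S : Finset V} {x y d t z : V} (A : Alpha T G c S x y d t z) : cnt G {d} Sᶜ ≤ 2 := by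
  classical
  have h := cnt_le_of_adj_subset (T := G) (u := d) (A := Sᶜ) (B := {t, z}) (by
    intro v hv h
    have := A.only v (by simpa using hv) h
    simpa using this)
  exact h.trans (Finset.card_le_two)

lemma Alpha.t_le (R : CRep T G c) (hT : PT T) {S : Finset V} {x y d t z : V} (A : Alpha T G c S x y d t z) :
    cnt T {t} (S.erase d)ᶜ = cnt T {t} Sᶜ + 1 ∧ cnt T {t} (S.erase d)ᶜ ≤ 3 := by
  classical
  obtain ⟨p, q, E⟩ := A.ext
  have h1 : (S.erase d)ᶜ = Insert.insert d Sᶜ := by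
    ext w
    have := A.dS
    simp only [Finset.mem_compl, Finset.mem_erase, Finset.mem_insert]
    by_cases h : w = d
    · simp [h]
    · simp [h]
  refine ⟨?_, E.deg_le hT (fun h => A.tS (Finset.mem_of_mem_erase h))⟩
  rw [h1, cnt_insert_right (by simpa using A.dS), cnt_singleton, ad_one.2 (R.le A.dt).symm]
  omega

lemma crep_false (R : CRep T G c) (hT : PT T) : False := by
  classical
  have hn := hT.hn
  obtain ⟨S, hS, cov⟩ := (R.cover4 hT).exact (by omega)
  have cS := Finset.card_add_card_compl S
  have ext : ∀ u ∈ S, ∀ v, ad T u v = ad G u v := fun u hu v =>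
    ad_congr ⟨fun h => no_extra R hT hS cov hu h, fun h => R.le h⟩
  have ext2 : ∀ B, cnt T S B = cnt G S B := by
    intro B
    unfold cnt
    exact Finset.sum_congr rfl fun u hu => Finset.sum_congr rfl fun v _ => ext u hu v
  have g0 : cnt G Sᶜ Sᶜ = 0 := by
    rw [cnt_eq_zero]
    intro u hu v hv h
    rw [Finset.mem_compl] at hu hv
    exact (cov u v h).elim hu hv
  obtain ⟨x1, y1, hx1, hy1, hxy1⟩ := cross_exists hT hS
  obtain ⟨d1, t1, z1, A1⟩ := alpha_of_all R hT hS cov hx1 hy1 hxy1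
  have tot : 8 ≤ cnt T Sᶜ Sᶜ := by
    have h1 := cnt_compl (G := T) S
    have h2 := cnt_compl (G := G) S
    have h3 := A1.tot
    have h4 := hT.edges
    rw [ext2, ext2] at h1
    omega
  have k1 := A1.t_le R hT
  have small : ∀ Z : Finset V, Z ⊆ Sᶜ → (∀ x y, x ∉ S → y ∉ S → T.Adj x y → x ∈ Z ∨ y ∈ Z) → 4 ≤ cnt T Z Sᶜ := by
    intro Z hZ h
    have := cnt_touch (T := T) (Z := Z) (W := Sᶜ) hZ (by
      intro u hu v hv huv
      rw [Finset.mem_compl] at hu hv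
      exact h u v hu hv huv)
    omega
  by_cases hall : ∀ x y d t z, x ∉ S → y ∉ S → T.Adj x y → Alpha T G c S x y d t z → t = t1
  · have := small {t1} (by simpa using A1.tS) (by
      intro x y hx hy hxy
      obtain ⟨d, t, z, A⟩ := alpha_of_all R hT hS cov hx hy hxy
      have h := hall x y d t z hx hy hxy A
      rcases A.te with h' | h'
      · left; simp [← h', h]
      · right; simp [← h', h])
    omega
  push Not at hall
  obtain ⟨x2, y2, d2, t2, z2, hx2, hy2, hxy2, A2, ht⟩ := hall
  have hd : d2 ≠ d1 := by
    rintro rfl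
    exact ht (t_const R hT hS hx2 hy2 hxy2 hx1 hy1 hxy1 A2 A1)
  have k2 := A2.t_le R hT
  have := small {t1, t2} (by
      intro w hw
      simp only [Finset.mem_insert, Finset.mem_singleton] at hw
      rw [Finset.mem_compl]
      rcases hw with rfl | rfl
      · exact A1.tS
      · exact A2.tS) (by
      intro x y hx hy hxy
      obtain ⟨d, t, z, A⟩ := alpha_of_all R hT hS cov hx hy hxy
      have h : t = t1 ∨ t = t2 := by
        by_cases h1 : d = d1
        · subst h1; exact Or.inl (t_const R hT hS hx hy hxy hx1 hy1 hxy1 A A1)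
        by_cases h2 : d = d2
        · subst h2; exact Or.inr (t_const R hT hS hx hy hxy hx2 hy2 hxy2 A A2)
        exfalso
        have hsub : ({d, d1, d2} : Finset V) ⊆ S := by
          intro w hw
          simp only [Finset.mem_insert, Finset.mem_singleton] at hw
          rcases hw with rfl | rfl | rfl
          · exact A.dS
          · exact A1.dS
          · exact A2.dS
        have c3 : ({d, d1, d2} : Finset V).card = 3 := Finset.card_eq_three.2 ⟨d, d1, d2, h1, h2, hd.symm, rfl⟩
        have c1 : (S \ {d, d1, d2}).card = 1 := by
          rw [Finset.card_sdiff_of_subset hsub]; omega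
        have e1 : cnt G S Sᶜ = cnt G {d, d1, d2} Sᶜ + cnt G (S \ {d, d1, d2}) Sᶜ := by
          rw [← cnt_union_left Finset.disjoint_sdiff, Finset.union_sdiff_of_subset hsub]
        have e2 := cnt_le_mul (G := G) (S \ {d, d1, d2}) Sᶜ
        rw [c1] at e2
        rw [cnt_insert_left (by simp [h1, h2]), cnt_insert_left (by simp [hd.symm])] at e1
        have e3 := A.only_le
        have e4 := A1.only_le
        have e5 := A2.only_le
        have e6 := cnt_self_le (G := G) S
        have e7 := cnt_compl (G := G) S
        have e8 := A1.tot
        rw [hS] at e6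
        omega
      simp only [Finset.mem_insert, Finset.mem_singleton]
      rcases A.te with h' | h'
      · left; rw [← h']; exact h
      · right; rw [← h']; exact h)
  rw [cnt_insert_left (by simpa using Ne.symm ht)] at this
  have full : ∀ {x y d t z : V}, Alpha T G c S x y d t z → 3 ≤ cnt T {t} (S.erase d)ᶜ → ∀ u ∈ S, T.Adj t u := by
    intro x y d t z A h u hu
    obtain ⟨p, q, E⟩ := A.ext
    by_cases hud : u = d
    · rw [hud]; exact (R.le A.dt).symm
    rcases E.deg3 hT (fun h => A.tS (Finset.mem_of_mem_erase h)) h with rfl | rfl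
    · exact E.pf u (Finset.mem_erase.2 ⟨hud, hu⟩)
    · exact E.qf u (Finset.mem_erase.2 ⟨hud, hu⟩)
  have f1 := full A1 (by omega)
  have f2 := full A2 (by omega)
  obtain ⟨p, q, E⟩ := A1.ext
  have m : ∀ t, t ∉ S → (∀ u ∈ S, T.Adj t u) → t = p ∨ t = q := by
    intro t htS h
    by_contra hc
    push Not at hc
    obtain ⟨m, hm, hm', -⟩ := E.low t (fun h => htS (Finset.mem_of_mem_erase h)) hc.1 hc.2
    exact hm' (h m (Finset.mem_of_mem_erase hm))
  have q1 := (connSet_singleton (G := T) d1).insert (u := t1) (v := d1) (by simp) (f1 d1 A1.dS)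
  have q2 := q1.insert (u := t2) (v := d1) (by simp) (f2 d1 A1.dS)
  refine E.s1' hT q2 ?_ ht (by simp) (by simp) (m t2 A2.tS f2) (m t1 A1.tS f1)
  intro z hz
  simp only [Set.mem_insert_iff, Set.mem_singleton_iff] at hz
  rcases hz with rfl | rfl | rfl
  · exact fun h => A2.tS (Finset.mem_of_mem_erase h)
  · exact fun h => A1.tS (Finset.mem_of_mem_erase h)
  · simp
end
end

section
open Set
set_option linter.all false

section
lemma threshold_upper {n : ℕ} (hn : 11 ≤ n) : RainbowThreshold n 5 (2 * n + 1) := by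
  classical
  intro T hT c hr
  by_contra hno
  obtain ⟨h3, hp, he⟩ := hT
  have hPT : PT T := by
    refine ⟨planar_K5Free hp, planar_K33Free hp, by simpa using hn, ?_⟩
    have := two_mul_edges (G := T)
    simp only [Fintype.card_fin]
    omega
  haveI : Nonempty (Sym2 (Fin n)) := ⟨s(⟨0, by omega⟩, ⟨0, by omega⟩)⟩
  have hch : ∀ k ∈ c '' T.edgeSet, ∃ e ∈ T.edgeSet, c e = k := fun k hk => hk
  choose! f hf1 hf2 using hch
  set E : Set (Sym2 (Fin n)) := f '' (c '' T.edgeSet) with hE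
  have hET : E ⊆ T.edgeSet := by
    rintro _ ⟨k, hk, rfl⟩
    exact hf1 k hk
  set G := SimpleGraph.fromEdgeSet E with hG
  have hGE : G.edgeSet = E := by
    rw [hG, SimpleGraph.edgeSet_fromEdgeSet]
    refine sdiff_eq_left.2 (Set.disjoint_left.2 ?_)
    intro e he hd
    exact T.not_isDiag_of_mem_edgeSet (hET he) hd
  have hle : G ≤ T := by
    rw [← SimpleGraph.edgeSet_subset_edgeSet, hGE]; exact hET
  refine crep_false (T := T) (G := G) (c := c) ⟨hle, ?_, ?_, ?_, hno⟩ hPT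
  · rw [hGE]
    rintro _ ⟨k, hk, rfl⟩ _ ⟨l, hl, rfl⟩ h
    rw [hf2 k hk, hf2 l hl] at h
    rw [h]
  · intro x y hxy
    have hk : c s(x, y) ∈ c '' T.edgeSet := ⟨s(x, y), hxy, rfl⟩
    have h1 : f (c s(x, y)) ∈ G.edgeSet := by rw [hGE]; exact ⟨_, hk, rfl⟩
    have h2 := hf2 _ hk
    induction h : f (c s(x, y)) with
    | _ u v =>
      rw [h] at h1 h2
      exact ⟨u, v, h1, h2⟩
  · have := two_mul_edges (G := G)
    rw [← this, hGE, hE, Set.ncard_image_of_injOn]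
    · simp only [Fintype.card_fin]; omega
    · intro k hk l hl h
      have := congrArg c h
      rwa [hf2 k hk, hf2 l hl] at this
end
end

section
open Set
set_option linter.all false

section
/-- oriented adjacency of the extremal triangulation -/
def wA (u v : ℕ) : Prop := (u = 0 ∧ v = 1) ∨ (u = 0 ∧ 2 ≤ v) ∨ (u = 1 ∧ 2 ≤ v) ∨ (2 ≤ u ∧ v = u + 1)

lemma wA.lt {u v : ℕ} (h : wA u v) : u < v := by unfold wA at h; omega

/-- the extremal triangulation -/
def wG (n : ℕ) : SimpleGraph (Fin n) where
  Adj u v := wA u v ∨ wA v u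
  symm := ⟨fun u v h => h.symm⟩
  loopless := ⟨fun u h => by rcases h with h | h <;> exact absurd h.lt (lt_irrefl _)⟩

noncomputable def wx (i : ℕ) : ℝ := if i = 0 then -1 else if i = 1 then 1 else 0
noncomputable def wy (i : ℕ) : ℝ := if i < 2 then 0 else i

noncomputable def wseg (u v : ℕ) (t : ℝ) : ℝ × ℝ := ((1 - t) * wx u + t * wx v, (1 - t) * wy u + t * wy v)

lemma wpos (i : ℕ) : (i = 0 ∧ wx i = -1 ∧ wy i = 0) ∨ (i = 1 ∧ wx i = 1 ∧ wy i = 0) ∨ (2 ≤ i ∧ wx i = 0 ∧ wy i = i) := by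
  rcases i with _ | _ | i
  · left; simp [wx, wy]
  · right; left; simp [wx, wy]
  · right; right; simp [wx, wy]

lemma wseg_form {u v : ℕ} (h : wA u v) (t : ℝ) : (u = 0 ∧ v = 1 ∧ wseg u v t = (2 * t - 1, 0)) ∨
    (u = 0 ∧ 2 ≤ v ∧ wseg u v t = (t - 1, t * v)) ∨ (u = 1 ∧ 2 ≤ v ∧ wseg u v t = (1 - t, t * v)) ∨
    (2 ≤ u ∧ v = u + 1 ∧ wseg u v t = (0, u + t)) := by
  rcases h with ⟨rfl, rfl⟩ | ⟨rfl, h⟩ | ⟨rfl, h⟩ | ⟨h, rfl⟩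
  · left; refine ⟨rfl, rfl, ?_⟩
    simp only [wseg, wx, wy]; norm_num; ring
  · right; left; refine ⟨rfl, h, ?_⟩
    have h0 : v ≠ 0 := by omega
    have h1 : v ≠ 1 := by omega
    have h2 : ¬ v < 2 := by omega
    simp only [wseg, wx, wy, if_neg h0, if_neg h1, if_neg h2]; norm_num
  · right; right; left; refine ⟨rfl, h, ?_⟩
    have h0 : v ≠ 0 := by omega
    have h1 : v ≠ 1 := by omega
    have h2 : ¬ v < 2 := by omega
    simp only [wseg, wx, wy, if_neg h0, if_neg h1, if_neg h2]; norm_num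
  · right; right; right; refine ⟨h, rfl, ?_⟩
    have h0 : u ≠ 0 := by omega
    have h1 : u ≠ 1 := by omega
    have h2 : ¬ u < 2 := by omega
    have h3 : u + 1 ≠ 0 := by omega
    have h4 : u + 1 ≠ 1 := by omega
    have h5 : ¬ u + 1 < 2 := by omega
    simp only [wseg, wx, wy, if_neg h0, if_neg h1, if_neg h2, if_neg h3, if_neg h4, if_neg h5]
    push_cast
    ext <;> simp <;> ring

lemma tv_pos {t : ℝ} {v : ℕ} (ht : 0 < t) (hv : 2 ≤ v) : 0 < t * v := by
  have : (0 : ℝ) < v := by exact_mod_cast (by omega : 0 < v)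
  positivity

lemma floor_aux {u u' : ℕ} {t t' : ℝ} (h : (u : ℝ) + t = u' + t') (ht : 0 < t) (ht1 : t < 1) (ht' : 0 < t') (ht1' : t' < 1) : u = u' := by
  rcases lt_trichotomy u u' with h1 | h1 | h1
  · have : (u : ℝ) + 1 ≤ u' := by exact_mod_cast h1
    linarith
  · exact h1
  · have : (u' : ℝ) + 1 ≤ u := by exact_mod_cast h1
    linarith

lemma wseg_disj {u v u' v' : ℕ} (h : wA u v) (h' : wA u' v') {t t' : ℝ} (ht : t ∈ Ioo (0 : ℝ) 1) (ht' : t' ∈ Ioo (0 : ℝ) 1)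
    (e : wseg u v t = wseg u' v' t') : u = u' ∧ v = v' := by
  obtain ⟨a1, a2⟩ := ht
  obtain ⟨b1, b2⟩ := ht'
  rcases wseg_form h t with ⟨h1, h2, h3⟩ | ⟨h1, h2, h3⟩ | ⟨h1, h2, h3⟩ | ⟨h1, h2, h3⟩ <;>
  rcases wseg_form h' t' with ⟨k1, k2, k3⟩ | ⟨k1, k2, k3⟩ | ⟨k1, k2, k3⟩ | ⟨k1, k2, k3⟩ <;>
  rw [h3, k3, Prod.mk.injEq] at e <;> obtain ⟨e1, e2⟩ := e
  · omega
  · have := tv_pos b1 k2; linarith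
  · have := tv_pos b1 k2; linarith
  · have : (0 : ℝ) ≤ u' := Nat.cast_nonneg _; linarith
  · have := tv_pos a1 h2; linarith
  · have : t = t' := by linarith
    subst this
    have := mul_left_cancel₀ a1.ne' e2
    exact ⟨by omega, by exact_mod_cast this⟩
  · linarith
  · linarith
  · have := tv_pos a1 h2; linarith
  · linarith
  · have : t = t' := by linarith
    subst this
    have := mul_left_cancel₀ a1.ne' e2
    exact ⟨by omega, by exact_mod_cast this⟩
  · linarith
  · have : (0 : ℝ) ≤ u := Nat.cast_nonneg _; linarith
  · linarith
  · linarith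
  · have := floor_aux e2 a1 a2 b1 b2
    omega

lemma wseg_avoid {u v w : ℕ} (h : wA u v) {t : ℝ} (ht : t ∈ Ioo (0 : ℝ) 1) (e : wseg u v t = (wx w, wy w)) : False := by
  obtain ⟨a1, a2⟩ := ht
  rcases wseg_form h t with ⟨h1, h2, h3⟩ | ⟨h1, h2, h3⟩ | ⟨h1, h2, h3⟩ | ⟨h1, h2, h3⟩ <;>
  rcases wpos w with ⟨k1, k2, k3⟩ | ⟨k1, k2, k3⟩ | ⟨k1, k2, k3⟩ <;>
  rw [h3, k2, k3, Prod.mk.injEq] at e <;> obtain ⟨e1, e2⟩ := e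
  · linarith
  · linarith
  · have : (2 : ℝ) ≤ w := by exact_mod_cast k1
    linarith
  · linarith
  · linarith
  · linarith
  · linarith
  · linarith
  · linarith
  · linarith
  · linarith
  · have q1 : (u : ℝ) < w := by linarith
    have q2 : (w : ℝ) < u + 1 := by linarith
    have q1' : u < w := by exact_mod_cast q1
    have q2' : w < u + 1 := by exact_mod_cast q2
    omega

lemma wseg_inj {u v : ℕ} (h : wA u v) {t t' : ℝ} (e : wseg u v t = wseg u v t') : t = t' := by
  rcases wseg_form h t with ⟨h1, h2, h3⟩ | ⟨h1, h2, h3⟩ | ⟨h1, h2, h3⟩ | ⟨h1, h2, h3⟩ <;>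
  rcases wseg_form h t' with ⟨k1, k2, k3⟩ | ⟨k1, k2, k3⟩ | ⟨k1, k2, k3⟩ | ⟨k1, k2, k3⟩ <;>
  first
  | (exfalso; omega)
  | (rw [h3, k3, Prod.mk.injEq] at e; obtain ⟨e1, e2⟩ := e; linarith)

lemma wG_edge {n : ℕ} (e : (wG n).edgeSet) : ∃ u v : Fin n, (e : Sym2 (Fin n)) = s(u, v) ∧ wA u v := by
  obtain ⟨e, he⟩ := e
  induction e with
  | _ u v =>
    rcases he with h | h
    · exact ⟨u, v, rfl, h⟩
    · exact ⟨v, u, Sym2.eq_swap, h⟩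

lemma wG_planar (n : ℕ) : (wG n).IsPlanar := by
  choose a b hab hA using wG_edge (n := n)
  refine ⟨fun i => (wx i, wy i), fun e t => wseg (a e) (b e) t, ?_, ?_, ?_, ?_, ?_, ?_⟩
  · intro i j h
    simp only [Prod.mk.injEq] at h
    apply Fin.ext
    rcases wpos i with ⟨h1, h2, h3⟩ | ⟨h1, h2, h3⟩ | ⟨h1, h2, h3⟩ <;>
    rcases wpos j with ⟨k1, k2, k3⟩ | ⟨k1, k2, k3⟩ | ⟨k1, k2, k3⟩ <;>
    rw [h2, k2, h3, k3] at h
    · omega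
    · exfalso; linarith [h.1]
    · exfalso; linarith [h.1]
    · exfalso; linarith [h.1]
    · omega
    · exfalso; linarith [h.1]
    · exfalso; linarith [h.1]
    · exfalso; linarith [h.1]
    · exact_mod_cast h.2
  · intro e
    unfold wseg
    fun_prop
  · intro e t _ t' _ h
    exact wseg_inj (hA e) h
  · intro e
    refine ⟨a e, b e, hab e, ?_, ?_⟩ <;> simp [wseg]
  · intro e t ht v h
    exact wseg_avoid (hA e) ht h
  · intro e₁ e₂ hne t₁ ht₁ t₂ ht₂ h
    obtain ⟨h1, h2⟩ := wseg_disj (hA e₁) (hA e₂) ht₁ ht₂ h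
    apply hne
    apply Subtype.ext
    rw [hab, hab, Fin.ext h1, Fin.ext h2]

/-- endpoints of the `k`-th edge -/
def wa (n k : ℕ) : ℕ := if k < n - 1 then 0 else if k < 2 * n - 3 then 1 else k + 5 - 2 * n
def wb (n k : ℕ) : ℕ := if k < n - 1 then k + 1 else if k < 2 * n - 3 then k + 3 - n else k + 6 - 2 * n

lemma wab {n k : ℕ} (hn : 11 ≤ n) (hk : k < 3 * n - 6) : wA (wa n k) (wb n k) ∧ wb n k < n := by
  unfold wA wa wb
  split_ifs <;> omega

lemma wab_inj {n k l : ℕ} (hn : 11 ≤ n) (h1 : wa n k = wa n l) (h2 : wb n k = wb n l) : k = l := by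
  unfold wa at h1
  unfold wb at h2
  split_ifs at h1 h2 <;> omega

lemma wab_surj {n u v : ℕ} (hn : 11 ≤ n) (h : wA u v) (hv : v < n) : ∃ k < 3 * n - 6, wa n k = u ∧ wb n k = v := by
  unfold wA at h
  by_cases h0 : u = 0
  · refine ⟨v - 1, by omega, ?_, ?_⟩ <;> (first | unfold wa | unfold wb) <;> split_ifs <;> omega
  by_cases h1 : u = 1
  · refine ⟨v + n - 3, by omega, ?_, ?_⟩ <;> (first | unfold wa | unfold wb) <;> split_ifs <;> omega
  · refine ⟨u + 2 * n - 5, by omega, ?_, ?_⟩ <;> (first | unfold wa | unfold wb) <;> split_ifs <;> omega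

/-- the `k`-th edge -/
def we {n : ℕ} (hn : 0 < n) (k : ℕ) : Sym2 (Fin n) :=
  s(⟨wa n k % n, Nat.mod_lt _ hn⟩, ⟨wb n k % n, Nat.mod_lt _ hn⟩)

lemma we_eq {n k : ℕ} (hn : 11 ≤ n) (hk : k < 3 * n - 6) (h0 : 0 < n) :
    ∃ u v : Fin n, (u : ℕ) = wa n k ∧ (v : ℕ) = wb n k ∧ we h0 k = s(u, v) ∧ wA u v := by
  obtain ⟨h1, h2⟩ := wab hn hk
  have h3 := h1.lt
  have e1 : wa n k % n = wa n k := Nat.mod_eq_of_lt (by omega)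
  have e2 : wb n k % n = wb n k := Nat.mod_eq_of_lt h2
  refine ⟨⟨wa n k % n, Nat.mod_lt _ h0⟩, ⟨wb n k % n, Nat.mod_lt _ h0⟩, e1, e2, rfl, ?_⟩
  simpa only [e1, e2] using h1

lemma we_inj {n : ℕ} (hn : 11 ≤ n) (h0 : 0 < n) : Set.InjOn (we h0) (Set.Iio (3 * n - 6)) := by
  intro k hk l hl h
  obtain ⟨u, v, h1, h2, h3, h4⟩ := we_eq hn hk h0
  obtain ⟨u', v', k1, k2, k3, k4⟩ := we_eq hn hl h0
  rw [h3, k3, Sym2.eq_iff] at h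
  rcases h with ⟨rfl, rfl⟩ | ⟨rfl, rfl⟩
  · exact wab_inj hn (h1.symm.trans k1) (h2.symm.trans k2)
  · have := h4.lt
    have := k4.lt
    omega

lemma wG_edgeSet {n : ℕ} (hn : 11 ≤ n) (h0 : 0 < n) : (wG n).edgeSet = we h0 '' Set.Iio (3 * n - 6) := by
  ext e
  constructor
  · intro he
    obtain ⟨u, v, h, hA⟩ := wG_edge ⟨e, he⟩
    obtain ⟨k, hk, h1, h2⟩ := wab_surj hn hA v.2
    obtain ⟨u', v', k1, k2, k3, k4⟩ := we_eq hn hk h0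
    refine ⟨k, hk, ?_⟩
    rw [k3]
    have h : e = s(u, v) := h
    rw [h, Fin.ext (k1.trans h1), Fin.ext (k2.trans h2)]
  · rintro ⟨k, hk, rfl⟩
    obtain ⟨u', v', k1, k2, k3, k4⟩ := we_eq hn hk h0
    rw [k3]
    exact Or.inl k4

lemma wG_tri {n : ℕ} (hn : 11 ≤ n) : IsPlaneTriangulation (wG n) := by
  refine ⟨by omega, wG_planar n, ?_⟩
  rw [wG_edgeSet hn (by omega), Set.ncard_image_of_injOn (we_inj hn _), ← Finset.coe_Iio, Set.ncard_coe_finset, Nat.card_Iio]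

lemma threshold_lower {n r : ℕ} (hn : 11 ≤ n) (h : RainbowThreshold n 5 r) : 2 * n + 1 ≤ r := by
  classical
  by_contra hr
  have h0 : 0 < n := by omega
  set K : Finset (Fin n) := {⟨0, by omega⟩, ⟨1, by omega⟩, ⟨3, by omega⟩} with hK
  have mK : ∀ v : Fin n, v ∈ K ↔ (v : ℕ) = 0 ∨ (v : ℕ) = 1 ∨ (v : ℕ) = 3 := by
    intro v; simp [hK, Fin.ext_iff]
  set enc := Fintype.equivFin (Sym2 (Fin n))
  set c : Sym2 (Fin n) → ℕ := fun e => if ∃ v ∈ e, v ∈ K then (enc e : ℕ) + 1 else 0 with hc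
  have htouch : ∀ k < 3 * n - 6, (∃ v ∈ we h0 k, v ∈ K) ↔ k < 2 * n - 1 := by
    intro k hk
    obtain ⟨u, v, h1, h2, h3, h4⟩ := we_eq hn hk h0
    rw [h3]
    have : (∃ w ∈ s(u, v), w ∈ K) ↔ u ∈ K ∨ v ∈ K := by
      simp [Sym2.mem_iff]
    rw [this, mK, mK, h1, h2]
    unfold wa wb
    split_ifs <;> omega
  have hcard : 2 * n ≤ (c '' (wG n).edgeSet).ncard := by
    rw [wG_edgeSet hn h0]
    have h1 : (c ∘ we h0) '' Set.Iio (2 * n) ⊆ c '' (we h0 '' Set.Iio (3 * n - 6)) := by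
      rw [Set.image_comp]
      apply Set.image_mono
      apply Set.image_mono
      apply Set.Iio_subset_Iio
      omega
    have h2 := Set.ncard_le_ncard h1 (Set.Finite.image _ (Set.Finite.image _ (Set.finite_Iio _)))
    rw [Set.ncard_image_of_injOn, ← Finset.coe_Iio, Set.ncard_coe_finset, Nat.card_Iio] at h2
    · exact h2
    · intro k hk l hl e
      simp only [Set.mem_Iio] at hk hl
      have tk := htouch k (by omega)
      have tl := htouch l (by omega)
      simp only [hc, Function.comp, tk, tl] at e
      by_cases q1 : k < 2 * n - 1 <;> by_cases q2 : l < 2 * n - 1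
      · rw [if_pos q1, if_pos q2] at e
        apply we_inj hn h0 (by simp; omega) (by simp; omega)
        apply enc.injective
        apply Fin.ext
        omega
      · rw [if_pos q1, if_neg q2] at e; omega
      · rw [if_neg q1, if_pos q2] at e; omega
      · omega
  obtain ⟨M, ⟨h5, -, hd⟩, hinj⟩ := h (wG n) (wG_tri hn) c (by omega)
  have s1 := Finset.card_filter_add_card_filter_not (s := M) (fun e => ∃ v ∈ e, v ∈ K)
  have s2 : (M.filter (fun e => ¬ ∃ v ∈ e, v ∈ K)).card ≤ 1 := by
    rw [Finset.card_le_one]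
    intro e he e' he'
    rw [Finset.mem_filter] at he he'
    apply hinj he.1 he'.1
    simp only [hc]
    rw [if_neg he.2, if_neg he'.2]
  have s3 : (M.filter (fun e => ∃ v ∈ e, v ∈ K)).card ≤ K.card := by
    have hch : ∀ e : Sym2 (Fin n), (∃ v ∈ e, v ∈ K) → ∃ v, v ∈ e ∧ v ∈ K := fun e h => h
    haveI : Nonempty (Fin n) := ⟨⟨0, h0⟩⟩
    choose! g hg1 hg2 using hch
    apply Finset.card_le_card_of_injOn g
    · intro e he
      rw [Finset.mem_coe, Finset.mem_filter] at he
      exact hg2 e he.2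
    · intro e he e' he' hgg
      rw [Finset.mem_coe, Finset.mem_filter] at he he'
      by_contra hne
      have := hd e he.1 e' he'.1 hne (g e) (hg1 e he.2)
      rw [hgg] at this
      exact this (hg1 e' he'.2)
  have s4 : K.card ≤ 3 := Finset.card_le_three
  omega
end
end

/-- For every integer `n ≥ 11`, the rainbow number of `5K₂` with respect to the class
of plane triangulations on `n` vertices equals `2n + 1`. -/
theorem rb_planeTriangulation_fiveMatching (n : ℕ) (hn : 11 ≤ n) :
    sInf {r : ℕ | RainbowThreshold n 5 r} = 2 * n + 1 := by
  apply le_antisymm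
  · exact Nat.sInf_le (threshold_upper hn)
  · have h : sInf {r : ℕ | RainbowThreshold n 5 r} ∈ {r : ℕ | RainbowThreshold n 5 r} :=
      Nat.sInf_mem ⟨_, threshold_upper hn⟩
    exact threshold_lower hn h
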